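/- arXiv:math/0304121 — 5 statements merged into one kernel-verified Lean document; each statement's English description precedes it below -/
import Mathlib

section
/- Let f = (x−t)(x+t)(y−t)(y+t)(z−t)(z+t)(x+y+z+t)(x+y+z−3t) ∈ ℚ[x,y,z,t] (arrangement no. 84) and let Jf and I_eq be its Jacobian ideal and equisingular ideal. Then the degree-8 homogeneous component of I_eq equals the degree-8 homogeneous component of Jf; equivalently, dim_ℚ (I_eq/Jf)^(8) = 0, i.e., the octic arrangement no. 84 admits no nontrivial equisingular deformations and the associated double octic Calabi–Yau threefold is rigid. -/
/-!
Rigidity of the double octic of arrangement no. 84: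
for `f = (x−t)(x+t)(y−t)(y+t)(z−t)(z+t)(x+y+z+t)(x+y+z−3t)` the degree-8 homogeneous
component of the equisingular ideal `I_eq` equals that of the Jacobian ideal
`Jf`, i.e. `dim_ℚ (I_eq/Jf)^(8) = 0`.
-/

noncomputable section

open Matrix MvPolynomial

namespace Octic84

/-- `R = ℚ[x,y,z,t]` -/
abbrev R : Type := MvPolynomial (Fin 4) ℚ

/-- The linear polynomial with coefficient vector `a`. -/
def lin (a : Fin 4 → ℚ) : R := ∑ j, C (a j) * X j

/-- Coefficient vectors of the eight planes `x−t, x+t, y−t, y+t, z−t, z+t, x+y+z+t, x+y+z−3t`. -/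
def c : Fin 8 → Fin 4 → ℚ :=
  ![![1,0,0,-1], ![1,0,0,1], ![0,1,0,-1], ![0,1,0,1],
    ![0,0,1,-1], ![0,0,1,1], ![1,1,1,1], ![1,1,1,-3]]

/-- The octic `f = (x−t)(x+t)(y−t)(y+t)(z−t)(z+t)(x+y+z+t)(x+y+z−3t)`. -/
def f : R := ∏ i, lin (c i)

/-- The Jacobian ideal of `f`. -/
def Jf : Ideal R :=
  Ideal.span {pderiv 0 f, pderiv 1 f, pderiv 2 f, pderiv 3 f}

/-- `m(P)`: the number of the eight planes through the point `v`. -/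
def m (v : Fin 4 → ℚ) : ℕ := {i : Fin 8 | c i ⬝ᵥ v = 0}.ncard

/-- `m(ℓᵢ,ℓⱼ)`: the number of the eight factors lying in the pencil spanned by
`ℓᵢ` and `ℓⱼ` (the multiplicity of `f` along the line `ℓᵢ = ℓⱼ = 0`). -/
def mLine (i j : Fin 8) : ℕ :=
  {k : Fin 8 | c k ∈ Submodule.span ℚ ({c i, c j} : Set (Fin 4 → ℚ))}.ncard

/-- `I_P`: the ideal of the point `v`, generated by all linear forms
vanishing at `v`. -/
def IP (v : Fin 4 → ℚ) : Ideal R :=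
  Ideal.span (lin '' {a : Fin 4 → ℚ | a ⬝ᵥ v = 0})

/-- The equisingular ideal
`I_eq = ⋂ ((ℓ,ℓ′)^{m(ℓ,ℓ′)} + Jf) ∩ ⋂ (I_P^{m(P)} + Jf)`, the first
intersection over all pairs of linearly independent factors, the second over
all points of `ℙ³(ℚ)` lying on at least three of the eight planes. -/
def Ieq : Ideal R :=
  (⨅ (i : Fin 8) (j : Fin 8) (_ : LinearIndependent ℚ ![c i, c j]),
      (Ideal.span {lin (c i), lin (c j)} ^ mLine i j + Jf)) ⊓
  (⨅ (v : Fin 4 → ℚ) (_ : v ≠ 0) (_ : 3 ≤ m v), (IP v ^ m v + Jf))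

lemma lin_add (a b : Fin 4 → ℚ) : lin (a + b) = lin a + lin b := by
  simp [lin, add_mul, Finset.sum_add_distrib]

lemma lin_smul (r : ℚ) (a : Fin 4 → ℚ) : lin (r • a) = C r * lin a := by
  simp [lin, Finset.mul_sum, mul_assoc]

/-- `lin` as a linear map. -/
def linHom : (Fin 4 → ℚ) →ₗ[ℚ] R where
  toFun := lin
  map_add' := lin_add
  map_smul' r a := by rw [lin_smul, RingHom.id_apply, smul_eq_C_mul]

@[simp] lemma linHom_apply (a : Fin 4 → ℚ) : linHom a = lin a := rfl

lemma lin_single (k : Fin 4) : lin (Pi.single k 1) = X k := by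
  simp [lin, Pi.single_apply]

lemma coeff_lin (a : Fin 4 → ℚ) (k : Fin 4) : coeff (Finsupp.single k 1) (lin a) = a k := by
  simp [lin, coeff_sum, coeff_C_mul, coeff_X, Finsupp.single_left_inj]

lemma lin_eq_zero {a : Fin 4 → ℚ} (h : lin a = 0) : a = 0 := by
  ext k
  rw [← coeff_lin a k, h, coeff_zero, Pi.zero_apply]

lemma isHomogeneous_lin (a : Fin 4 → ℚ) : (lin a).IsHomogeneous 1 :=
  IsHomogeneous.sum _ _ _ fun _ _ => isHomogeneous_C_mul_X _ _

lemma exists_eq_lin {p : R} (hp : p.IsHomogeneous 1) : ∃ a, p = lin a := by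
  rw [← mem_homogeneousSubmodule, homogeneousSubmodule_one_eq_span_X,
    Submodule.mem_span_range_iff_exists_fun] at hp
  obtain ⟨a, rfl⟩ := hp
  exact ⟨a, by simp [lin, smul_eq_C_mul]⟩

lemma aeval_lin {A : Type*} [CommRing A] [Algebra ℚ A] (g : Fin 4 → A) (a : Fin 4 → ℚ) :
    aeval g (lin a) = ∑ k, algebraMap ℚ A (a k) * g k := by
  simp [lin]

/-- The ideal of a linear subspace is the kernel of a substitution of linear forms, and its
linear forms are those of the defining subspace. -/
lemma exists_algHom_ker (W : Submodule ℚ (Fin 4 → ℚ)) :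
    ∃ φ : R →ₐ[ℚ] R, RingHom.ker φ = Ideal.span (lin '' W) ∧ ∀ v, φ (lin v) = 0 → v ∈ W := by
  obtain ⟨V, hV⟩ := Submodule.exists_isCompl W
  let π : (Fin 4 → ℚ) →ₗ[ℚ] (Fin 4 → ℚ) := V.subtype ∘ₗ V.projectionOnto W hV.symm
  have hker : ∀ v, π v = 0 ↔ v ∈ W := by
    intro v
    simp [π]
  have hsub : ∀ v, π v - v ∈ W := by
    intro v
    rw [← hker, map_sub, sub_eq_zero]
    simp [π]
  let φ : R →ₐ[ℚ] R := aeval fun k => lin (π (Pi.single k 1))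
  have hφ : ∀ v, φ (lin v) = lin (π v) := by
    have : φ.toLinearMap ∘ₗ linHom = linHom ∘ₗ π := by
      ext k : 2
      simp [φ, lin_single]
    exact fun v => LinearMap.congr_fun this v
  have hmod : ∀ p, φ p - p ∈ Ideal.span (lin '' (W : Set (Fin 4 → ℚ))) := by
    intro p
    rw [← Ideal.Quotient.eq]
    have : (Ideal.Quotient.mkₐ ℚ (Ideal.span (lin '' (W : Set (Fin 4 → ℚ))))).comp φ =
        Ideal.Quotient.mkₐ ℚ _ := by
      ext k
      simp only [AlgHom.comp_apply, Ideal.Quotient.mkₐ_eq_mk, Ideal.Quotient.eq]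
      refine Ideal.subset_span ⟨_, hsub (Pi.single k 1), ?_⟩
      rw [← linHom_apply, map_sub, linHom_apply, linHom_apply, lin_single, aeval_X]
    exact DFunLike.congr_fun this p
  refine ⟨φ, le_antisymm (fun p hp => ?_) (Ideal.span_le.2 ?_), fun v hv => ?_⟩
  · have := hmod p
    rw [RingHom.mem_ker] at hp
    rw [hp, zero_sub] at this
    exact neg_mem_iff.1 this
  · rintro _ ⟨w, hw, rfl⟩
    rw [SetLike.mem_coe, RingHom.mem_ker, hφ, (hker w).2 hw, ← linHom_apply, map_zero]
  · rw [hφ] at hv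
    exact (hker v).1 (lin_eq_zero hv)

lemma span_lin_isPrime (W : Submodule ℚ (Fin 4 → ℚ)) : (Ideal.span (lin '' W)).IsPrime := by
  obtain ⟨φ, h, -⟩ := exists_algHom_ker W
  exact h ▸ RingHom.ker_isPrime _

lemma mem_of_lin_mem_span {W : Submodule ℚ (Fin 4 → ℚ)} {v : Fin 4 → ℚ}
    (h : lin v ∈ Ideal.span (lin '' W)) : v ∈ W := by
  obtain ⟨φ, h', h''⟩ := exists_algHom_ker W
  rw [← h', RingHom.mem_ker] at h
  exact h'' v h

lemma span_lin_span (s : Set (Fin 4 → ℚ)) :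
    Ideal.span (lin '' (Submodule.span ℚ s : Set (Fin 4 → ℚ))) = Ideal.span (lin '' s) := by
  refine le_antisymm (Ideal.span_le.2 ?_) (Ideal.span_mono (Set.image_mono Submodule.subset_span))
  rintro _ ⟨v, hv, rfl⟩
  induction hv using Submodule.span_induction with
  | mem x hx => exact Ideal.subset_span ⟨x, hx, rfl⟩
  | zero => rw [← linHom_apply, map_zero]; exact zero_mem _
  | add x y _ _ hx hy => rw [lin_add]; exact add_mem hx hy
  | smul r x _ hx => rw [lin_smul]; exact Ideal.mul_mem_left _ _ hx

lemma span_pair_isPrime (a b : Fin 4 → ℚ) : (Ideal.span {lin a, lin b}).IsPrime := by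
  have := span_lin_isPrime (Submodule.span ℚ {a, b})
  rwa [span_lin_span, Set.image_pair] at this

lemma lin_mem_span_pair {a b v : Fin 4 → ℚ} (h : lin v ∈ Ideal.span {lin a, lin b}) :
    v ∈ Submodule.span ℚ {a, b} := by
  apply mem_of_lin_mem_span
  rwa [span_lin_span, Set.image_pair]

/-- A polynomial vanishing on all pairwise intersections of planes, no three of which share a
line, is a combination of the products omitting one plane. -/
lemma exists_sum_mul_prod_erase {ι : Type*} [DecidableEq ι] {d : ι → Fin 4 → ℚ} {S : Finset ι}
    (hd : ∀ i ∈ S, ∀ j ∈ S, ∀ k ∈ S, i ≠ j → k ≠ i → k ≠ j → d k ∉ Submodule.span ℚ {d i, d j})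
    {g : R} (hg : ∀ i ∈ S, ∀ j ∈ S, i ≠ j → g ∈ Ideal.span {lin (d i), lin (d j)}) :
    ∃ (h : ι → R) (u : R),
      g = ∑ i ∈ S, h i * ∏ j ∈ S.erase i, lin (d j) + u * ∏ j ∈ S, lin (d j) := by
  induction S using Finset.induction_on with
  | empty => exact ⟨0, g, by simp⟩
  | insert a S ha ih =>
    obtain ⟨h, u, hu⟩ := ih
      (fun i hi j hj k hk => hd i (Finset.mem_insert_of_mem hi) j (Finset.mem_insert_of_mem hj) k
        (Finset.mem_insert_of_mem hk))
      (fun i hi j hj => hg i (Finset.mem_insert_of_mem hi) j (Finset.mem_insert_of_mem hj))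
    have key : ∀ i ∈ S, h i ∈ Ideal.span {lin (d i), lin (d a)} := by
      intro i hi
      have hia : i ≠ a := fun e => ha (e ▸ hi)
      have hP := span_pair_isPrime (d i) (d a)
      have hli : lin (d i) ∈ Ideal.span {lin (d i), lin (d a)} := Ideal.subset_span (by simp)
      have hgi := hg i (Finset.mem_insert_of_mem hi) a (Finset.mem_insert_self _ _) hia
      rw [hu, ← Finset.add_sum_erase _ _ hi, add_assoc] at hgi
      have hrest : ∑ x ∈ S.erase i, h x * ∏ j ∈ S.erase x, lin (d j) + u * ∏ j ∈ S, lin (d j) ∈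
          Ideal.span {lin (d i), lin (d a)} := by
        refine add_mem (sum_mem fun x hx => ?_) ?_
        · exact Ideal.mul_mem_left _ _ (Ideal.mem_of_dvd _ (Finset.dvd_prod_of_mem _
            (Finset.mem_erase.2 ⟨(Finset.ne_of_mem_erase hx).symm, hi⟩)) hli)
        · exact Ideal.mul_mem_left _ _ (Ideal.mem_of_dvd _ (Finset.dvd_prod_of_mem _ hi) hli)
      rw [Ideal.add_mem_iff_left _ hrest] at hgi
      refine (hP.mem_or_mem hgi).resolve_right fun hprod => ?_
      obtain ⟨k, hk, hk'⟩ := hP.prod_mem_iff.1 hprod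
      obtain ⟨hki, hkS⟩ := Finset.mem_erase.1 hk
      exact hd i (Finset.mem_insert_of_mem hi) a (Finset.mem_insert_self _ _) k
        (Finset.mem_insert_of_mem hkS) hia hki (fun e => ha (e ▸ hkS)) (lin_mem_span_pair hk')
    have key' : ∀ i, ∃ p q : R, i ∈ S → p * lin (d i) + q * lin (d a) = h i := by
      intro i
      by_cases hi : i ∈ S
      · obtain ⟨p, q, e⟩ := Ideal.mem_span_pair.1 (key i hi)
        exact ⟨p, q, fun _ => e⟩
      · exact ⟨0, 0, fun h => absurd h hi⟩
    choose p q hpq using key'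
    refine ⟨fun i => if i = a then ∑ i ∈ S, p i + u else q i, 0, ?_⟩
    beta_reduce
    rw [zero_mul, add_zero, Finset.sum_insert ha, if_pos rfl, Finset.erase_insert ha, hu, add_mul,
      add_right_comm, Finset.sum_mul, ← Finset.sum_add_distrib]
    congr 1
    refine Finset.sum_congr rfl fun i hi => ?_
    have hia : i ≠ a := fun e => ha (e ▸ hi)
    rw [if_neg hia, Finset.erase_insert_of_ne hia.symm,
      Finset.prod_insert (fun h => ha (Finset.mem_of_mem_erase h)), ← hpq i hi,
      ← Finset.mul_prod_erase S (fun j => lin (d j)) hi]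
    ring

/-- The product of all the linear factors but the `i`-th. -/
def cofactor (i : Fin 8) : R := ∏ j ∈ Finset.univ.erase i, lin (c j)

lemma lin_mul_cofactor (i : Fin 8) : lin (c i) * cofactor i = f :=
  Finset.mul_prod_erase _ (fun j => lin (c j)) (Finset.mem_univ i)

lemma isHomogeneous_cofactor (i : Fin 8) : (cofactor i).IsHomogeneous 7 := by
  have := IsHomogeneous.prod (Finset.univ.erase i) (fun j => lin (c j)) (fun _ => 1)
    (fun j _ => isHomogeneous_lin _)
  simpa [cofactor, Finset.card_erase_of_mem] using this

lemma pderiv_lin (k : Fin 4) (a : Fin 4 → ℚ) : pderiv k (lin a) = C (a k) := by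
  simp [lin, pderiv_X, Pi.single_apply]

lemma pderiv_f (k : Fin 4) : pderiv k f = ∑ i, C (c i k) * cofactor i := by
  have : ∀ S : Finset (Fin 8), pderiv k (∏ i ∈ S, lin (c i)) =
      ∑ i ∈ S, C (c i k) * ∏ j ∈ S.erase i, lin (c j) := by
    intro S
    induction S using Finset.induction_on with
    | empty => simp
    | insert a S ha ih =>
      rw [Finset.prod_insert ha, Derivation.leibniz, ih, Finset.sum_insert ha,
        Finset.erase_insert ha, pderiv_lin, smul_eq_mul, smul_eq_mul, add_comm, Finset.mul_sum,
        mul_comm (C (c a k))]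
      congr 1
      refine Finset.sum_congr rfl fun i hi => ?_
      have hia : i ≠ a := fun e => ha (e ▸ hi)
      rw [Finset.erase_insert_of_ne hia.symm,
        Finset.prod_insert (fun h => ha (Finset.mem_of_mem_erase h))]
      ring
  exact this _

lemma Jf_eq : Jf = Ideal.span (Set.range fun k => pderiv k f) := by
  rw [Jf]
  congr 1
  ext p
  simp [Fin.exists_fin_succ, eq_comm]

lemma pderiv_mem_Jf (k : Fin 4) : pderiv k f ∈ Jf := by
  rw [Jf_eq]
  exact Ideal.subset_span ⟨k, rfl⟩

lemma exists_of_mem_Jf {p : R} (hp : p ∈ Jf) :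
    ∃ Q : Fin 4 → R, p = ∑ i, (∑ k, C (c i k) * Q k) * cofactor i := by
  rw [Jf_eq, Ideal.mem_span_range_iff_exists_fun] at hp
  obtain ⟨Q, rfl⟩ := hp
  refine ⟨Q, ?_⟩
  simp_rw [pderiv_f, Finset.mul_sum, Finset.sum_mul]
  rw [Finset.sum_comm]
  exact Finset.sum_congr rfl fun i _ => Finset.sum_congr rfl fun k _ => by ring

lemma sum_mul_cofactor_mem_Jf (Q : Fin 4 → R) :
    ∑ i, (∑ k, C (c i k) * Q k) * cofactor i ∈ Jf := by
  have : ∑ i, (∑ k, C (c i k) * Q k) * cofactor i = ∑ k, Q k * pderiv k f := by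
    simp_rw [pderiv_f, Finset.mul_sum, Finset.sum_mul]
    rw [Finset.sum_comm]
    exact Finset.sum_congr rfl fun i _ => Finset.sum_congr rfl fun k _ => by ring
  rw [this]
  exact sum_mem fun k _ => Ideal.mul_mem_left _ _ (pderiv_mem_Jf k)

/-- The Euler formula puts `f` in its Jacobian ideal. -/
lemma f_mem_Jf : f ∈ Jf := by
  have h := sum_mul_cofactor_mem_Jf X
  have e : ∑ i, (∑ k, C (c i k) * X k) * cofactor i = C 8 * f := by
    change ∑ i, lin (c i) * cofactor i = _
    simp_rw [lin_mul_cofactor, Finset.sum_const, Finset.card_univ, Fintype.card_fin, nsmul_eq_mul]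
    rfl
  rw [e] at h
  have := Ideal.mul_mem_left _ (C (1 / 8)) h
  rwa [← mul_assoc, ← C_mul, one_div, inv_mul_cancel₀ (by norm_num), C_1, one_mul] at this

lemma Jf_le_span_pair {i j : Fin 8} (hij : i ≠ j) : Jf ≤ Ideal.span {lin (c i), lin (c j)} := by
  intro p hp
  obtain ⟨Q, rfl⟩ := exists_of_mem_Jf hp
  refine sum_mem fun k _ => Ideal.mul_mem_left _ _ ?_
  by_cases hk : k = i
  · exact Ideal.mem_of_dvd _ (Finset.dvd_prod_of_mem _
      (Finset.mem_erase.2 ⟨fun h => hij (hk ▸ h.symm), Finset.mem_univ j⟩))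
      (Ideal.subset_span (by simp))
  · exact Ideal.mem_of_dvd _ (Finset.dvd_prod_of_mem _
      (Finset.mem_erase.2 ⟨fun h => hk h.symm, Finset.mem_univ i⟩)) (Ideal.subset_span (by simp))

lemma exists_minor_ne_zero : ∀ i j : Fin 8, i ≠ j → ∃ p q : Fin 4,
    c i p * c j q - c i q * c j p ≠ 0 := by
  decide +kernel

lemma exists_minor_three_ne_zero : ∀ i j k : Fin 8, i ≠ j → k ≠ i → k ≠ j → ∃ p q r : Fin 4,
    c i p * (c j q * c k r - c j r * c k q) - c i q * (c j p * c k r - c j r * c k p)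
      + c i r * (c j p * c k q - c j q * c k p) ≠ 0 := by
  decide +kernel

lemma linearIndependent_pair {i j : Fin 8} (hij : i ≠ j) : LinearIndependent ℚ ![c i, c j] := by
  obtain ⟨p, q, h⟩ := exists_minor_ne_zero i j hij
  rw [LinearIndependent.pair_iff]
  intro s t hst
  have hp := congrFun hst p
  have hq := congrFun hst q
  simp only [Pi.add_apply, Pi.smul_apply, smul_eq_mul, Pi.zero_apply] at hp hq
  constructor
  · refine (mul_eq_zero.1 ?_).resolve_right h
    linear_combination c j q * hp - c j p * hq
  · refine (mul_eq_zero.1 ?_).resolve_right h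
    linear_combination c i p * hq - c i q * hp

lemma notMem_span_pair {i j k : Fin 8} (hij : i ≠ j) (hki : k ≠ i) (hkj : k ≠ j) :
    c k ∉ Submodule.span ℚ {c i, c j} := by
  intro h
  obtain ⟨s, t, hst⟩ := Submodule.mem_span_pair.1 h
  obtain ⟨p, q, r, hpqr⟩ := exists_minor_three_ne_zero i j k hij hki hkj
  apply hpqr
  simp only [← hst, Pi.add_apply, Pi.smul_apply, smul_eq_mul]
  ring

lemma mLine_ne_zero (i j : Fin 8) : mLine i j ≠ 0 := by
  refine Set.ncard_ne_zero_of_mem (a := i) ?_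
  exact Submodule.subset_span (Set.mem_insert _ _)

lemma mem_span_pair_of_mem_Ieq {g : R} (hg : g ∈ Ieq) {i j : Fin 8} (hij : i ≠ j) :
    g ∈ Ideal.span {lin (c i), lin (c j)} := by
  have h := (Submodule.mem_inf.1 hg).1
  simp only [Submodule.mem_iInf] at h
  exact sup_le (Ideal.pow_le_self (mLine_ne_zero i j)) (Jf_le_span_pair hij)
    (h i j (linearIndependent_pair hij))

/-- The part of degree `n` of a multiple of a form. -/
lemma homogeneousComponent_mul_of_isHomogeneous {p q : R} {n k : ℕ} (hq : q.IsHomogeneous k) :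
    homogeneousComponent (n + k) (p * q) = homogeneousComponent n p * q := by
  conv_lhs => rw [← sum_homogeneousComponent p, Finset.sum_mul, map_sum]
  have : ∀ i, homogeneousComponent (n + k) (homogeneousComponent i p * q) =
      if i = n then homogeneousComponent n p * q else 0 := by
    intro i
    rw [homogeneousComponent_of_mem
      ((mem_homogeneousSubmodule _ _).2 ((homogeneousComponent_isHomogeneous i p).mul hq))]
    by_cases h : i = n
    · simp [h]
    · rw [if_neg (by omega), if_neg h]
  simp_rw [this, Finset.sum_ite_eq', Finset.mem_range]
  split_ifs with h
  · rfl
  · rw [homogeneousComponent_eq_zero _ _ (by omega), zero_mul]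

/-- Octics vanishing along the double lines are first-order deformations of `f` moving the
planes. -/
lemma exists_eq_sum_lin_mul_cofactor {g : R} (hg : g ∈ Ieq) (h8 : g.IsHomogeneous 8) :
    ∃ b : Fin 8 → Fin 4 → ℚ, g = ∑ i, lin (b i) * cofactor i := by
  obtain ⟨h, u, hgu⟩ := exists_sum_mul_prod_erase (d := c) (S := Finset.univ)
    (fun i _ j _ k _ => notMem_span_pair) (fun i _ j _ => mem_span_pair_of_mem_Ieq hg)
  let h' : Fin 8 → R := fun i => h i + if i = 0 then u * lin (c 0) else 0
  have e : g = ∑ i, h' i * cofactor i := by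
    simp only [h', add_mul, Finset.sum_add_distrib, ite_mul, zero_mul, Finset.sum_ite_eq',
      Finset.mem_univ, if_true, mul_assoc, lin_mul_cofactor]
    exact hgu
  have hb : ∀ i, ∃ b, homogeneousComponent 1 (h' i) = lin b := fun i =>
    exists_eq_lin (homogeneousComponent_isHomogeneous 1 _)
  choose b hb using hb
  refine ⟨b, ?_⟩
  rw [← homogeneousComponent_eq_self h8, e, map_sum]
  exact Finset.sum_congr rfl fun i _ => by
    rw [← hb, ← homogeneousComponent_mul_of_isHomogeneous (isHomogeneous_cofactor i)]

/-- For each `i`, a vector in the `i`-th plane and in no other plane. -/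
def dir : Fin 8 → Fin 4 → ℚ :=
  ![![-1,0,0,-1], ![-1,-2,0,1], ![0,-1,0,-1], ![-2,-1,0,1],
    ![0,0,-1,-1], ![-2,0,-1,1], ![-1,-1,0,2], ![-3,0,0,-1]]

lemma c_dotProduct_dir : ∀ i j : Fin 8, c j ⬝ᵥ dir i = 0 ↔ j = i := by
  decide +kernel

/-- Restriction of polynomials to the line through `v` with direction `w`. -/
def toLine (v w : Fin 4 → ℚ) : R →ₐ[ℚ] Polynomial ℚ :=
  aeval fun k => Polynomial.C (v k) + Polynomial.X * Polynomial.C (w k)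

lemma toLine_lin (v w a : Fin 4 → ℚ) :
    toLine v w (lin a) = Polynomial.C (a ⬝ᵥ v) + Polynomial.X * Polynomial.C (a ⬝ᵥ w) := by
  simp only [toLine, aeval_lin, dotProduct, map_sum, map_mul, Finset.mul_sum,
    ← Finset.sum_add_distrib]
  exact Finset.sum_congr rfl fun k _ => by
    change Polynomial.C _ * _ = _
    ring

lemma X_dvd_toLine {v w : Fin 4 → ℚ} {p : R} : Polynomial.X ∣ toLine v w p ↔ eval v p = 0 := by
  rw [Polynomial.X_dvd_iff, Polynomial.coeff_zero_eq_eval_zero]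
  have : (Polynomial.evalRingHom 0).comp (toLine v w : R →+* Polynomial ℚ) = eval v := by
    ext <;> simp [toLine]
  exact iff_of_eq (congrArg (· = 0) (RingHom.congr_fun this p))

lemma X_pow_dvd_toLine {v w : Fin 4 → ℚ} {p : R} {n : ℕ} (hp : p ∈ IP v ^ n) :
    Polynomial.X ^ n ∣ toLine v w p := by
  have h1 : (IP v).map (toLine v w) ≤ Ideal.span {Polynomial.X} := by
    rw [IP, Ideal.map_span, Ideal.span_le]
    rintro _ ⟨_, ⟨a, ha, rfl⟩, rfl⟩
    rw [Set.mem_ofPred_eq] at ha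
    rw [SetLike.mem_coe, Ideal.mem_span_singleton, toLine_lin, ha, map_zero, zero_add]
    exact dvd_mul_right _ _
  have h2 := Ideal.pow_right_mono h1 n (Ideal.map_pow (toLine v w) (IP v) n ▸
    Ideal.mem_map_of_mem (toLine v w) hp)
  rwa [Ideal.span_singleton_pow, Ideal.mem_span_singleton] at h2

/-- Along a line through `v` inside the `i`-th plane and no other, the `i`-th cofactor vanishes
at `v` to order exactly `m v - 1`. -/
lemma exists_toLine_cofactor {v : Fin 4 → ℚ} {i : Fin 8} (hi : c i ⬝ᵥ v = 0) :
    ∃ U : Polynomial ℚ, ¬ Polynomial.X ∣ U ∧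
      ∃ n, n + 1 = m v ∧ toLine v (dir i) (cofactor i) = Polynomial.X ^ n * U := by
  classical
  let A : Finset (Fin 8) := (Finset.univ.erase i).filter fun j => c j ⬝ᵥ v = 0
  let B : Finset (Fin 8) := (Finset.univ.erase i).filter fun j => ¬ c j ⬝ᵥ v = 0
  refine ⟨(∏ j ∈ A, Polynomial.C (c j ⬝ᵥ dir i)) * ∏ j ∈ B, toLine v (dir i) (lin (c j)), ?_,
    A.card, ?_, ?_⟩
  · intro h
    rcases Polynomial.prime_X.dvd_or_dvd h with h | h
    · obtain ⟨j, hj, h⟩ := (Polynomial.prime_X.dvd_finsetProd_iff _).1 h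
      rw [Polynomial.X_dvd_iff, Polynomial.coeff_C_zero, c_dotProduct_dir] at h
      simp [A, h] at hj
    · obtain ⟨j, hj, h⟩ := (Polynomial.prime_X.dvd_finsetProd_iff _).1 h
      rw [X_dvd_toLine] at h
      simp only [B, Finset.mem_filter] at hj
      apply hj.2
      simpa [lin, dotProduct] using h
  · have : A = (Finset.univ.filter fun j => c j ⬝ᵥ v = 0).erase i := by
      ext j
      simp [A]
    rw [this, Finset.card_erase_add_one (by simpa using hi), m, Set.ncard_eq_toFinset_card']
    congr 1
    ext j
    simp
  · rw [← mul_assoc, ← Finset.prod_const, ← Finset.prod_mul_distrib, cofactor, map_prod,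
      ← Finset.prod_filter_mul_prod_filter_not _ (fun j => c j ⬝ᵥ v = 0)]
    congr 1
    refine Finset.prod_congr rfl fun j hj => ?_
    rw [toLine_lin, (Finset.mem_filter.1 hj).2, map_zero, zero_add]

lemma eval_lin (v a : Fin 4 → ℚ) : eval v (lin a) = a ⬝ᵥ v := by
  simp [lin, dotProduct]

lemma toLine_cofactor_of_ne {v : Fin 4 → ℚ} {i j : Fin 8} (hi : c i ⬝ᵥ v = 0) (hij : j ≠ i) :
    toLine v (dir i) (cofactor j) = 0 := by
  rw [cofactor, map_prod]
  refine Finset.prod_eq_zero (Finset.mem_erase.2 ⟨hij.symm, Finset.mem_univ i⟩) ?_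
  rw [toLine_lin, hi, (c_dotProduct_dir i i).2 rfl]
  simp

lemma eval_eq_zero_of_sum_mem {v : Fin 4 → ℚ} {h : Fin 8 → R}
    (hh : ∑ i, h i * cofactor i ∈ IP v ^ m v) {i : Fin 8} (hi : c i ⬝ᵥ v = 0) :
    eval v (h i) = 0 := by
  have h1 := X_pow_dvd_toLine (w := dir i) hh
  rw [map_sum, Finset.sum_eq_single i
    (fun j _ hj => by rw [map_mul, toLine_cofactor_of_ne hi hj, mul_zero]) (by simp), map_mul] at h1
  obtain ⟨U, hU, n, hn, e⟩ := exists_toLine_cofactor hi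
  rw [e, ← hn, pow_succ, mul_left_comm,
    mul_dvd_mul_iff_left (pow_ne_zero _ Polynomial.X_ne_zero)] at h1
  exact X_dvd_toLine.1 ((Polynomial.prime_X.dvd_or_dvd h1).resolve_right hU)

/-- Near a multiple point, an equisingular deformation is, to first order, a translation. -/
lemma exists_translation {b : Fin 8 → Fin 4 → ℚ} (hb : ∑ i, lin (b i) * cofactor i ∈ Ieq)
    {v : Fin 4 → ℚ} (hv : v ≠ 0) (hm : 3 ≤ m v) :
    ∃ q : Fin 4 → ℚ, ∀ i, c i ⬝ᵥ v = 0 → b i ⬝ᵥ v = c i ⬝ᵥ q := by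
  have h := (Submodule.mem_inf.1 hb).2
  simp only [Submodule.mem_iInf] at h
  obtain ⟨p, hp, r, hr, e⟩ := Submodule.mem_sup.1 (h v hv hm)
  obtain ⟨Q, rfl⟩ := exists_of_mem_Jf hr
  rw [← eq_sub_iff_add_eq, ← Finset.sum_sub_distrib] at e
  simp_rw [← sub_mul] at e
  rw [e] at hp
  refine ⟨fun k => eval v (Q k), fun i hi => ?_⟩
  have := eval_eq_zero_of_sum_mem hp hi
  rw [map_sub, sub_eq_zero, eval_lin] at this
  simpa [dotProduct] using this

lemma sum_smul_dotProduct_eq_zero {b : Fin 8 → Fin 4 → ℚ}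
    (hb : ∑ i, lin (b i) * cofactor i ∈ Ieq) {v : Fin 4 → ℚ} (hv : v ≠ 0) (hm : 3 ≤ m v)
    {r : Fin 8 → ℚ} (hr : ∀ i, r i = 0 ∨ c i ⬝ᵥ v = 0) (hrc : ∀ k, ∑ i, r i * c i k = 0) :
    ∑ i, r i * (b i ⬝ᵥ v) = 0 := by
  obtain ⟨q, hq⟩ := exists_translation hb hv hm
  calc ∑ i, r i * (b i ⬝ᵥ v) = ∑ i, r i * (c i ⬝ᵥ q) := by
        refine Finset.sum_congr rfl fun i _ => ?_
        rcases hr i with h | h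
        · simp [h]
        · rw [hq i h]
    _ = ∑ k, (∑ i, r i * c i k) * q k := by
        simp_rw [dotProduct, Finset.mul_sum, Finset.sum_mul]
        rw [Finset.sum_comm]
        exact Finset.sum_congr rfl fun i _ => Finset.sum_congr rfl fun k _ => by ring
    _ = 0 := by simp [hrc]

lemma m_eq_card (v : Fin 4 → ℚ) : m v = (Finset.univ.filter fun i => c i ⬝ᵥ v = 0).card := by
  rw [m, Set.ncard_eq_toFinset_card']
  congr 1
  ext j
  simp

/-- The ten fourfold points of the arrangement. -/
def pt : Fin 10 → Fin 4 → ℚ :=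
  ![![1,1,1,1], ![1,-1,-1,1], ![-1,1,-1,1], ![-1,-1,1,1], ![0,1,-1,0], ![1,0,-1,0], ![1,-1,0,0],
    ![0,0,1,0], ![0,1,0,0], ![1,0,0,0]]

/-- The linear relations between the planes through the fourfold points. -/
def rel : Fin 10 → Fin 8 → ℚ :=
  ![![1,0,1,0,1,0,0,-1], ![1,0,0,1,0,1,-1,0], ![0,1,1,0,0,1,-1,0], ![0,1,0,1,1,0,-1,0],
    ![2,-2,0,0,0,0,1,-1], ![0,0,2,-2,0,0,1,-1], ![0,0,0,0,2,-2,1,-1],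
    ![1,-1,-1,1,0,0,0,0], ![1,-1,0,0,-1,1,0,0], ![0,0,1,-1,-1,1,0,0]]

lemma pt_spec : ∀ n, pt n ≠ 0 ∧ 3 ≤ (Finset.univ.filter fun i => c i ⬝ᵥ pt n = 0).card ∧
    (∀ i, rel n i = 0 ∨ c i ⬝ᵥ pt n = 0) ∧ ∀ k, ∑ i, rel n i * c i k = 0 := by
  decide +kernel

lemma rel_pt {b : Fin 8 → Fin 4 → ℚ} (hb : ∑ i, lin (b i) * cofactor i ∈ Ieq) (n : Fin 10) :
    ∑ i, rel n i * (b i ⬝ᵥ pt n) = 0 := by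
  obtain ⟨h1, h2, h3, h4⟩ := pt_spec n
  exact sum_smul_dotProduct_eq_zero hb h1 (m_eq_card _ ▸ h2) h3 h4

set_option maxHeartbeats 2000000 in
/-- The conditions at the fourfold points leave only infinitesimal linear coordinate changes. -/
lemma exists_matrix {b : Fin 8 → Fin 4 → ℚ} (h : ∀ n, ∑ i, rel n i * (b i ⬝ᵥ pt n) = 0) :
    ∃ (M : Fin 4 → Fin 4 → ℚ) (s : Fin 8 → ℚ), ∀ i, b i = ∑ l, c i l • M l + s i • c i := by
  refine ⟨![![b 0 0 + (b 3 0 - b 2 0) / 2,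
        (b 0 1 + b 1 1) / 2,
        b 0 2 + (b 3 2 - b 2 2) / 2,
        (b 0 0 + b 0 3 + b 1 3 + b 3 0 - b 1 0 - b 2 0) / 2],
      ![(b 2 0 + b 3 0) / 2,
        (b 0 0 + b 1 3 + b 2 1 + b 2 3 + b 3 0 + b 3 1 - b 0 3 - b 1 0 - b 2 0 - b 3 3) / 2,
        (b 2 2 + b 3 2) / 2,
        (b 1 1 + b 2 1 + b 2 3 + b 3 3 - b 0 1 - b 3 1) / 2],
      ![b 4 0 + (b 3 0 - b 2 0) / 2,
        b 4 1 + (b 1 1 - b 0 1) / 2,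
        (b 0 0 + b 1 3 + b 3 0 + b 4 2 + b 4 3 + b 5 2 - b 0 3 - b 1 0 - b 2 0 - b 5 3) / 2,
        (b 3 2 + b 4 2 + b 4 3 + b 5 3 - b 2 2 - b 5 2) / 2],
      ![(b 3 0 - b 2 0) / 2,
        (b 1 1 - b 0 1) / 2,
        (b 3 2 - b 2 2) / 2,
        (b 0 0 + b 1 3 + b 3 0 - b 0 3 - b 1 0 - b 2 0) / 2]],
      ![0,
      b 1 0 + b 2 0 - b 0 0 - b 3 0,
      (b 0 3 + b 1 0 + b 1 1 + b 2 0 + b 2 1 + b 3 3 - b 0 0 - b 0 1 - b 1 3 - b 2 3 - b 3 0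
        - b 3 1) / 2,
      (b 0 1 + b 0 3 + b 1 0 + b 2 0 + b 3 1 + b 3 3 - b 0 0 - b 1 1 - b 1 3 - b 2 1 - b 2 3
        - b 3 0) / 2,
      (b 0 3 + b 1 0 + b 2 0 + b 3 2 + b 4 2 + b 5 3 - b 0 0 - b 1 3 - b 2 2 - b 3 0 - b 4 3
        - b 5 2) / 2,
      (b 0 3 + b 1 0 + b 2 0 + b 2 2 + b 5 2 + b 5 3 - b 0 0 - b 1 3 - b 3 0 - b 3 2 - b 4 2
        - b 4 3) / 2,
      b 2 0 + b 6 0 - b 0 0 - 2 * b 3 0 - b 4 0,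
      b 7 0 - b 0 0 - b 2 0 - b 4 0], ?_⟩
  have h0 := h 0
  have h1 := h 1
  have h2 := h 2
  have h3 := h 3
  have h4 := h 4
  have h5 := h 5
  have h6 := h 6
  have h7 := h 7
  have h8 := h 8
  have h9 := h 9
  simp [pt, rel, dotProduct, Fin.sum_univ_succ] at h0 h1 h2 h3 h4 h5 h6 h7 h8 h9
  intro i
  ext k
  fin_cases i <;> fin_cases k <;> simp [c, Fin.sum_univ_succ] <;> linarith

/-- The degree-8 homogeneous components of `I_eq` and of `Jf` coincide;
equivalently `dim_ℚ (I_eq/Jf)^(8) = 0`: arrangement no. 84 admits no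
nontrivial equisingular deformations, and the associated double octic
Calabi–Yau threefold is rigid. -/
theorem arrangement84_rigid :
    Submodule.restrictScalars ℚ Ieq ⊓ homogeneousSubmodule (Fin 4) ℚ 8 =
    Submodule.restrictScalars ℚ Jf ⊓ homogeneousSubmodule (Fin 4) ℚ 8 := by
  refine le_antisymm (le_inf ?_ inf_le_right) (inf_le_inf_right _ ?_)
  · rintro g ⟨hg, h8⟩
    obtain ⟨b, rfl⟩ := exists_eq_sum_lin_mul_cofactor hg h8
    obtain ⟨M, s, hb⟩ := exists_matrix (rel_pt hg)
    have e : ∑ i, lin (b i) * cofactor i =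
        ∑ i, (∑ k, C (c i k) * lin (M k)) * cofactor i + ∑ i, C (s i) * f := by
      rw [← Finset.sum_add_distrib]
      refine Finset.sum_congr rfl fun i _ => ?_
      rw [hb i, ← linHom_apply, map_add, map_sum, map_smul, add_mul, ← lin_mul_cofactor i]
      simp [smul_eq_C_mul, mul_assoc]
    rw [e]
    exact add_mem (sum_mul_cofactor_mem_Jf _) (sum_mem fun i _ => Ideal.mul_mem_left _ _ f_mem_Jf)
  · intro p hp
    refine Submodule.mem_inf.2 ⟨?_, ?_⟩
    · simp only [Submodule.mem_iInf]
      exact fun i j _ => Ideal.mem_sup_right hp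
    · simp only [Submodule.mem_iInf]
      exact fun v _ _ => Ideal.mem_sup_right hp

end Octic84
end
end

section
/- Let f = (x−t)(x+t)(y−t)(y+t)(z−t)(z+t)(x+y+z−t)(x+y+z−3t) ∈ ℚ[x,y,z,t] (arrangement no. 84ᵃ) and let Jf and I_eq be its Jacobian ideal and equisingular ideal. Then the degree-8 homogeneous component of I_eq equals the degree-8 homogeneous component of Jf; equivalently, dim_ℚ (I_eq/Jf)^(8) = 0, i.e., the octic arrangement no. 84ᵃ admits no nontrivial equisingular deformations and the associated double octic Calabi–Yau threefold is rigid. -/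
/-!
Rigidity of the double octic of arrangement no. 84ᵃ:
for `f = (x−t)(x+t)(y−t)(y+t)(z−t)(z+t)(x+y+z−t)(x+y+z−3t)` the degree-8 homogeneous
component of the equisingular ideal `I_eq` equals that of the Jacobian ideal
`Jf`, i.e. `dim_ℚ (I_eq/Jf)^(8) = 0`.
-/

noncomputable section

open Matrix MvPolynomial

namespace Octic84a

/-- `R = ℚ[x,y,z,t]` -/
abbrev R : Type := MvPolynomial (Fin 4) ℚ

/-- The linear polynomial with coefficient vector `a`. -/
def lin (a : Fin 4 → ℚ) : R := ∑ j, C (a j) * X j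

/-- Coefficient vectors of the eight planes `x−t, x+t, y−t, y+t, z−t, z+t, x+y+z−t, x+y+z−3t`. -/
def c : Fin 8 → Fin 4 → ℚ :=
  ![![1,0,0,-1], ![1,0,0,1], ![0,1,0,-1], ![0,1,0,1],
    ![0,0,1,-1], ![0,0,1,1], ![1,1,1,-1], ![1,1,1,-3]]

/-- The octic `f = (x−t)(x+t)(y−t)(y+t)(z−t)(z+t)(x+y+z−t)(x+y+z−3t)`. -/
def f : R := ∏ i, lin (c i)

/-- The Jacobian ideal of `f`. -/
def Jf : Ideal R :=
  Ideal.span {pderiv 0 f, pderiv 1 f, pderiv 2 f, pderiv 3 f}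

/-- `m(P)`: the number of the eight planes through the point `v`. -/
def m (v : Fin 4 → ℚ) : ℕ := {i : Fin 8 | c i ⬝ᵥ v = 0}.ncard

/-- `m(ℓᵢ,ℓⱼ)`: the number of the eight factors lying in the pencil spanned by
`ℓᵢ` and `ℓⱼ` (the multiplicity of `f` along the line `ℓᵢ = ℓⱼ = 0`). -/
def mLine (i j : Fin 8) : ℕ :=
  {k : Fin 8 | c k ∈ Submodule.span ℚ ({c i, c j} : Set (Fin 4 → ℚ))}.ncard

/-- `I_P`: the ideal of the point `v`, generated by all linear forms
vanishing at `v`. -/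
def IP (v : Fin 4 → ℚ) : Ideal R :=
  Ideal.span (lin '' {a : Fin 4 → ℚ | a ⬝ᵥ v = 0})

/-- The equisingular ideal
`I_eq = ⋂ ((ℓ,ℓ′)^{m(ℓ,ℓ′)} + Jf) ∩ ⋂ (I_P^{m(P)} + Jf)`, the first
intersection over all pairs of linearly independent factors, the second over
all points of `ℙ³(ℚ)` lying on at least three of the eight planes. -/
def Ieq : Ideal R :=
  (⨅ (i : Fin 8) (j : Fin 8) (_ : LinearIndependent ℚ ![c i, c j]),
      (Ideal.span {lin (c i), lin (c j)} ^ mLine i j + Jf)) ⊓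
  (⨅ (v : Fin 4 → ℚ) (_ : v ≠ 0) (_ : 3 ≤ m v), (IP v ^ m v + Jf))

/-- Integral coefficient vectors of the eight planes. -/
def cInt : Fin 8 → Fin 4 → ℤ :=
  ![![1,0,0,-1], ![1,0,0,1], ![0,1,0,-1], ![0,1,0,1],
    ![0,0,1,-1], ![0,0,1,1], ![1,1,1,-1], ![1,1,1,-3]]

theorem c_eq_cInt (i : Fin 8) (k : Fin 4) : c i k = cInt i k := by
  fin_cases i <;> fin_cases k <;> simp [c, cInt]

theorem cInt_minors : ∀ i k : Fin 8, i ≠ k → ∃ p q : Fin 4,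
    cInt i p * cInt k q - cInt i q * cInt k p ≠ 0 ∧
    ∀ j, j ≠ i → j ≠ k → ∃ r : Fin 4,
      (cInt i p * cInt k q - cInt i q * cInt k p) * cInt j r
        - (cInt j p * cInt k q - cInt j q * cInt k p) * cInt i r
        - (cInt i p * cInt j q - cInt i q * cInt j p) * cInt k r ≠ 0 := by
  decide +kernel

/-- Minors witnessing that no three of the eight planes share a line. -/
theorem exists_minors {i k : Fin 8} (hik : i ≠ k) : ∃ p q : Fin 4,
    c i p * c k q - c i q * c k p ≠ 0 ∧
    ∀ j, j ≠ i → j ≠ k → ∃ r : Fin 4,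
      (c i p * c k q - c i q * c k p) * c j r
        - (c j p * c k q - c j q * c k p) * c i r
        - (c i p * c j q - c i q * c j p) * c k r ≠ 0 := by
  simp only [c_eq_cInt]
  exact_mod_cast cInt_minors i k hik

theorem linearIndependent_pair {i k : Fin 8} (hik : i ≠ k) :
    LinearIndependent ℚ ![c i, c k] := by
  obtain ⟨p, q, h, -⟩ := exists_minors hik
  refine LinearIndependent.pair_iff.2 fun s t hst => ?_
  have hp := congrFun hst p
  have hq := congrFun hst q
  simp only [Pi.add_apply, Pi.smul_apply, smul_eq_mul, Pi.zero_apply] at hp hq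
  constructor
  · refine (mul_eq_zero.1 ?_).resolve_right h
    linear_combination c k q * hp - c k p * hq
  · refine (mul_eq_zero.1 ?_).resolve_right h
    linear_combination c i p * hq - c i q * hp

theorem coeff_lin (a : Fin 4 → ℚ) (k : Fin 4) : coeff (Finsupp.single k 1) (lin a) = a k := by
  simp [lin, coeff_sum, coeff_C_mul, coeff_X, Finsupp.single_left_inj]

theorem aeval_lin {A : Type*} [CommRing A] [Algebra ℚ A] (g : Fin 4 → A) (a : Fin 4 → ℚ) :
    aeval g (lin a) = ∑ k, algebraMap ℚ A (a k) * g k := by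
  simp [lin]

theorem isHomogeneous_lin (a : Fin 4 → ℚ) : (lin a).IsHomogeneous 1 :=
  IsHomogeneous.sum _ _ _ fun j _ => by
    simpa using (isHomogeneous_C _ (a j)).mul (isHomogeneous_X ℚ j)

theorem eq_lin_of_isHomogeneous {p : R} (hp : p.IsHomogeneous 1) :
    p = lin fun k => coeff (Finsupp.single k 1) p := by
  ext d
  by_cases hd : d.degree = 1
  · obtain ⟨k, rfl⟩ := Finsupp.range_single_one.ge hd
    rw [coeff_lin]
  · rw [hp.coeff_eq_zero hd, (isHomogeneous_lin _).coeff_eq_zero hd]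

/-- A substitution congruent to the identity modulo `I` detects membership in `I`. -/
theorem mem_of_aeval_eq_zero {I : Ideal R} {g : Fin 4 → R} (hg : ∀ k, X k - g k ∈ I) {p : R}
    (hp : aeval g p = 0) : p ∈ I := by
  have key : ((Ideal.Quotient.mkₐ ℚ I).comp (aeval g)) = Ideal.Quotient.mkₐ ℚ I := by
    ext k
    simpa using (Ideal.Quotient.eq.2 (hg k)).symm
  have := congrArg (fun φ => φ p) key
  simp only [AlgHom.comp_apply, hp, map_zero] at this
  exact Ideal.Quotient.eq_zero_iff_mem.1 this.symm

theorem mem_span_pair_of_mul_lin_mem {i j k : Fin 8} (hik : i ≠ k) (hji : j ≠ i) (hjk : j ≠ k)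
    {p : R} (hp : p * lin (c j) ∈ Ideal.span {lin (c i), lin (c k)}) :
    p ∈ Ideal.span {lin (c i), lin (c k)} := by
  obtain ⟨a, b, hd, h⟩ := exists_minors hik
  obtain ⟨r, hr⟩ := h j hji hjk
  set d := c i a * c k b - c i b * c k a with hd'
  let x : Fin 4 → ℚ := fun l =>
    (c k b * (Pi.single a 1 : Fin 4 → ℚ) l - c k a * (Pi.single b 1 : Fin 4 → ℚ) l) / d
  let y : Fin 4 → ℚ := fun l =>
    (c i a * (Pi.single b 1 : Fin 4 → ℚ) l - c i b * (Pi.single a 1 : Fin 4 → ℚ) l) / d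
  let g : Fin 4 → R := fun l => X l - C (x l) * lin (c i) - C (y l) * lin (c k)
  have hx (u : Fin 4 → ℚ) : ∑ l, u l * x l = (u a * c k b - u b * c k a) / d := by
    simp only [x, mul_div_assoc', ← Finset.sum_div, mul_sub, Finset.sum_sub_distrib,
      Pi.single_apply, mul_ite, mul_one, mul_zero, Finset.sum_ite_eq', Finset.mem_univ, if_true]
  have hy (u : Fin 4 → ℚ) : ∑ l, u l * y l = (c i a * u b - c i b * u a) / d := by
    simp only [y, mul_div_assoc', ← Finset.sum_div, mul_sub, Finset.sum_sub_distrib,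
      Pi.single_apply, mul_ite, mul_one, mul_zero, Finset.sum_ite_eq', Finset.mem_univ, if_true]
    ring
  have hlin (u : Fin 4 → ℚ) : aeval g (lin u) =
      lin u - C (∑ l, u l * x l) * lin (c i) - C (∑ l, u l * y l) * lin (c k) := by
    simp only [aeval_lin, g, algebraMap_eq, mul_sub, Finset.sum_sub_distrib, map_sum, map_mul,
      Finset.sum_mul, mul_assoc]
    rfl
  have hgi : aeval g (lin (c i)) = 0 := by
    rw [hlin, hx, hy, ← hd', div_self hd, mul_comm (c i b), sub_self]
    simp
  have hgk : aeval g (lin (c k)) = 0 := by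
    rw [hlin, hx, hy, ← hd', div_self hd, mul_comm (c k b), sub_self]
    simp
  have hgj : aeval g (lin (c j)) ≠ 0 := by
    intro h0
    apply hr
    have := congrArg (coeff (Finsupp.single r 1)) h0
    rw [hlin, hx, hy] at this
    simp only [coeff_sub, coeff_C_mul, coeff_lin, coeff_zero] at this
    field_simp at this
    linear_combination this
  refine mem_of_aeval_eq_zero (g := g) (fun l => ?_) ?_
  · have : X l - g l = C (x l) * lin (c i) + C (y l) * lin (c k) := by simp only [g]; ring
    rw [this]
    exact Ideal.mem_span_pair.2 ⟨_, _, rfl⟩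
  · obtain ⟨s, t, hst⟩ := Ideal.mem_span_pair.1 hp
    have := congrArg (aeval g) hst
    simp only [map_add, map_mul, hgi, hgk, mul_zero, add_zero] at this
    exact (mul_eq_zero.1 this.symm).resolve_right hgj

theorem mem_span_pair_of_mul_prod_mem {i k : Fin 8} (hik : i ≠ k) {s : Finset (Fin 8)}
    (hi : i ∉ s) (hk : k ∉ s) {p : R}
    (hp : p * ∏ j ∈ s, lin (c j) ∈ Ideal.span {lin (c i), lin (c k)}) :
    p ∈ Ideal.span {lin (c i), lin (c k)} := by
  induction s using Finset.induction_on generalizing p with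
  | empty => simpa using hp
  | insert j s hj ih =>
    simp only [Finset.mem_insert, not_or] at hi hk
    rw [Finset.prod_insert hj, ← mul_assoc] at hp
    exact mem_span_pair_of_mul_lin_mem hik (Ne.symm hi.1) (Ne.symm hk.1) (ih hi.2 hk.2 hp)

/-- Polynomials vanishing along all double lines of a subarrangement. -/
theorem exists_eq_sum_of_mem_span_pair (s : Finset (Fin 8)) {g : R}
    (hg : ∀ i ∈ s, ∀ k ∈ s, i ≠ k → g ∈ Ideal.span {lin (c i), lin (c k)}) :
    ∃ (q : R) (p : Fin 8 → R), g = q * ∏ j ∈ s, lin (c j) +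
      ∑ i ∈ s, p i * ∏ j ∈ s.erase i, lin (c j) := by
  induction s using Finset.induction_on with
  | empty => exact ⟨g, 0, by simp⟩
  | insert k s hk ih =>
    obtain ⟨q, p, hqp⟩ := ih fun i hi j hj =>
      hg i (Finset.mem_insert_of_mem hi) j (Finset.mem_insert_of_mem hj)
    have hp : ∀ i ∈ s, ∃ u v, u * lin (c i) + v * lin (c k) = p i := by
      intro i hi
      have hik : i ≠ k := fun h => hk (h ▸ hi)
      refine Ideal.mem_span_pair.1 (mem_span_pair_of_mul_prod_mem hik
        (Finset.notMem_erase i s) (fun h => hk (Finset.mem_of_mem_erase h)) ?_)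
      have hli : lin (c i) ∈ Ideal.span {lin (c i), lin (c k)} := Ideal.subset_span (by simp)
      rw [← Finset.add_sum_erase s _ hi] at hqp
      have h1 := hg i (Finset.mem_insert_of_mem hi) k (Finset.mem_insert_self k s) hik
      have h2 : q * ∏ j ∈ s, lin (c j) ∈ Ideal.span {lin (c i), lin (c k)} :=
        Ideal.mul_mem_left _ _ (Ideal.mem_of_dvd _ (Finset.dvd_prod_of_mem _ hi) hli)
      have h3 : ∑ l ∈ s.erase i, p l * ∏ j ∈ s.erase l, lin (c j) ∈
          Ideal.span {lin (c i), lin (c k)} := by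
        refine Ideal.sum_mem _ fun l hl => Ideal.mul_mem_left _ _ (Ideal.mem_of_dvd _
          (Finset.dvd_prod_of_mem _ (Finset.mem_erase.2 ⟨?_, hi⟩)) hli)
        exact (Finset.ne_of_mem_erase hl).symm
      have := Ideal.sub_mem _ (Ideal.sub_mem _ h1 h2) h3
      rw [hqp] at this
      convert this using 1
      ring
    choose! u v huv using hp
    refine ⟨0, fun i => if i = k then q + ∑ l ∈ s, u l else v i, ?_⟩
    simp only [Finset.sum_insert hk, Finset.erase_insert hk, hqp, if_true, zero_mul, zero_add,
      add_mul, add_assoc, Finset.sum_mul, ← Finset.sum_add_distrib]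
    congr 1
    refine Finset.sum_congr rfl fun i hi => ?_
    have hik : i ≠ k := fun h => hk (h ▸ hi)
    rw [if_neg hik, Finset.erase_insert_of_ne hik.symm,
      Finset.prod_insert (fun h => hk (Finset.mem_of_mem_erase h)), ← huv i hi,
      ← Finset.mul_prod_erase s _ hi]
    ring

theorem homogeneousComponent_mul_of_isHomogeneous {p q : R} {n : ℕ} (hq : q.IsHomogeneous n)
    (d : ℕ) : homogeneousComponent (d + n) (p * q) = homogeneousComponent d p * q := by
  conv_lhs => rw [← sum_homogeneousComponent p, Finset.sum_mul, map_sum]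
  have h (e : ℕ) : homogeneousComponent (d + n) (homogeneousComponent e p * q) =
      if d = e then homogeneousComponent e p * q else 0 := by
    rw [homogeneousComponent_of_mem ((homogeneousComponent_isHomogeneous e p).mul hq)]
    simp
  simp only [h, Finset.sum_ite_eq, Finset.mem_range]
  split_ifs with hd
  · rfl
  · rw [homogeneousComponent_eq_zero d p (by omega), zero_mul]

/-- The product of all the linear forms but the `i`-th. -/
def cofactor (i : Fin 8) : R := ∏ j ∈ Finset.univ.erase i, lin (c j)

theorem isHomogeneous_cofactor (i : Fin 8) : (cofactor i).IsHomogeneous 7 := by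
  have := IsHomogeneous.prod (Finset.univ.erase i) (fun j => lin (c j)) (fun _ => 1)
    fun j _ => isHomogeneous_lin (c j)
  simpa [cofactor] using this

theorem lin_mul_cofactor (i : Fin 8) : lin (c i) * cofactor i = f :=
  Finset.mul_prod_erase _ _ (Finset.mem_univ i)

theorem pderiv_lin (k : Fin 4) (a : Fin 4 → ℚ) : pderiv k (lin a) = C (a k) := by
  simp [lin, pderiv_X, Pi.single_apply]

theorem pderiv_prod_lin (k : Fin 4) (s : Finset (Fin 8)) :
    pderiv k (∏ i ∈ s, lin (c i)) = ∑ i ∈ s, C (c i k) * ∏ j ∈ s.erase i, lin (c j) := by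
  induction s using Finset.induction_on with
  | empty => simp
  | insert l s hl ih =>
    rw [Finset.prod_insert hl, Derivation.leibniz, ih, pderiv_lin, Finset.sum_insert hl,
      Finset.erase_insert hl, add_comm, smul_eq_mul, smul_eq_mul, mul_comm, Finset.mul_sum]
    congr 1
    refine Finset.sum_congr rfl fun i hi => ?_
    have hil : l ≠ i := fun h => hl (h ▸ hi)
    rw [Finset.erase_insert_of_ne hil,
      Finset.prod_insert (fun h => hl (Finset.mem_of_mem_erase h))]
    ring

theorem pderiv_f (k : Fin 4) : pderiv k f = ∑ i, C (c i k) * cofactor i :=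
  pderiv_prod_lin k Finset.univ

theorem Jf_eq_span_range : Jf = Ideal.span (Set.range fun k => pderiv k f) := by
  rw [Jf]
  congr 1
  ext p
  simp [Fin.exists_fin_succ, eq_comm]

theorem f_mem_Jf : f ∈ Jf := by
  have hf : f.IsHomogeneous 8 := by
    rw [← lin_mul_cofactor 0]
    exact (isHomogeneous_lin _).mul (isHomogeneous_cofactor 0)
  have : f = C (1 / 8) * ∑ k, X k * pderiv k f := by
    rw [hf.sum_X_mul_pderiv, nsmul_eq_mul, ← mul_assoc, Nat.cast_ofNat,
      show (8 : R) = C 8 from rfl, ← C_mul]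
    norm_num
  rw [this, Jf_eq_span_range]
  exact Ideal.mul_mem_left _ _ (Ideal.sum_mem _ fun k _ =>
    Ideal.mul_mem_left _ _ (Ideal.subset_span ⟨k, rfl⟩))

theorem Jf_le_span_pair {i k : Fin 8} (hik : i ≠ k) :
    Jf ≤ Ideal.span {lin (c i), lin (c k)} := by
  rw [Jf_eq_span_range, Ideal.span_le]
  rintro _ ⟨l, rfl⟩
  dsimp only
  rw [pderiv_f]
  refine Ideal.sum_mem _ fun j _ => Ideal.mul_mem_left _ _ ?_
  by_cases hj : j = i
  · exact Ideal.mem_of_dvd _ (Finset.dvd_prod_of_mem _ (Finset.mem_erase.2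
      ⟨hj ▸ hik.symm, Finset.mem_univ k⟩)) (Ideal.subset_span (by simp))
  · exact Ideal.mem_of_dvd _ (Finset.dvd_prod_of_mem _ (Finset.mem_erase.2
      ⟨Ne.symm hj, Finset.mem_univ i⟩)) (Ideal.subset_span (by simp))

theorem mLine_ne_zero (i k : Fin 8) : mLine i k ≠ 0 := by
  exact Set.ncard_ne_zero_of_mem (a := i) (Submodule.subset_span (by simp))

theorem Ieq_le_span_pair {i k : Fin 8} (hik : i ≠ k) :
    Ieq ≤ Ideal.span {lin (c i), lin (c k)} := by
  refine inf_le_left.trans ((iInf_le _ i).trans ((iInf_le _ k).trans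
    ((iInf_le _ (linearIndependent_pair hik)).trans ?_)))
  exact sup_le (Ideal.pow_le_self (mLine_ne_zero i k)) (Jf_le_span_pair hik)

theorem Jf_le_Ieq : Jf ≤ Ieq :=
  le_inf (le_iInf fun _ => le_iInf fun _ => le_iInf fun _ => le_sup_right)
    (le_iInf fun _ => le_iInf fun _ => le_iInf fun _ => le_sup_right)

/-- A degree-8 element of the equisingular ideal comes from moving the eight planes. -/
theorem exists_eq_sum_lin_mul_cofactor {g : R} (hg : g ∈ Ieq) (h8 : g.IsHomogeneous 8) :
    ∃ a : Fin 8 → Fin 4 → ℚ, g = ∑ i, lin (a i) * cofactor i := by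
  obtain ⟨q, p, hqp⟩ := exists_eq_sum_of_mem_span_pair Finset.univ
    fun i _ k _ hik => Ieq_le_span_pair hik hg
  have hf : q * ∏ j, lin (c j) = q * lin (c 0) * cofactor 0 := by
    rw [mul_assoc, lin_mul_cofactor, f]
  have h := congrArg (homogeneousComponent (1 + 7)) hqp
  rw [homogeneousComponent_eq_self h8, hf, map_add, map_sum,
    homogeneousComponent_mul_of_isHomogeneous (isHomogeneous_cofactor 0)] at h
  have hp (i : Fin 8) : homogeneousComponent (1 + 7) (p i * ∏ j ∈ Finset.univ.erase i, lin (c j)) =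
      homogeneousComponent 1 (p i) * cofactor i :=
    homogeneousComponent_mul_of_isHomogeneous (isHomogeneous_cofactor i) 1
  simp only [hp] at h
  let w (i : Fin 8) : R := homogeneousComponent 1 (p i + if i = 0 then q * lin (c 0) else 0)
  refine ⟨fun i k => coeff (Finsupp.single k 1) (w i), ?_⟩
  have hw (i : Fin 8) : lin (fun k => coeff (Finsupp.single k 1) (w i)) = w i :=
    (eq_lin_of_isHomogeneous (homogeneousComponent_isHomogeneous 1 _)).symm
  simp only [hw]
  simp only [w, h, map_add, add_mul, Finset.sum_add_distrib]
  rw [add_comm, add_right_inj, Fintype.sum_eq_single 0 (fun i hi => by simp [hi]), if_pos rfl]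

/-- Restriction to the line through `v` in direction `u`. -/
def restrictLine (v u : Fin 4 → ℚ) : R →ₐ[ℚ] Polynomial ℚ :=
  aeval fun k => Polynomial.C (v k) + Polynomial.C (u k) * Polynomial.X

theorem restrictLine_lin (v u a : Fin 4 → ℚ) : restrictLine v u (lin a) =
    Polynomial.C (a ⬝ᵥ v) + Polynomial.C (a ⬝ᵥ u) * Polynomial.X := by
  simp only [restrictLine, aeval_lin, dotProduct, map_sum, map_mul, mul_add,
    Finset.sum_add_distrib, Finset.sum_mul, mul_assoc, Polynomial.algebraMap_eq]

theorem coeff_zero_restrictLine (v u : Fin 4 → ℚ) (p : R) :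
    (restrictLine v u p).coeff 0 = eval v p := by
  have : (Polynomial.aeval (0 : ℚ)).comp (restrictLine v u) = aeval v := by
    ext k
    simp [restrictLine]
  have := congrArg (fun φ => φ p) this
  simpa [Polynomial.coeff_zero_eq_eval_zero, aeval_eq_eval, Polynomial.coe_aeval_eq_eval] using this

theorem X_pow_dvd_restrictLine {v : Fin 4 → ℚ} (u : Fin 4 → ℚ) {n : ℕ} {p : R}
    (hp : p ∈ IP v ^ n) : Polynomial.X ^ n ∣ restrictLine v u p := by
  rw [← Ideal.mem_span_singleton, ← Ideal.span_singleton_pow, ← Ideal.mem_comap]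
  refine Ideal.le_comap_pow _ n (Ideal.pow_right_mono ?_ n hp)
  rw [IP, Ideal.span_le]
  rintro _ ⟨a, ha, rfl⟩
  have ha : a ⬝ᵥ v = 0 := ha
  simp only [SetLike.mem_coe, Ideal.mem_comap, Ideal.mem_span_singleton, restrictLine_lin, ha,
    map_zero, zero_add]
  exact dvd_mul_left _ _

/-- On the `i`-th plane, a point on no other plane. -/
def genericPoint : Fin 8 → Fin 4 → ℤ :=
  ![![1,2,3,1], ![-1,2,3,1], ![2,1,3,1], ![2,-1,3,1],
    ![2,3,1,1], ![2,3,-1,1], ![2,3,-4,1], ![2,3,-2,1]]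

theorem dotProduct_c_cast (i : Fin 8) (v : Fin 4 → ℤ) :
    c i ⬝ᵥ (fun k => (v k : ℚ)) = ((cInt i ⬝ᵥ v : ℤ) : ℚ) := by
  simp [dotProduct, c_eq_cInt]

theorem dotProduct_genericPoint_eq_zero_iff (i j : Fin 8) :
    c j ⬝ᵥ (fun k => (genericPoint i k : ℚ)) = 0 ↔ j = i := by
  rw [dotProduct_c_cast, Int.cast_eq_zero]
  revert i j
  decide +kernel

theorem m_eq_card (v : Fin 4 → ℚ) : m v = (Finset.univ.filter fun i => c i ⬝ᵥ v = 0).card := by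
  rw [m, ← Set.ncard_coe_finset]
  simp

/-- To first order, the planes through `v` keep passing through a common point. -/
theorem exists_dotProduct_eq {a : Fin 8 → Fin 4 → ℚ} {v : Fin 4 → ℚ}
    (hg : ∑ i, lin (a i) * cofactor i ∈ IP v ^ m v + Jf) :
    ∃ b : Fin 4 → ℚ, ∀ i, c i ⬝ᵥ v = 0 → a i ⬝ᵥ v = c i ⬝ᵥ b := by
  obtain ⟨r, hr, s, hs, hrs⟩ := Submodule.mem_sup.1 hg
  rw [Jf_eq_span_range] at hs
  obtain ⟨β, rfl⟩ := Ideal.mem_span_range_iff_exists_fun.1 hs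
  refine ⟨fun k => eval v (β k), fun i hi => ?_⟩
  set u : Fin 4 → ℚ := fun k => (genericPoint i k : ℚ) with hu
  have hiu : c i ⬝ᵥ u = 0 := (dotProduct_genericPoint_eq_zero_iff i i).2 rfl
  have hju {j : Fin 8} (hj : j ≠ i) : c j ⬝ᵥ u ≠ 0 :=
    fun h => hj ((dotProduct_genericPoint_eq_zero_iff i j).1 h)
  have hcof {j : Fin 8} (hj : j ≠ i) : restrictLine v u (cofactor j) = 0 := by
    rw [cofactor, map_prod]
    exact Finset.prod_eq_zero (Finset.mem_erase.2 ⟨hj.symm, Finset.mem_univ i⟩)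
      (by simp [restrictLine_lin, hi, hiu])
  have hsum (p : Fin 8 → R) : restrictLine v u (∑ j, p j * cofactor j) =
      restrictLine v u (p i) * restrictLine v u (cofactor i) := by
    rw [map_sum, Fintype.sum_eq_single i fun j hj => by rw [map_mul, hcof hj, mul_zero], map_mul]
  set S := Finset.univ.filter fun j => c j ⬝ᵥ v = 0 with hS
  have hiS : i ∈ S := by simp [hS, hi]
  obtain ⟨U, hU, hcofU⟩ : ∃ U : Polynomial ℚ, ¬ Polynomial.X ∣ U ∧
      restrictLine v u (cofactor i) = Polynomial.X ^ (m v - 1) * U := by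
    refine ⟨(∏ j ∈ S.erase i, Polynomial.C (c j ⬝ᵥ u)) *
      ∏ j with c j ⬝ᵥ v ≠ 0, restrictLine v u (lin (c j)), ?_, ?_⟩
    · simp only [Polynomial.X_dvd_iff, Polynomial.mul_coeff_zero, Polynomial.coeff_zero_prod,
        mul_eq_zero, Finset.prod_eq_zero_iff, not_or, not_exists, not_and]
      refine ⟨fun j hj => ?_, fun j hj => ?_⟩
      · simpa using hju (Finset.ne_of_mem_erase hj)
      · simpa [restrictLine_lin] using hj
    · have hsplit : Finset.univ.erase i = S.erase i ∪ Finset.univ.filter fun j => c j ⬝ᵥ v ≠ 0 := by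
        ext j
        by_cases hj : j = i
        · simp [hj, hi]
        · simp [hj, hS, em]
      have hdisj : Disjoint (S.erase i) (Finset.univ.filter fun j => c j ⬝ᵥ v ≠ 0) :=
        (Finset.disjoint_filter_filter_not _ _ _).mono_left (Finset.erase_subset _ _)
      rw [cofactor, map_prod, hsplit, Finset.prod_union hdisj, ← mul_assoc, m_eq_card,
        ← Finset.card_erase_of_mem hiS, ← Finset.prod_const, ← Finset.prod_mul_distrib]
      congr 1
      refine Finset.prod_congr rfl fun j hj => ?_
      have hj0 : c j ⬝ᵥ v = 0 := by simpa [hS] using Finset.mem_of_mem_erase hj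
      rw [restrictLine_lin, hj0, map_zero, zero_add, mul_comm]
  have hm : m v - 1 + 1 = m v :=
    Nat.sub_add_cancel (by rw [m_eq_card]; exact Finset.card_pos.2 ⟨i, hiS⟩)
  have hJ : ∑ k, β k * pderiv k f = ∑ j, (∑ k, β k * C (c j k)) * cofactor j := by
    simp only [pderiv_f, Finset.mul_sum, Finset.sum_mul, mul_assoc]
    exact Finset.sum_comm
  have hdvd := X_pow_dvd_restrictLine u hr
  rw [eq_sub_of_add_eq hrs, hJ, map_sub, hsum, hsum, ← sub_mul, hcofU, ← mul_assoc] at hdvd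
  have hdvd := Polynomial.prime_X.pow_dvd_of_dvd_mul_right _ hU hdvd
  nth_rw 1 [← hm] at hdvd
  rw [pow_succ', mul_dvd_mul_iff_right (pow_ne_zero _ Polynomial.X_ne_zero),
    ← map_sub, Polynomial.X_dvd_iff, coeff_zero_restrictLine] at hdvd
  simp only [map_sub, map_sum, map_mul, eval_C, lin, eval_X] at hdvd
  rw [sub_eq_zero] at hdvd
  simpa only [dotProduct, mul_comm] using hdvd

/-- The fourfold points of the arrangement. -/
def fourfoldPoint : Fin 10 → Fin 4 → ℤ :=
  ![![1,0,0,0], ![0,1,0,0], ![0,0,1,0], ![0,1,-1,0], ![1,0,-1,0], ![1,-1,0,0],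
    ![1,1,1,1], ![-1,1,1,1], ![1,-1,1,1], ![1,1,-1,1]]

/-- The linear relations between the planes through the fourfold points. -/
def fourfoldRelation : Fin 10 → Fin 8 → ℤ :=
  ![![0,0,1,-1,-1,1,0,0], ![1,-1,0,0,-1,1,0,0], ![1,-1,-1,1,0,0,0,0],
    ![-1,1,0,0,0,0,-1,1], ![0,0,-1,1,0,0,-1,1], ![0,0,0,0,-1,1,-1,1],
    ![-1,0,-1,0,-1,0,0,1], ![0,-1,-1,0,-1,0,1,0], ![-1,0,0,-1,-1,0,1,0],
    ![-1,0,-1,0,0,-1,1,0]]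

theorem fourfoldPoint_spec : ∀ n : Fin 10, fourfoldPoint n ≠ 0 ∧
    3 ≤ (Finset.univ.filter fun i => cInt i ⬝ᵥ fourfoldPoint n = 0).card ∧
    (∀ i, fourfoldRelation n i = 0 ∨ cInt i ⬝ᵥ fourfoldPoint n = 0) ∧
    ∀ k, ∑ i, fourfoldRelation n i * cInt i k = 0 := by
  decide +kernel

theorem sum_fourfoldRelation_mul {a : Fin 8 → Fin 4 → ℚ}
    (hg : ∑ i, lin (a i) * cofactor i ∈ Ieq) (n : Fin 10) :
    ∑ i, (fourfoldRelation n i : ℚ) * ∑ k, a i k * (fourfoldPoint n k : ℚ) = 0 := by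
  obtain ⟨h0, h3, hs, hl⟩ := fourfoldPoint_spec n
  set v : Fin 4 → ℚ := fun k => (fourfoldPoint n k : ℚ) with hv
  have hv0 : v ≠ 0 := fun h => h0 (funext fun k => by simpa [hv] using congrFun h k)
  have hc (i : Fin 8) : c i ⬝ᵥ v = 0 ↔ cInt i ⬝ᵥ fourfoldPoint n = 0 := by
    rw [hv, dotProduct_c_cast, Int.cast_eq_zero]
  have hm : 3 ≤ m v := by simpa only [m_eq_card, hc] using h3
  have hle : Ieq ≤ IP v ^ m v + Jf := inf_le_right.trans
    ((iInf_le _ v).trans ((iInf_le _ hv0).trans (iInf_le _ hm)))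
  obtain ⟨b, hb⟩ := exists_dotProduct_eq (hle hg)
  have hl (k : Fin 4) : ∑ i, (fourfoldRelation n i : ℚ) * c i k = 0 := by
    simp only [c_eq_cInt]
    exact_mod_cast hl k
  calc ∑ i, (fourfoldRelation n i : ℚ) * ∑ k, a i k * v k
      = ∑ i, (fourfoldRelation n i : ℚ) * ∑ k, c i k * b k := by
        refine Finset.sum_congr rfl fun i _ => ?_
        rcases hs i with h | h
        · simp [h]
        · rw [← dotProduct, hb i ((hc i).2 h), dotProduct]
    _ = ∑ k, (∑ i, (fourfoldRelation n i : ℚ) * c i k) * b k := by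
        simp only [Finset.mul_sum, Finset.sum_mul, mul_assoc]
        exact Finset.sum_comm
    _ = 0 := by simp [hl]

set_option maxHeartbeats 1600000 in
/-- First-order deformations preserving the fourfold points are infinitesimal coordinate changes. -/
theorem exists_matrix_of_sum_fourfoldRelation {a : Fin 8 → Fin 4 → ℚ}
    (h : ∀ n, ∑ i, (fourfoldRelation n i : ℚ) * ∑ k, a i k * (fourfoldPoint n k : ℚ) = 0) :
    ∃ (A : Fin 4 → Fin 4 → ℚ) (μ : Fin 8 → ℚ),
      ∀ i k, a i k = ∑ j, c i j * A j k + μ i * c i k := by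
  have h0 := h 0
  have h1 := h 1
  have h2 := h 2
  have h3 := h 3
  have h4 := h 4
  have h5 := h 5
  have h6 := h 6
  have h7 := h 7
  have h8 := h 8
  have h9 := h 9
  simp [Fin.sum_univ_succ, fourfoldRelation, fourfoldPoint] at h0 h1 h2 h3 h4 h5 h6 h7 h8 h9
  let A : Fin 4 → Fin 4 → ℚ :=
    ![![(a 0 0 + a 0 3 + a 1 0 - a 1 3) / 2,
      (a 0 1 + a 1 1) / 2,
      (a 0 2 + a 1 2) / 2,
      (a 0 0 + a 0 3 - a 1 0 + a 1 3) / 2 + (a 3 0 - a 2 0) / 2],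
    ![(a 2 0 + a 3 0) / 2,
      (a 2 1 + a 2 3 + a 3 1 - a 3 3) / 2,
      (a 2 2 + a 3 2) / 2,
      (a 2 1 + a 2 3 - a 3 1 + a 3 3) / 2 + (a 1 1 - a 0 1) / 2],
    ![(a 4 0 + a 5 0) / 2,
      (a 4 1 + a 5 1) / 2,
      (a 4 2 + a 4 3 + a 5 2 - a 5 3) / 2,
      (a 4 2 + a 4 3 - a 5 2 + a 5 3) / 2 + (a 1 2 - a 0 2) / 2],
    ![(a 3 0 - a 2 0) / 2,
      (a 1 1 - a 0 1) / 2,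
      (a 1 2 - a 0 2) / 2,
      0]]
  let μ : Fin 8 → ℚ :=
    ![a 0 0 - A 0 0 + A 3 0, a 1 0 - A 0 0 - A 3 0, a 2 1 - A 1 1 + A 3 1,
      a 3 1 - A 1 1 - A 3 1, a 4 2 - A 2 2 + A 3 2, a 5 2 - A 2 2 - A 3 2,
      a 6 0 - A 0 0 - A 1 0 - A 2 0 + A 3 0, a 7 0 - A 0 0 - A 1 0 - A 2 0 + 3 * A 3 0]
  refine ⟨A, μ, fun i k => ?_⟩
  fin_cases i <;> fin_cases k <;> simp [c, Fin.sum_univ_succ, A, μ] <;> linarith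

theorem mem_Jf_of_mem_Ieq {g : R} (hg : g ∈ Ieq) (h8 : g.IsHomogeneous 8) : g ∈ Jf := by
  obtain ⟨a, rfl⟩ := exists_eq_sum_lin_mul_cofactor hg h8
  obtain ⟨A, μ, h⟩ := exists_matrix_of_sum_fourfoldRelation (sum_fourfoldRelation_mul hg)
  have hlin (i : Fin 8) : lin (a i) = ∑ j, C (c i j) * lin (A j) + C (μ i) * lin (c i) := by
    simp only [lin, h, map_add, map_sum, map_mul, add_mul, Finset.sum_add_distrib,
      Finset.sum_mul, Finset.mul_sum, mul_assoc]
    rw [Finset.sum_comm]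
  have hsum : ∑ i, lin (a i) * cofactor i =
      ∑ j, lin (A j) * pderiv j f + (∑ i, C (μ i)) * f := by
    simp only [hlin, add_mul, Finset.sum_add_distrib, mul_assoc, lin_mul_cofactor, pderiv_f,
      Finset.sum_mul, Finset.mul_sum]
    rw [Finset.sum_comm]
    simp only [mul_left_comm]
  rw [hsum, Jf_eq_span_range]
  exact Ideal.add_mem _ (Ideal.sum_mem _ fun j _ => Ideal.mul_mem_left _ _
    (Ideal.subset_span ⟨j, rfl⟩)) (Ideal.mul_mem_left _ _ (Jf_eq_span_range ▸ f_mem_Jf))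

/-- The degree-8 homogeneous components of `I_eq` and of `Jf` coincide;
equivalently `dim_ℚ (I_eq/Jf)^(8) = 0`: arrangement no. 84ᵃ admits no
nontrivial equisingular deformations, and the associated double octic
Calabi–Yau threefold is rigid. -/
theorem arrangement84a_rigid :
    Submodule.restrictScalars ℚ Ieq ⊓ homogeneousSubmodule (Fin 4) ℚ 8 =
    Submodule.restrictScalars ℚ Jf ⊓ homogeneousSubmodule (Fin 4) ℚ 8 := by
  refine le_antisymm (fun g hg => ⟨?_, hg.2⟩) (inf_le_inf_right _ fun g hg => Jf_le_Ieq hg)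
  exact mem_Jf_of_mem_Ieq hg.1 hg.2

end Octic84a
end
end

section
/- Let f = (x−t)(x+t)(y−t)(y+t)(z−t)(z+t)(x+y+z+t)(x+y+z−t) ∈ ℚ[x,y,z,t] (arrangement no. 85) and let Jf and I_eq be its Jacobian ideal and equisingular ideal. Then the degree-8 homogeneous component of I_eq equals the degree-8 homogeneous component of Jf; equivalently, dim_ℚ (I_eq/Jf)^(8) = 0, i.e., the octic arrangement no. 85 admits no nontrivial equisingular deformations and the associated double octic Calabi–Yau threefold is rigid. -/
/-!
Rigidity of the double octic of arrangement no. 85: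
for `f = (x−t)(x+t)(y−t)(y+t)(z−t)(z+t)(x+y+z+t)(x+y+z−t)` the degree-8 homogeneous
component of the equisingular ideal `I_eq` equals that of the Jacobian ideal
`Jf`, i.e. `dim_ℚ (I_eq/Jf)^(8) = 0`.
-/

noncomputable section

open Matrix MvPolynomial

namespace Octic85

/-- `R = ℚ[x,y,z,t]` -/
abbrev R : Type := MvPolynomial (Fin 4) ℚ

/-- The linear polynomial with coefficient vector `a`. -/
def lin (a : Fin 4 → ℚ) : R := ∑ j, C (a j) * X j

/-- Coefficient vectors of the eight planes `x−t, x+t, y−t, y+t, z−t, z+t, x+y+z+t, x+y+z−t`. -/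
def c : Fin 8 → Fin 4 → ℚ :=
  ![![1,0,0,-1], ![1,0,0,1], ![0,1,0,-1], ![0,1,0,1],
    ![0,0,1,-1], ![0,0,1,1], ![1,1,1,1], ![1,1,1,-1]]

/-- The octic `f = (x−t)(x+t)(y−t)(y+t)(z−t)(z+t)(x+y+z+t)(x+y+z−t)`. -/
def f : R := ∏ i, lin (c i)

/-- The Jacobian ideal of `f`. -/
def Jf : Ideal R :=
  Ideal.span {pderiv 0 f, pderiv 1 f, pderiv 2 f, pderiv 3 f}

/-- `m(P)`: the number of the eight planes through the point `v`. -/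
def m (v : Fin 4 → ℚ) : ℕ := {i : Fin 8 | c i ⬝ᵥ v = 0}.ncard

/-- `m(ℓᵢ,ℓⱼ)`: the number of the eight factors lying in the pencil spanned by
`ℓᵢ` and `ℓⱼ` (the multiplicity of `f` along the line `ℓᵢ = ℓⱼ = 0`). -/
def mLine (i j : Fin 8) : ℕ :=
  {k : Fin 8 | c k ∈ Submodule.span ℚ ({c i, c j} : Set (Fin 4 → ℚ))}.ncard

/-- `I_P`: the ideal of the point `v`, generated by all linear forms
vanishing at `v`. -/
def IP (v : Fin 4 → ℚ) : Ideal R :=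
  Ideal.span (lin '' {a : Fin 4 → ℚ | a ⬝ᵥ v = 0})

/-- The equisingular ideal
`I_eq = ⋂ ((ℓ,ℓ′)^{m(ℓ,ℓ′)} + Jf) ∩ ⋂ (I_P^{m(P)} + Jf)`, the first
intersection over all pairs of linearly independent factors, the second over
all points of `ℙ³(ℚ)` lying on at least three of the eight planes. -/
def Ieq : Ideal R :=
  (⨅ (i : Fin 8) (j : Fin 8) (_ : LinearIndependent ℚ ![c i, c j]),
      (Ideal.span {lin (c i), lin (c j)} ^ mLine i j + Jf)) ⊓
  (⨅ (v : Fin 4 → ℚ) (_ : v ≠ 0) (_ : 3 ≤ m v), (IP v ^ m v + Jf))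

/-- `lin` as a linear map. -/
def linMap : (Fin 4 → ℚ) →ₗ[ℚ] R where
  toFun := lin
  map_add' a b := by simp [lin, add_mul, Finset.sum_add_distrib]
  map_smul' r a := by simp [lin, Finset.mul_sum, smul_eq_C_mul, mul_assoc]

theorem linMap_apply (a : Fin 4 → ℚ) : linMap a = lin a := rfl

theorem lin_sub (a b : Fin 4 → ℚ) : lin (a - b) = lin a - lin b := map_sub linMap a b

theorem lin_single (j : Fin 4) : lin (Pi.single j 1) = X j := by
  simp [lin, Pi.single_apply, apply_ite C, ite_mul]

theorem eval_lin (v a : Fin 4 → ℚ) : eval v (lin a) = a ⬝ᵥ v := by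
  simp [lin, dotProduct]

theorem lin_eq_zero {a : Fin 4 → ℚ} (h : lin a = 0) : a = 0 := by
  funext j
  have := eval_lin (Pi.single j 1) a
  simpa [h] using this.symm

theorem isHomogeneous_lin (a : Fin 4 → ℚ) : (lin a).IsHomogeneous 1 :=
  IsHomogeneous.sum _ _ _ fun j _ => by
    simpa using (isHomogeneous_C (Fin 4) (a j)).mul (isHomogeneous_X ℚ j)

theorem exists_eq_lin {p : R} (hp : p.IsHomogeneous 1) : ∃ a, p = lin a := by
  have h : p ∈ Submodule.span ℚ (Set.range (X : Fin 4 → R)) := by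
    rw [← homogeneousSubmodule_one_eq_span_X]
    exact hp
  obtain ⟨a, ha⟩ := (Submodule.mem_span_range_iff_exists_fun ℚ).1 h
  exact ⟨a, by simp [← ha, lin, smul_eq_C_mul]⟩

theorem lin_mem_span {s : Set (Fin 4 → ℚ)} {w : Fin 4 → ℚ} (hw : w ∈ Submodule.span ℚ s) :
    lin w ∈ Ideal.span (lin '' s) := by
  have : Submodule.span ℚ s ≤
      ((Ideal.span (lin '' s)).restrictScalars ℚ).comap linMap :=
    Submodule.span_le.2 fun a ha => Ideal.subset_span ⟨a, ha, rfl⟩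
  exact this hw

/-- An ideal generated by linear forms is the kernel of a substitution by linear forms. -/
theorem exists_ker_eq_span_lin (s : Set (Fin 4 → ℚ)) :
    ∃ φ : R →ₐ[ℚ] R, RingHom.ker φ = Ideal.span (lin '' s) ∧
      ∀ a, φ (lin a) = 0 → a ∈ Submodule.span ℚ s := by
  obtain ⟨q, hq⟩ := (Submodule.span ℚ s).exists_isCompl
  set π := q.projection _ hq.symm with hπ
  let φ : R →ₐ[ℚ] R := aeval fun j => lin (π (Pi.single j 1))
  have hφ (a : Fin 4 → ℚ) : φ (lin a) = lin (π a) := by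
    have : φ.toLinearMap ∘ₗ linMap = linMap ∘ₗ π := by
      refine (Pi.basisFun ℚ (Fin 4)).ext fun j => ?_
      simp [linMap_apply, lin_single, φ]
    exact LinearMap.congr_fun this a
  have hsub (p : R) : p - φ p ∈ Ideal.span (lin '' s) := by
    induction p using MvPolynomial.induction_on with
    | C r => simp [φ]
    | add p q hp hq =>
      rw [map_add, add_sub_add_comm]
      exact add_mem hp hq
    | mul_X p j hp =>
      have hj : X j - φ (X j) ∈ Ideal.span (lin '' s) := by
        rw [← lin_single, hφ, ← lin_sub]
        apply lin_mem_span
        rw [← Submodule.projection_apply_eq_zero_iff hq.symm, map_sub, sub_eq_zero, ← hπ]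
        exact (Submodule.projection_apply_left hq.symm ⟨_, Submodule.projection_apply_mem _ _⟩).symm
      have : p * X j - φ (p * X j) = X j * (p - φ p) + φ p * (X j - φ (X j)) := by
        rw [map_mul]; ring
      rw [this]
      exact add_mem (Ideal.mul_mem_left _ _ hp) (Ideal.mul_mem_left _ _ hj)
  refine ⟨φ, le_antisymm (fun p hp => ?_) (Ideal.span_le.2 ?_), fun a ha => ?_⟩
  · simpa [(RingHom.mem_ker).1 hp] using hsub p
  · rintro _ ⟨a, ha, rfl⟩
    have : π a = 0 :=
      (Submodule.projection_apply_eq_zero_iff hq.symm).2 (Submodule.subset_span ha)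
    change φ (lin a) = 0
    rw [hφ, this]
    exact map_zero linMap
  · rw [hφ] at ha
    exact (Submodule.projection_apply_eq_zero_iff hq.symm).1 (lin_eq_zero ha)

theorem isPrime_span_lin (s : Set (Fin 4 → ℚ)) : (Ideal.span (lin '' s)).IsPrime := by
  obtain ⟨φ, h, -⟩ := exists_ker_eq_span_lin s
  exact h ▸ RingHom.ker_isPrime _

theorem lin_mem_span_iff {s : Set (Fin 4 → ℚ)} {a : Fin 4 → ℚ} :
    lin a ∈ Ideal.span (lin '' s) ↔ a ∈ Submodule.span ℚ s := by
  refine ⟨fun h => ?_, lin_mem_span⟩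
  obtain ⟨φ, hφ, h'⟩ := exists_ker_eq_span_lin s
  rw [← hφ] at h
  exact h' a h

section PrimePairs

variable {A ι : Type*} [CommRing A] [DecidableEq ι]

theorem exists_eq_add_mul_prod {l : ι → A}
    (hprime : ∀ i j, i ≠ j → (Ideal.span {l i, l j}).IsPrime)
    (hnot : ∀ i j k, i ≠ j → i ≠ k → j ≠ k → l k ∉ Ideal.span {l i, l j})
    (n : ι) (S : Finset ι) (hn : n ∉ S) (g : A) (hg : ∀ j ∈ S, g ∈ Ideal.span {l n, l j}) :
    ∃ a b, g = a * l n + b * ∏ j ∈ S, l j := by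
  induction S using Finset.induction_on with
  | empty => exact ⟨0, g, by simp⟩
  | insert k S hk ih =>
    rw [Finset.mem_insert, not_or] at hn
    obtain ⟨a, b, hab⟩ := ih hn.2 fun j hj => hg j (Finset.mem_insert_of_mem hj)
    have hP := hprime n k hn.1
    have hb : b * ∏ j ∈ S, l j ∈ Ideal.span {l n, l k} := by
      have h1 := hg k (Finset.mem_insert_self _ _)
      have h2 : a * l n ∈ Ideal.span {l n, l k} :=
        Ideal.mul_mem_left _ _ (Ideal.subset_span (by simp))
      simpa [hab] using sub_mem h1 h2
    have hb' : b ∈ Ideal.span {l n, l k} := by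
      refine (hP.mem_or_mem hb).resolve_right fun h => ?_
      obtain ⟨j, hj, h⟩ := hP.prod_mem_iff.1 h
      exact hnot n k j hn.1 (fun e => hn.2 (e ▸ hj)) (fun e => hk (e ▸ hj)) h
    obtain ⟨d, e, rfl⟩ := Ideal.mem_span_pair.1 hb'
    refine ⟨a + d * ∏ j ∈ S, l j, e, ?_⟩
    rw [hab, Finset.prod_insert hk]
    ring

/-- If all pairs of the `l i` generate prime ideals which contain no third `l k`, then the
intersection of these ideals is generated by the products of all but one of the `l i`. -/
theorem exists_eq_sum_mul_prod_erase {l : ι → A}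
    (hprime : ∀ i j, i ≠ j → (Ideal.span {l i, l j}).IsPrime)
    (hnot : ∀ i j k, i ≠ j → i ≠ k → j ≠ k → l k ∉ Ideal.span {l i, l j})
    (S : Finset ι) (hS : S.Nonempty) (g : A)
    (hg : ∀ i ∈ S, ∀ j ∈ S, i ≠ j → g ∈ Ideal.span {l i, l j}) :
    ∃ h : ι → A, g = ∑ i ∈ S, h i * ∏ j ∈ S.erase i, l j := by
  induction hS using Finset.Nonempty.cons_induction generalizing g with
  | singleton a => exact ⟨fun _ => g, by simp⟩
  | cons n S hn hS ih =>
    rw [Finset.cons_eq_insert] at hg ⊢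
    have hne {j : ι} (hj : j ∈ S) : n ≠ j := fun e => hn (e ▸ hj)
    obtain ⟨a, b, rfl⟩ := exists_eq_add_mul_prod hprime hnot n S hn g fun j hj =>
      hg n (Finset.mem_insert_self _ _) j (Finset.mem_insert_of_mem hj) (hne hj)
    obtain ⟨h, rfl⟩ := ih a fun i hi j hj hij => by
      have h1 := hg i (Finset.mem_insert_of_mem hi) j (Finset.mem_insert_of_mem hj) hij
      have h2 : b * ∏ j ∈ S, l j ∈ Ideal.span {l i, l j} :=
        Ideal.mul_mem_left _ _ (Ideal.mem_of_dvd _ (Finset.dvd_prod_of_mem l hi)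
          (Ideal.subset_span (by simp)))
      have h3 : a * l n ∈ Ideal.span {l i, l j} := by simpa using sub_mem h1 h2
      exact ((hprime i j hij).mem_or_mem h3).resolve_right
        (hnot i j n hij (hne hi).symm (hne hj).symm)
    refine ⟨Function.update h n b, ?_⟩
    rw [Finset.sum_insert hn, Finset.erase_insert hn, Function.update_self, add_comm,
      Finset.sum_mul]
    congr 1
    refine Finset.sum_congr rfl fun i hi => ?_
    rw [Function.update_of_ne (hne hi).symm, Finset.erase_insert_of_ne (hne hi),
      Finset.prod_insert (fun hm => hn (Finset.mem_of_mem_erase hm))]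
    ring

end PrimePairs

theorem exists_minor_ne_zero : ∀ i j k : Fin 8, i ≠ j → i ≠ k → j ≠ k → ∃ p q r : Fin 4,
    c i p * (c j q * c k r - c j r * c k q) - c i q * (c j p * c k r - c j r * c k p)
      + c i r * (c j p * c k q - c j q * c k p) ≠ 0 := by
  decide +kernel

/-- No three of the eight planes share a line. -/
theorem c_notMem_span {i j k : Fin 8} (hij : i ≠ j) (hik : i ≠ k) (hjk : j ≠ k) :
    c k ∉ Submodule.span ℚ ({c i, c j} : Set (Fin 4 → ℚ)) := by
  rw [Submodule.mem_span_pair]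
  rintro ⟨a, b, h⟩
  obtain ⟨p, q, r, hne⟩ := exists_minor_ne_zero i j k hij hik hjk
  refine hne ?_
  simp only [← h, Pi.add_apply, Pi.smul_apply, smul_eq_mul]
  ring

theorem linearIndependent_c {i j : Fin 8} (hij : i ≠ j) : LinearIndependent ℚ ![c i, c j] := by
  obtain ⟨k, hik, hjk⟩ : ∃ k, i ≠ k ∧ j ≠ k := by
    revert i j; decide
  have h0 : c i ≠ 0 := fun h => c_notMem_span hjk hij.symm hik.symm (h ▸ zero_mem _)
  rw [LinearIndependent.pair_iff' h0]
  intro a ha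
  refine c_notMem_span hik hij hjk.symm ?_
  rw [← ha]
  exact Submodule.smul_mem _ _ (Submodule.subset_span (by simp))

theorem isPrime_span_pair (i j : Fin 8) : (Ideal.span {lin (c i), lin (c j)}).IsPrime := by
  rw [← Set.image_pair]
  exact isPrime_span_lin _

theorem lin_c_notMem_span {i j k : Fin 8} (hij : i ≠ j) (hik : i ≠ k) (hjk : j ≠ k) :
    lin (c k) ∉ Ideal.span {lin (c i), lin (c j)} := by
  rw [← Set.image_pair, lin_mem_span_iff]
  exact c_notMem_span hij hik hjk

/-- The product of all the planes but the `i`-th. -/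
def cofactor (i : Fin 8) : R := ∏ j ∈ Finset.univ.erase i, lin (c j)

theorem lin_mul_cofactor (i : Fin 8) : lin (c i) * cofactor i = f :=
  Finset.mul_prod_erase _ _ (Finset.mem_univ i)

theorem isHomogeneous_cofactor (i : Fin 8) : (cofactor i).IsHomogeneous 7 := by
  have := IsHomogeneous.prod (Finset.univ.erase i) (fun j => lin (c j)) (fun _ => 1)
    fun j _ => isHomogeneous_lin (c j)
  simpa [cofactor, Finset.card_erase_of_mem] using this

theorem pderiv_lin (k : Fin 4) (a : Fin 4 → ℚ) : pderiv k (lin a) = C (a k) := by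
  simp [lin, pderiv_X, Pi.single_apply]

theorem pderiv_f (k : Fin 4) : pderiv k f = ∑ i, C (c i k) * cofactor i := by
  have (S : Finset (Fin 8)) : pderiv k (∏ i ∈ S, lin (c i)) =
      ∑ i ∈ S, C (c i k) * ∏ j ∈ S.erase i, lin (c j) := by
    induction S using Finset.induction_on with
    | empty => simp
    | insert n S hn ih =>
      rw [Finset.prod_insert hn, Derivation.leibniz, ih, Finset.sum_insert hn,
        Finset.erase_insert hn, pderiv_lin, add_comm, smul_eq_mul, smul_eq_mul,
        Finset.mul_sum, mul_comm]
      congr 1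
      refine Finset.sum_congr rfl fun i hi => ?_
      have hni : n ≠ i := fun e => hn (e ▸ hi)
      rw [Finset.erase_insert_of_ne hni,
        Finset.prod_insert (fun hm => hn (Finset.mem_of_mem_erase hm))]
      ring
  exact this Finset.univ

theorem pderiv_f_mem_Jf (k : Fin 4) : pderiv k f ∈ Jf := by
  apply Ideal.subset_span
  fin_cases k <;> simp

theorem sum_mul_pderiv_f (a : Fin 4 → R) :
    ∑ k, a k * pderiv k f = ∑ i, (∑ k, C (c i k) * a k) * cofactor i := by
  simp_rw [pderiv_f, Finset.mul_sum, Finset.sum_mul]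
  rw [Finset.sum_comm]
  exact Finset.sum_congr rfl fun i _ => Finset.sum_congr rfl fun k _ => by ring

theorem mem_Jf {p : R} (hp : p ∈ Jf) : ∃ a : Fin 4 → R, p = ∑ k, a k * pderiv k f := by
  have h : Set.range (fun k => pderiv k f) = {pderiv 0 f, pderiv 1 f, pderiv 2 f, pderiv 3 f} := by
    ext q
    simp [Fin.exists_fin_succ, eq_comm]
  rw [Jf, ← h, Ideal.mem_span_range_iff_exists_fun] at hp
  obtain ⟨a, ha⟩ := hp
  exact ⟨a, ha.symm⟩

theorem f_mem_Jf : f ∈ Jf := by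
  have h : ∑ k, X k * pderiv k f = 8 * f := by
    rw [sum_mul_pderiv_f]
    change ∑ i, lin (c i) * cofactor i = 8 * f
    simp [lin_mul_cofactor]
  have h8 : f = C (1 / 8) * (8 * f) := by
    rw [← mul_assoc, ← map_ofNat C 8, ← C_mul]
    norm_num
  rw [h8, ← h]
  exact Ideal.mul_mem_left _ _
    (sum_mem fun k _ => Ideal.mul_mem_left _ _ (pderiv_f_mem_Jf k))

theorem cofactor_mem_span {i j : Fin 8} (hij : i ≠ j) (n : Fin 8) :
    cofactor n ∈ Ideal.span {lin (c i), lin (c j)} := by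
  rcases eq_or_ne n i with rfl | hn
  · exact Ideal.mem_of_dvd _
      (Finset.dvd_prod_of_mem (fun j => lin (c j)) (by simpa using hij.symm))
      (Ideal.subset_span (by simp))
  · exact Ideal.mem_of_dvd _
      (Finset.dvd_prod_of_mem (fun j => lin (c j)) (by simpa using hn.symm))
      (Ideal.subset_span (by simp))

theorem Jf_le_span {i j : Fin 8} (hij : i ≠ j) : Jf ≤ Ideal.span {lin (c i), lin (c j)} := by
  intro p hp
  obtain ⟨a, rfl⟩ := mem_Jf hp
  rw [sum_mul_pderiv_f]
  exact sum_mem fun n _ => Ideal.mul_mem_left _ _ (cofactor_mem_span hij n)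

theorem Jf_le_Ieq : Jf ≤ Ieq :=
  le_inf (le_iInf fun _ => le_iInf fun _ => le_iInf fun _ => le_sup_right)
    (le_iInf fun _ => le_iInf fun _ => le_iInf fun _ => le_sup_right)

theorem Ieq_le_span {i j : Fin 8} (hij : i ≠ j) : Ieq ≤ Ideal.span {lin (c i), lin (c j)} := by
  refine inf_le_left.trans <| (iInf_le_of_le i <| iInf_le_of_le j <|
    iInf_le_of_le (linearIndependent_c hij) le_rfl).trans (sup_le ?_ (Jf_le_span hij))
  refine Ideal.pow_le_self (Set.ncard_ne_zero_of_mem (a := i) ?_)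
  exact Submodule.subset_span (by simp)

theorem Ieq_le_point {v : Fin 4 → ℚ} (hv : v ≠ 0) (hm : 3 ≤ m v) : Ieq ≤ IP v ^ m v + Jf :=
  inf_le_right.trans <| iInf_le_of_le v <| iInf_le_of_le hv <| iInf_le_of_le hm le_rfl

theorem homogeneousComponent_mul_of_right {p q : R} {i n : ℕ} (hq : q.IsHomogeneous i)
    (h : i ≤ n) : homogeneousComponent n (p * q) = homogeneousComponent (n - i) p * q := by
  let _ := gradedAlgebra (σ := Fin 4) (R := ℚ)
  have := DirectSum.coe_decompose_mul_of_right_mem_of_le (homogeneousSubmodule (Fin 4) ℚ)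
    (a := p) (b := q) (n := n) (i := i) hq h
  simp only [← decomposition.decompose'_apply]
  exact this

/-- The octics vanishing along all the double lines are the first-order displacements of the
eight planes. -/
theorem exists_eq_sum_lin_mul_cofactor {g : R} (hg : g ∈ Ieq) (hd : g.IsHomogeneous 8) :
    ∃ q : Fin 8 → Fin 4 → ℚ, g = ∑ i, lin (q i) * cofactor i := by
  obtain ⟨h, hh⟩ := exists_eq_sum_mul_prod_erase (l := fun i => lin (c i))
    (fun i j _ => isPrime_span_pair i j) (fun i j k => lin_c_notMem_span) Finset.univ
    Finset.univ_nonempty g fun i _ j _ hij => Ieq_le_span hij hg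
  choose q hq using fun i => exists_eq_lin (homogeneousComponent_isHomogeneous 1 (h i))
  refine ⟨q, ?_⟩
  calc g = homogeneousComponent 8 g := (homogeneousComponent_of_mem hd).symm ▸ (if_pos rfl).symm
    _ = ∑ i, homogeneousComponent 8 (h i * cofactor i) := by
      conv_lhs => rw [hh]
      rw [map_sum]
      rfl
    _ = ∑ i, lin (q i) * cofactor i := Finset.sum_congr rfl fun i _ => by
      rw [homogeneousComponent_mul_of_right (isHomogeneous_cofactor i) (by norm_num), hq]

/-- Restriction to the parametrized line through `v` in the direction `w`. -/
def restrictLine (v w : Fin 4 → ℚ) : R →ₐ[ℚ] Polynomial ℚ :=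
  aeval fun j => Polynomial.C (v j) + Polynomial.C (w j) * Polynomial.X

theorem restrictLine_lin (v w a : Fin 4 → ℚ) : restrictLine v w (lin a) =
    Polynomial.C (a ⬝ᵥ v) + Polynomial.C (a ⬝ᵥ w) * Polynomial.X := by
  simp only [restrictLine, lin, dotProduct, map_sum, map_mul, aeval_X, algHom_C,
    Polynomial.algebraMap_eq, Finset.sum_mul, ← Finset.sum_add_distrib]
  exact Finset.sum_congr rfl fun i _ => by ring

theorem eval_zero_restrictLine (v w : Fin 4 → ℚ) (p : R) :
    (restrictLine v w p).eval 0 = eval v p := by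
  have : (Polynomial.aeval (0 : ℚ)).comp (restrictLine v w) = aeval v := by
    ext j
    simp [restrictLine]
  simpa [Polynomial.coe_aeval_eq_eval, MvPolynomial.coe_aeval_eq_eval] using
    DFunLike.congr_fun this p

theorem X_pow_dvd_restrictLine {v : Fin 4 → ℚ} (w : Fin 4 → ℚ) {n : ℕ} {p : R}
    (hp : p ∈ IP v ^ n) : Polynomial.X ^ n ∣ restrictLine v w p := by
  have h : IP v ≤ (Ideal.span {(Polynomial.X : Polynomial ℚ)}).comap (restrictLine v w) := by
    refine Ideal.span_le.2 ?_
    rintro _ ⟨a, ha, rfl⟩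
    have ha : a ⬝ᵥ v = 0 := ha
    change restrictLine v w (lin a) ∈ Ideal.span {(Polynomial.X : Polynomial ℚ)}
    rw [restrictLine_lin, ha, Ideal.mem_span_singleton]
    simp
  have := (Ideal.pow_right_mono h n).trans (Ideal.le_comap_pow _ n) hp
  rwa [Ideal.mem_comap, Ideal.span_singleton_pow, Ideal.mem_span_singleton] at this

/-- A combination of the cofactors of the expected multiplicity at `v` has coefficients vanishing
at `v` for each plane through `v`. -/
theorem eval_eq_zero_of_sum_mem {v w : Fin 4 → ℚ} {i : Fin 8} (hv : c i ⬝ᵥ v = 0)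
    (hw : ∀ j, c j ⬝ᵥ w = 0 ↔ j = i) {r : Fin 8 → R}
    (h : ∑ j, r j * cofactor j ∈ IP v ^ m v) : eval v (r i) = 0 := by
  have hdvd := X_pow_dvd_restrictLine w h
  have hi : restrictLine v w (lin (c i)) = 0 := by
    rw [restrictLine_lin, hv, (hw i).2 rfl]
    simp
  rw [map_sum, Finset.sum_eq_single i (fun j _ hji => ?_) (by simp)] at hdvd
  swap
  · obtain ⟨e, he⟩ : lin (c i) ∣ cofactor j :=
      Finset.dvd_prod_of_mem (fun j => lin (c j)) (by simpa using hji.symm)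
    rw [map_mul, he, map_mul, hi, zero_mul, mul_zero]
  let T := (Finset.univ.erase i).filter fun j => c j ⬝ᵥ v = 0
  let U := (Finset.univ.erase i).filter fun j => ¬ c j ⬝ᵥ v = 0
  have hm : m v = T.card + 1 := by
    have : {j : Fin 8 | c j ⬝ᵥ v = 0} = (insert i T : Finset (Fin 8)) := by
      ext j
      rcases eq_or_ne j i with rfl | hj
      · simp [hv]
      · simp [T, hj]
    rw [m, this, Set.ncard_coe_finset, Finset.card_insert_of_notMem (by simp [T])]
  have hcof : restrictLine v w (cofactor i) = Polynomial.X ^ T.card *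
      ((∏ j ∈ T, Polynomial.C (c j ⬝ᵥ w)) * ∏ j ∈ U, restrictLine v w (lin (c j))) := by
    rw [cofactor, map_prod, ← Finset.prod_filter_mul_prod_filter_not _ (fun j => c j ⬝ᵥ v = 0),
      ← mul_assoc, ← Finset.prod_const, ← Finset.prod_mul_distrib]
    congr 1
    refine Finset.prod_congr rfl fun j hj => ?_
    rw [restrictLine_lin, (Finset.mem_filter.1 hj).2]
    rw [map_zero, zero_add, mul_comm]
  rw [hm, map_mul, hcof, pow_succ, mul_left_comm,
    mul_dvd_mul_iff_left (pow_ne_zero _ Polynomial.X_ne_zero), Polynomial.X_dvd_iff,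
    Polynomial.coeff_zero_eq_eval_zero] at hdvd
  simp only [Polynomial.eval_mul, Polynomial.eval_prod, Polynomial.eval_C,
    eval_zero_restrictLine, eval_lin] at hdvd
  refine (mul_eq_zero.1 hdvd).resolve_right
    (mul_ne_zero (Finset.prod_ne_zero_iff.2 fun j hj => ?_)
      (Finset.prod_ne_zero_iff.2 fun j hj => (Finset.mem_filter.1 hj).2))
  rw [Ne, hw]
  exact Finset.ne_of_mem_erase (Finset.mem_filter.1 hj).1

/-- For each plane, a direction which lies in it but in no other plane. -/
def direction : Fin 8 → Fin 4 → ℚ :=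
  ![![1,2,3,1], ![-1,2,3,1], ![2,1,3,1], ![2,-1,3,1],
    ![2,3,1,1], ![2,3,-1,1], ![2,3,-6,1], ![2,3,-4,1]]

theorem dotProduct_direction : ∀ i j, c j ⬝ᵥ direction i = 0 ↔ j = i := by
  decide +kernel

/-- The twelve points which lie on four of the planes. -/
def fourfoldPoint : Fin 12 → Fin 4 → ℚ :=
  ![![1,0,0,0], ![0,1,0,0], ![0,0,1,0], ![0,1,-1,0],
    ![1,0,-1,0], ![1,-1,0,0], ![1,1,-1,1], ![1,-1,1,1],
    ![1,-1,-1,1], ![-1,1,1,1], ![-1,1,-1,1], ![-1,-1,1,1]]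

/-- The coefficients of the linear relation between the planes through each fourfold point. -/
def relation : Fin 12 → Fin 8 → ℚ :=
  ![![0,0,1,-1,-1,1,0,0], ![1,-1,0,0,-1,1,0,0], ![1,-1,-1,1,0,0,0,0],
    ![-1,1,0,0,0,0,-1,1], ![0,0,-1,1,0,0,-1,1], ![0,0,0,0,-1,1,-1,1],
    ![-1,0,-1,0,0,-1,0,1], ![-1,0,0,-1,-1,0,0,1], ![-1,0,0,-1,0,-1,1,0],
    ![0,-1,-1,0,-1,0,0,1], ![0,-1,-1,0,0,-1,1,0], ![0,-1,0,-1,-1,0,1,0]]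

theorem fourfoldPoint_ne_zero : ∀ n, fourfoldPoint n ≠ 0 := by
  decide +kernel

theorem card_planes_fourfoldPoint :
    ∀ n, (Finset.univ.filter fun i => c i ⬝ᵥ fourfoldPoint n = 0).card = 4 := by
  decide +kernel

theorem dotProduct_fourfoldPoint :
    ∀ n i, relation n i ≠ 0 → c i ⬝ᵥ fourfoldPoint n = 0 := by
  decide +kernel

theorem sum_relation_smul : ∀ n, ∑ i, relation n i • c i = 0 := by
  decide +kernel

theorem three_le_m_fourfoldPoint (n : Fin 12) : 3 ≤ m (fourfoldPoint n) := by
  have h := card_planes_fourfoldPoint n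
  rw [← Set.ncard_coe_finset, Finset.coe_filter_univ] at h
  exact h.ge.trans' (by norm_num)

/-- To first order the planes through a multiple point keep passing through a common point. -/
theorem exists_dotProduct_eq {q : Fin 8 → Fin 4 → ℚ} (hg : ∑ i, lin (q i) * cofactor i ∈ Ieq)
    {v : Fin 4 → ℚ} (hm : 3 ≤ m v) (hv : v ≠ 0) :
    ∃ u : Fin 4 → ℚ, ∀ i, c i ⬝ᵥ v = 0 → q i ⬝ᵥ v = c i ⬝ᵥ u := by
  obtain ⟨p, hp, s, hs, hps⟩ := Submodule.mem_sup.1 (Ieq_le_point hv hm hg)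
  obtain ⟨a, rfl⟩ := mem_Jf hs
  refine ⟨fun k => eval v (a k), fun i hi => ?_⟩
  have hsum : ∑ i, (lin (q i) - ∑ k, C (c i k) * a k) * cofactor i ∈ IP v ^ m v := by
    simp_rw [sub_mul]
    rw [Finset.sum_sub_distrib, ← hps, sum_mul_pderiv_f, add_sub_cancel_right]
    exact hp
  have := eval_eq_zero_of_sum_mem hi (dotProduct_direction i) hsum
  rw [map_sub, eval_lin, sub_eq_zero] at this
  simpa [dotProduct] using this

/-- The linear relation at each fourfold point is preserved to first order. -/
theorem sum_relation_mul_eq_zero {q : Fin 8 → Fin 4 → ℚ}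
    (hg : ∑ i, lin (q i) * cofactor i ∈ Ieq) (n : Fin 12) :
    ∑ i, relation n i * q i ⬝ᵥ fourfoldPoint n = 0 := by
  obtain ⟨u, hu⟩ :=
    exists_dotProduct_eq hg (three_le_m_fourfoldPoint n) (fourfoldPoint_ne_zero n)
  calc ∑ i, relation n i * q i ⬝ᵥ fourfoldPoint n = ∑ i, relation n i * c i ⬝ᵥ u :=
        Finset.sum_congr rfl fun i _ => by
          by_cases h : relation n i = 0
          · simp [h]
          · rw [hu i (dotProduct_fourfoldPoint n i h)]
    _ = (∑ i, relation n i • c i) ⬝ᵥ u := by simp [sum_dotProduct]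
    _ = 0 := by simp [sum_relation_smul]

set_option maxHeartbeats 1000000 in
/-- The displacements which preserve the linear relation at each of the twelve fourfold points are
infinitesimal projective motions of the arrangement, up to rescaling the planes. -/
theorem exists_displacement {q : Fin 8 → Fin 4 → ℚ}
    (hq : ∀ n, ∑ i, relation n i * q i ⬝ᵥ fourfoldPoint n = 0) :
    ∃ (θ : Fin 4 → Fin 4 → ℚ) (μ : Fin 8 → ℚ), ∀ i, q i = ∑ k, c i k • θ k + μ i • c i := by
  have h0 := hq 0
  have h1 := hq 1
  have h2 := hq 2
  have h3 := hq 3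
  have h4 := hq 4
  have h5 := hq 5
  have h6 := hq 6
  have h7 := hq 7
  have h8 := hq 8
  have h9 := hq 9
  have h10 := hq 10
  have h11 := hq 11
  simp [relation, fourfoldPoint, dotProduct, Fin.sum_univ_succ]
    at h0 h1 h2 h3 h4 h5 h6 h7 h8 h9 h10 h11
  refine ⟨![![(q 0 0 + q 0 3 + q 1 0 - q 1 3) / 2,
      (q 0 1 + q 1 1) / 2,
      (q 0 2 + q 1 2) / 2,
      (q 0 0 + q 0 3 - q 1 0 + q 1 3 - q 2 0 + q 3 0) / 2],
    ![(q 2 0 + q 3 0) / 2,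
      (q 2 1 + q 2 3 + q 3 1 - q 3 3) / 2,
      (-q 0 2 + q 1 2 + 2 * q 2 2) / 2,
      (-q 0 1 + q 1 1 + q 2 1 + q 2 3 - q 3 1 + q 3 3) / 2],
    ![(-q 2 0 + q 3 0 + 2 * q 4 0) / 2,
      (-q 0 1 + q 1 1 + 2 * q 4 1) / 2,
      (q 4 2 + q 4 3 + q 5 2 - q 5 3) / 2,
      (-q 0 2 + q 1 2 + q 4 2 + q 4 3 - q 5 2 + q 5 3) / 2],
    ![(-q 2 0 + q 3 0) / 2,
      (-q 0 1 + q 1 1) / 2,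
      (-q 0 2 + q 1 2) / 2,
      0]],
    ![(q 0 0 - q 0 3 - q 1 0 + q 1 3 - q 2 0 + q 3 0) / 2,
      (-q 0 0 - q 0 3 + q 1 0 + q 1 3 + q 2 0 - q 3 0) / 2,
      (-q 0 1 + q 1 1 + q 2 1 - q 2 3 - q 3 1 + q 3 3) / 2,
      (q 0 1 - q 1 1 - q 2 1 - q 2 3 + q 3 1 + q 3 3) / 2,
      (-q 0 2 + q 1 2 + q 4 2 - q 4 3 - q 5 2 + q 5 3) / 2,
      (q 0 2 - q 1 2 - q 4 2 - q 4 3 + q 5 2 + q 5 3) / 2,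
      (-q 0 0 - q 0 3 - q 1 0 + q 1 3 + q 2 0 - 3 * q 3 0 - 2 * q 4 0 + 2 * q 6 0) / 2,
      (-q 0 0 - q 0 3 - q 1 0 + q 1 3 - q 2 0 - q 3 0 - 2 * q 4 0 + 2 * q 7 0) / 2], fun i => ?_⟩
  fin_cases i <;> funext j <;> fin_cases j <;> simp [Fin.sum_univ_succ, c] <;> linarith

/-- The degree-8 homogeneous components of `I_eq` and of `Jf` coincide;
equivalently `dim_ℚ (I_eq/Jf)^(8) = 0`: arrangement no. 85 admits no
nontrivial equisingular deformations, and the associated double octic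
Calabi–Yau threefold is rigid. -/
theorem arrangement85_rigid :
    Submodule.restrictScalars ℚ Ieq ⊓ homogeneousSubmodule (Fin 4) ℚ 8 =
    Submodule.restrictScalars ℚ Jf ⊓ homogeneousSubmodule (Fin 4) ℚ 8 := by
  refine le_antisymm (fun g ⟨hg, hd⟩ => ⟨?_, hd⟩) (inf_le_inf_right _ fun g hg => Jf_le_Ieq hg)
  change g ∈ Jf
  obtain ⟨q, rfl⟩ := exists_eq_sum_lin_mul_cofactor hg hd
  obtain ⟨θ, μ, hq⟩ := exists_displacement (sum_relation_mul_eq_zero hg)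
  have hsum : ∑ i, lin (q i) * cofactor i =
      ∑ k, lin (θ k) * pderiv k f + ∑ i, C (μ i) * f := by
    rw [sum_mul_pderiv_f, ← Finset.sum_add_distrib]
    refine Finset.sum_congr rfl fun i _ => ?_
    have : lin (q i) = ∑ k, C (c i k) * lin (θ k) + C (μ i) * lin (c i) := by
      simp only [hq i, ← linMap_apply, map_add, map_sum, map_smul, smul_eq_C_mul]
    rw [this, add_mul, mul_assoc, lin_mul_cofactor]
  rw [hsum]
  exact add_mem (sum_mem fun k _ => Ideal.mul_mem_left _ _ (pderiv_f_mem_Jf k))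
    (sum_mem fun i _ => Ideal.mul_mem_left _ _ f_mem_Jf)

end Octic85
end
end

section
/- Let f = xyzt(x+y)(y+z)(z+t)(x+2t) ∈ ℚ[x,y,z,t], the member of the one-dimensional family no. 1, f = xyzt(x+y)(y+z)(z+t)(Ax+Bt), with (A,B) = (1,2), and let Jf and I_eq be its Jacobian ideal and equisingular ideal. Then dim_ℚ (I_eq/Jf)^(8) = 1, i.e., the degree-8 homogeneous component of I_eq contains the degree-8 homogeneous component of Jf as a codimension-1 subspace. (Hence this octic has a one-dimensional space of equisingular deformations, in accordance with h^{1,2} = 1 for arrangement no. 1.) -/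
/-!
One-dimensional equisingular deformation space of the double octic of the
one-parameter family no. 1 at `(A,B) = (1,2)`:
for `f = xyzt(x+y)(y+z)(z+t)(x+2t)` we have `dim_ℚ (I_eq/Jf)^(8) = 1`.
-/

noncomputable section

open Matrix MvPolynomial

namespace OcticFamily1

/-- `R = ℚ[x,y,z,t]` -/
abbrev R : Type := MvPolynomial (Fin 4) ℚ

/-- The linear polynomial with coefficient vector `a`. -/
def lin (a : Fin 4 → ℚ) : R := ∑ j, C (a j) * X j

/-- Coefficient vectors of the eight planes `x, y, z, t, x+y, y+z, z+t, x+2t` (family no. 1 with `(A,B) = (1,2)`). -/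
def c : Fin 8 → Fin 4 → ℚ :=
  ![![1,0,0,0], ![0,1,0,0], ![0,0,1,0], ![0,0,0,1],
    ![1,1,0,0], ![0,1,1,0], ![0,0,1,1], ![1,0,0,2]]

/-- The octic `f = xyzt(x+y)(y+z)(z+t)(x+2t)`. -/
def f : R := ∏ i, lin (c i)

/-- The Jacobian ideal of `f`. -/
def Jf : Ideal R :=
  Ideal.span {pderiv 0 f, pderiv 1 f, pderiv 2 f, pderiv 3 f}

/-- `m(P)`: the number of the eight planes through the point `v`. -/
def m (v : Fin 4 → ℚ) : ℕ := {i : Fin 8 | c i ⬝ᵥ v = 0}.ncard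

/-- `m(ℓᵢ,ℓⱼ)`: the number of the eight factors lying in the pencil spanned by
`ℓᵢ` and `ℓⱼ` (the multiplicity of `f` along the line `ℓᵢ = ℓⱼ = 0`). -/
def mLine (i j : Fin 8) : ℕ :=
  {k : Fin 8 | c k ∈ Submodule.span ℚ ({c i, c j} : Set (Fin 4 → ℚ))}.ncard

/-- `I_P`: the ideal of the point `v`, generated by all linear forms
vanishing at `v`. -/
def IP (v : Fin 4 → ℚ) : Ideal R :=
  Ideal.span (lin '' {a : Fin 4 → ℚ | a ⬝ᵥ v = 0})

/-- The equisingular ideal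
`I_eq = ⋂ ((ℓ,ℓ′)^{m(ℓ,ℓ′)} + Jf) ∩ ⋂ (I_P^{m(P)} + Jf)`, the first
intersection over all pairs of linearly independent factors, the second over
all points of `ℙ³(ℚ)` lying on at least three of the eight planes. -/
def Ieq : Ideal R :=
  (⨅ (i : Fin 8) (j : Fin 8) (_ : LinearIndependent ℚ ![c i, c j]),
      (Ideal.span {lin (c i), lin (c j)} ^ mLine i j + Jf)) ⊓
  (⨅ (v : Fin 4 → ℚ) (_ : v ≠ 0) (_ : 3 ≤ m v), (IP v ^ m v + Jf))

/-- The degree-8 homogeneous component of `I_eq`, as a `ℚ`-subspace of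
`ℚ[x,y,z,t]`. -/
def E : Submodule ℚ R :=
  Submodule.restrictScalars ℚ Ieq ⊓ homogeneousSubmodule (Fin 4) ℚ 8

/-- The degree-8 homogeneous component of `Jf`, as a `ℚ`-subspace of
`ℚ[x,y,z,t]`. -/
def F : Submodule ℚ R :=
  Submodule.restrictScalars ℚ Jf ⊓ homogeneousSubmodule (Fin 4) ℚ 8

theorem prod_dvd_of_forall_pow_card_dvd {ι A : Type*} [CommRing A] [IsDomain A] [DecidableEq ι]
    [DecidableRel ((· ∣ ·) : A → A → Prop)] (T : Finset ι) (d : ι → A)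
    (hd : ∀ j ∈ T, Prime (d j)) (H : A)
    (hH : ∀ j ∈ T, d j ^ (T.filter fun k => d j ∣ d k).card ∣ H) : ∏ j ∈ T, d j ∣ H := by
  induction T using Finset.induction_on generalizing H with
  | empty => simp
  | insert a T ha ih =>
    have hpa := hd a (Finset.mem_insert_self a T)
    obtain ⟨H', rfl⟩ : d a ∣ H := by
      refine (dvd_pow_self _ ?_).trans (hH a (Finset.mem_insert_self a T))
      exact Finset.card_ne_zero_of_mem (a := a) (by simp)
    rw [Finset.prod_insert ha]
    refine mul_dvd_mul_left _ (ih (fun j hj => hd j (Finset.mem_insert_of_mem hj)) H' ?_)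
    intro j hj
    have hpj := hd j (Finset.mem_insert_of_mem hj)
    have key := hH j (Finset.mem_insert_of_mem hj)
    rw [Finset.filter_insert] at key
    split_ifs at key with hja
    · rw [Finset.card_insert_of_notMem (by simp [ha]), pow_succ'] at key
      obtain ⟨u, hu⟩ := hpj.associated_of_dvd hpa hja
      rw [← hu, mul_assoc] at key
      exact (Units.dvd_mul_left).1 ((mul_dvd_mul_iff_left hpj.ne_zero).1 key)
    · exact hpj.pow_dvd_of_dvd_mul_left _ hja key

theorem lin_add (a b : Fin 4 → ℚ) : lin (a + b) = lin a + lin b := by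
  simp [lin, add_mul, Finset.sum_add_distrib]

theorem lin_smul (r : ℚ) (a : Fin 4 → ℚ) : lin (r • a) = C r * lin a := by
  simp [lin, Finset.mul_sum, mul_assoc]

theorem lin_sub (a b : Fin 4 → ℚ) : lin (a - b) = lin a - lin b := by
  simp [lin, sub_mul, Finset.sum_sub_distrib]

theorem coeff_lin (a : Fin 4 → ℚ) (k : Fin 4) : coeff (Finsupp.single k 1) (lin a) = a k := by
  simp [lin, coeff_sum, coeff_X, Finsupp.single_left_inj]

theorem coeff_lin_mul (a : Fin 4 → ℚ) (s : R) (k : Fin 4) :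
    coeff (Finsupp.single k 1) (lin a * s) = a k * coeff 0 s := by
  rw [lin, Finset.sum_mul, coeff_sum, Finset.sum_eq_single k]
  · rw [mul_assoc, coeff_C_mul]
    simpa using congrArg (a k * ·) (coeff_X_mul (0 : Fin 4 →₀ ℕ) k s)
  · intro j _ hj
    rw [mul_assoc, coeff_C_mul, coeff_X_mul', if_neg (by simpa using hj), mul_zero]
  · simp

theorem lin_isHomogeneous (a : Fin 4 → ℚ) : (lin a).IsHomogeneous 1 :=
  IsHomogeneous.sum _ _ _ fun _ _ => isHomogeneous_C_mul_X _ _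

theorem lin_ne_zero {a : Fin 4 → ℚ} (ha : a ≠ 0) : lin a ≠ 0 := by
  rintro h
  refine ha (funext fun k => ?_)
  simpa [h] using (coeff_lin a k).symm

theorem exists_smul_of_lin_dvd_lin {a b : Fin 4 → ℚ} (h : lin a ∣ lin b) : ∃ r : ℚ, b = r • a := by
  obtain ⟨s, hs⟩ := h
  refine ⟨coeff 0 s, funext fun k => ?_⟩
  rw [← coeff_lin b k, hs, coeff_lin_mul, Pi.smul_apply, smul_eq_mul, mul_comm]

theorem lin_prime {a : Fin 4 → ℚ} (ha : a ≠ 0) : Prime (lin a) := by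
  refine (irreducible_of_totalDegree_eq_one
    ((lin_isHomogeneous a).totalDegree (lin_ne_zero ha)) fun x hx => ?_).prime
  obtain ⟨k, hk⟩ := Function.ne_iff.1 ha
  have := hx (Finsupp.single k 1)
  rw [coeff_lin] at this
  exact isUnit_of_dvd_unit this (isUnit_iff_ne_zero.2 hk)

theorem aeval_lin {A : Type*} [CommRing A] [Algebra ℚ A] (φ : Fin 4 → A) (a : Fin 4 → ℚ) :
    aeval φ (lin a) = ∑ j, algebraMap ℚ A (a j) * φ j := by
  simp [lin]

theorem pderiv_lin (k : Fin 4) (a : Fin 4 → ℚ) : pderiv k (lin a) = C (a k) := by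
  simp [lin, pderiv_X, Pi.single_apply]

/-- The product of all factors of `f` except the `i`-th one. -/
def G (i : Fin 8) : R := ∏ k ∈ Finset.univ.erase i, lin (c k)

theorem lin_mul_G (i : Fin 8) : lin (c i) * G i = f :=
  Finset.mul_prod_erase _ _ (Finset.mem_univ i)

theorem G_isHomogeneous (i : Fin 8) : (G i).IsHomogeneous 7 := by
  simpa [G] using IsHomogeneous.prod (Finset.univ.erase i) (fun k => lin (c k)) (fun _ => 1)
    fun k _ => lin_isHomogeneous (c k)

theorem lin_dvd_G {i k : Fin 8} (h : i ≠ k) : lin (c i) ∣ G k :=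
  Finset.dvd_prod_of_mem _ (by simpa using h)

theorem pderiv_f (k : Fin 4) : pderiv k f = ∑ i, C (c i k) * G i := by
  have key (s : Finset (Fin 8)) : pderiv k (∏ i ∈ s, lin (c i)) =
      ∑ i ∈ s, C (c i k) * ∏ j ∈ s.erase i, lin (c j) := by
    induction s using Finset.induction_on with
    | empty => simp
    | insert a s ha ih =>
      rw [Finset.prod_insert ha, Derivation.leibniz, ih, pderiv_lin, Finset.sum_insert ha,
        Finset.erase_insert ha, smul_eq_mul, smul_eq_mul, add_comm, mul_comm (∏ i ∈ s, _),
        Finset.mul_sum]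
      refine congrArg _ (Finset.sum_congr rfl fun i hi => ?_)
      have hai : a ≠ i := fun h => ha (h ▸ hi)
      rw [Finset.erase_insert_of_ne hai, Finset.prod_insert (by simp [ha])]
      ring
  exact key Finset.univ

theorem mem_Jf_iff {p : R} : p ∈ Jf ↔ ∃ r : Fin 4 → R, p = ∑ k, r k * pderiv k f := by
  have : ({pderiv 0 f, pderiv 1 f, pderiv 2 f, pderiv 3 f} : Set R) =
      Set.range fun k => pderiv k f := by
    ext q
    simp [Fin.exists_fin_succ, eq_comm]
  rw [Jf, this, Ideal.mem_span_range_iff_exists_fun]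
  simp only [eq_comm]

theorem sum_mul_pderiv_f (r : Fin 4 → R) :
    ∑ k, r k * pderiv k f = ∑ i, (∑ k, C (c i k) * r k) * G i := by
  simp only [pderiv_f, Finset.mul_sum, Finset.sum_mul]
  rw [Finset.sum_comm]
  exact Finset.sum_congr rfl fun i _ => Finset.sum_congr rfl fun k _ => by ring

theorem linearIndependent_c {i j : Fin 8} (h : i ≠ j) : LinearIndependent ℚ ![c i, c j] := by
  rw [LinearIndependent.pair_iff]
  intro s t hst
  have h0 := congrFun hst 0
  have h1 := congrFun hst 1
  have h2 := congrFun hst 2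
  have h3 := congrFun hst 3
  fin_cases i <;> fin_cases j <;> first | exact absurd rfl h | skip
  all_goals
    simp [c] at h0 h1 h2 h3
    constructor <;> linarith

/-- The substitution eliminating the variable `X p` by means of the equation `lin a = 0`. -/
def restr (a : Fin 4 → ℚ) (p : Fin 4) : R →ₐ[ℚ] R :=
  aeval fun k => X k - C ((Pi.single p (a p)⁻¹ : Fin 4 → ℚ) k) * lin a

theorem restr_lin (a : Fin 4 → ℚ) (p : Fin 4) (b : Fin 4 → ℚ) :
    restr a p (lin b) = lin (b - (b p * (a p)⁻¹) • a) := by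
  rw [restr, aeval_lin, lin_sub, lin_smul]
  simp only [mul_sub, Finset.sum_sub_distrib, ← mul_assoc, ← Finset.sum_mul, algebraMap_eq, ← C_mul,
    ← map_sum]
  simp [Pi.single_apply, lin]

theorem restr_lin_self {a : Fin 4 → ℚ} {p : Fin 4} (hp : a p ≠ 0) : restr a p (lin a) = 0 := by
  rw [restr_lin, mul_inv_cancel₀ hp]
  simp [lin]

theorem lin_dvd_sub_restr (a : Fin 4 → ℚ) (p : Fin 4) (q : R) : lin a ∣ q - restr a p q := by
  rw [← Ideal.mem_span_singleton, ← Ideal.Quotient.eq]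
  have : Ideal.Quotient.mkₐ ℚ (Ideal.span {lin a}) =
      (Ideal.Quotient.mkₐ ℚ (Ideal.span {lin a})).comp (restr a p) := by
    refine algHom_ext fun k => ?_
    simp only [restr, AlgHom.comp_apply, aeval_X, Ideal.Quotient.mkₐ_eq_mk]
    rw [Ideal.Quotient.eq, sub_sub_cancel]
    exact Ideal.mul_mem_left _ _ (Ideal.mem_span_singleton_self _)
  exact DFunLike.congr_fun this q

theorem lin_dvd_of_restr_eq_zero {a : Fin 4 → ℚ} {p : Fin 4} {q : R} (h : restr a p q = 0) :
    lin a ∣ q := by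
  simpa [h] using lin_dvd_sub_restr a p q

theorem exists_c_ne_zero (i : Fin 8) : ∃ p, c i p ≠ 0 := by
  fin_cases i <;> simp [c, Fin.exists_fin_succ]

theorem sub_smul_c_ne_zero {i j : Fin 8} (h : i ≠ j) (r : ℚ) : c j - r • c i ≠ 0 := by
  intro h0
  have := (LinearIndependent.pair_iff.1 (linearIndependent_c h) (-r) 1 (by
    rw [← h0]; module)).2
  exact one_ne_zero this

theorem c_ne_zero (i : Fin 8) : c i ≠ 0 := by
  obtain ⟨p, hp⟩ := exists_c_ne_zero i
  exact fun h => hp (by simp [h])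

theorem f_dvd_of_forall_lin_dvd {q : R} (h : ∀ i, lin (c i) ∣ q) : f ∣ q := by
  classical
  refine prod_dvd_of_forall_pow_card_dvd _ _ (fun j _ => lin_prime (c_ne_zero j)) q fun j _ => ?_
  have : (Finset.univ.filter fun k => lin (c j) ∣ lin (c k)) = {j} := by
    ext k
    simp only [Finset.mem_filter, Finset.mem_univ, true_and, Finset.mem_singleton]
    refine ⟨fun hk => ?_, fun hk => hk ▸ dvd_rfl⟩
    by_contra hne
    obtain ⟨r, hr⟩ := exists_smul_of_lin_dvd_lin hk
    exact sub_smul_c_ne_zero (Ne.symm hne) r (sub_eq_zero.2 hr)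
  rw [this, Finset.card_singleton, pow_one]
  exact h j

/-- The factors other than the `i`-th one, restricted to the `i`-th plane, that are divisible by
the restriction of the `j`-th one lie in the pencil of the two factors. -/
theorem card_filter_restr_dvd_add_one_le {i j : Fin 8} {p : Fin 4}
    [DecidablePred fun k => restr (c i) p (lin (c j)) ∣ restr (c i) p (lin (c k))] :
    ((Finset.univ.erase i).filter fun k =>
      restr (c i) p (lin (c j)) ∣ restr (c i) p (lin (c k))).card + 1 ≤ mLine i j := by
  rw [← Finset.card_insert_of_notMem (a := i) (by simp), mLine, ← Set.ncard_coe_finset]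
  refine Set.ncard_le_ncard (fun k hk => ?_) (Set.toFinite _)
  simp only [Finset.coe_insert, Finset.coe_filter, Finset.mem_erase, Finset.mem_univ, and_true,
    Set.mem_insert_iff, Set.mem_ofPred_eq] at hk ⊢
  rw [Submodule.mem_span_pair]
  obtain rfl | ⟨_, hk⟩ := hk
  · exact ⟨1, 0, by simp⟩
  · rw [restr_lin, restr_lin] at hk
    obtain ⟨r, hr⟩ := exists_smul_of_lin_dvd_lin hk
    refine ⟨c k p * (c i p)⁻¹ - r * (c j p * (c i p)⁻¹), r, ?_⟩
    rw [sub_eq_iff_eq_add] at hr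
    linear_combination (norm := module) -hr

theorem exists_eq_sum_mul_G {h : R}
    (H : ∀ i j, i ≠ j → h ∈ Ideal.span {lin (c i), lin (c j)} ^ (mLine i j - 1)) :
    ∃ q : Fin 8 → R, h = ∑ i, q i * G i := by
  classical
  have key (i : Fin 8) : ∃ q, lin (c i) ∣ h - q * G i := by
    obtain ⟨p, hp⟩ := exists_c_ne_zero i
    have hdvd : restr (c i) p (G i) ∣ restr (c i) p h := by
      rw [G, map_prod]
      refine prod_dvd_of_forall_pow_card_dvd _ _ (fun j hj => ?_) _ fun j hj => ?_
      · rw [restr_lin]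
        exact lin_prime (sub_smul_c_ne_zero (Finset.ne_of_mem_erase hj).symm _)
      · refine (pow_dvd_pow _ (Nat.le_sub_one_of_lt card_filter_restr_dvd_add_one_le)).trans ?_
        have := Ideal.mem_map_of_mem (restr (c i) p) (H i j (Finset.ne_of_mem_erase hj).symm)
        rwa [Ideal.map_pow, Ideal.map_span, Set.image_pair, restr_lin_self hp,
          Ideal.span_insert_zero, Ideal.span_singleton_pow, Ideal.mem_span_singleton] at this
    obtain ⟨q, hq⟩ := hdvd
    refine ⟨q, ?_⟩
    have e : h - q * G i = (h - restr (c i) p h) - q * (G i - restr (c i) p (G i)) := by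
      rw [hq]
      ring
    rw [e]
    exact dvd_sub (lin_dvd_sub_restr _ _ _) (dvd_mul_of_dvd_right (lin_dvd_sub_restr _ _ _) _)
  choose q hq using key
  obtain ⟨e, he⟩ : f ∣ h - ∑ i, q i * G i := by
    refine f_dvd_of_forall_lin_dvd fun i => ?_
    rw [← Finset.add_sum_erase _ _ (Finset.mem_univ i), ← sub_sub]
    exact dvd_sub (hq i) (Finset.dvd_sum fun k hk =>
      dvd_mul_of_dvd_right (lin_dvd_G (Finset.ne_of_mem_erase hk).symm) _)
  refine ⟨q + Pi.single 0 (lin (c 0) * e), ?_⟩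
  simp only [Pi.add_apply, add_mul, Finset.sum_add_distrib]
  rw [Finset.sum_eq_single (a := 0)
    (f := fun i => (Pi.single 0 (lin (c 0) * e) : Fin 8 → R) i * G i)
    (fun i _ hi => by simp [hi]) (by simp), Pi.single_eq_same, mul_right_comm, lin_mul_G]
  rw [← he]
  ring

theorem exists_lin_of_isHomogeneous_one {q : R} (h : q.IsHomogeneous 1) : ∃ b, q = lin b := by
  rw [← mem_homogeneousSubmodule, homogeneousSubmodule_one_eq_span_X,
    Submodule.mem_span_range_iff_exists_fun] at h
  obtain ⟨b, rfl⟩ := h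
  exact ⟨b, by simp [lin, smul_eq_C_mul]⟩

theorem homogeneousComponent_mul_of_isHomogeneous {q g : R} {n k : ℕ} (hg : g.IsHomogeneous n) :
    homogeneousComponent (k + n) (q * g) = homogeneousComponent k q * g := by
  induction q using MvPolynomial.induction_on' with
  | monomial u a =>
    have hu : (monomial u a : R).IsHomogeneous u.degree := isHomogeneous_monomial a rfl
    rw [homogeneousComponent_of_mem hu, homogeneousComponent_of_mem (hu.mul hg)]
    simp [ite_mul]
  | add p q hp hq => rw [add_mul, map_add, hp, hq, map_add, add_mul]

theorem exists_lin_eq_sum_mul_G {h : R} (hh : h.IsHomogeneous 8)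
    (H : ∀ i j, i ≠ j → h ∈ Ideal.span {lin (c i), lin (c j)} ^ (mLine i j - 1)) :
    ∃ b : Fin 8 → Fin 4 → ℚ, h = ∑ i, lin (b i) * G i := by
  obtain ⟨q, hq⟩ := exists_eq_sum_mul_G H
  choose b hb using fun i =>
    exists_lin_of_isHomogeneous_one (homogeneousComponent_isHomogeneous 1 (q i))
  refine ⟨b, ?_⟩
  conv_lhs => rw [← homogeneousComponent_eq_self hh, hq, map_sum]
  refine Finset.sum_congr rfl fun i _ => ?_
  rw [← hb i, ← homogeneousComponent_mul_of_isHomogeneous (G_isHomogeneous i)]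

theorem G_mem_pow {I : Ideal R} {S : Set (Fin 8)} (hS : ∀ k ∈ S, lin (c k) ∈ I) (i : Fin 8) :
    G i ∈ I ^ (S \ {i}).ncard := by
  classical
  have hsub : (S \ {i}).toFinset ⊆ Finset.univ.erase i := fun k hk => by
    simp only [Set.mem_toFinset, Set.mem_sdiff, Set.mem_singleton_iff] at hk
    simp [hk.2]
  rw [G, ← Finset.prod_sdiff hsub, Set.ncard_eq_toFinset_card']
  refine Ideal.mul_mem_left _ _ ?_
  rw [← Finset.prod_const]
  refine Ideal.prod_mem_prod fun k hk => hS k ?_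
  simp only [Set.mem_toFinset, Set.mem_sdiff] at hk
  exact hk.1

theorem mul_G_mem_pow {I : Ideal R} {S : Set (Fin 8)} (hS : ∀ k ∈ S, lin (c k) ∈ I) {i : Fin 8}
    {a : R} (h : i ∈ S → a ∈ I) : a * G i ∈ I ^ S.ncard := by
  by_cases hi : i ∈ S
  · rw [← Set.ncard_sdiff_singleton_add_one hi, pow_succ']
    exact Ideal.mul_mem_mul (h hi) (G_mem_pow hS i)
  · have := G_mem_pow hS i
    rw [Set.sdiff_singleton_eq_self hi] at this
    exact Ideal.mul_mem_left _ _ this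

theorem f_mem_pow {I : Ideal R} {S : Set (Fin 8)} (hS : ∀ k ∈ S, lin (c k) ∈ I) :
    f ∈ I ^ S.ncard := by
  rw [← lin_mul_G 0]
  exact mul_G_mem_pow hS (hS 0)

theorem Jf_le_pow {I : Ideal R} {S : Set (Fin 8)} (hS : ∀ k ∈ S, lin (c k) ∈ I) :
    Jf ≤ I ^ (S.ncard - 1) := by
  intro p hp
  obtain ⟨r, rfl⟩ := mem_Jf_iff.1 hp
  rw [sum_mul_pderiv_f]
  exact Ideal.sum_mem _ fun i _ => Ideal.mul_mem_left _ _
    (Ideal.pow_le_pow_right (Set.pred_ncard_le_ncard_sdiff_singleton S i) (G_mem_pow hS i))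

theorem lin_mem_of_mem_span {i j : Fin 8} {a : Fin 4 → ℚ}
    (ha : a ∈ Submodule.span ℚ ({c i, c j} : Set (Fin 4 → ℚ))) :
    lin a ∈ Ideal.span {lin (c i), lin (c j)} := by
  obtain ⟨s, t, rfl⟩ := Submodule.mem_span_pair.1 ha
  rw [lin_add, lin_smul, lin_smul]
  exact Ideal.mem_span_pair.2 ⟨_, _, rfl⟩

theorem f_eq_X_zero_mul : f = X 0 * G 0 := by
  rw [← lin_mul_G 0]; simp [lin, c, Fin.sum_univ_four]

theorem f_eq_X_one_mul : f = X 1 * G 1 := by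
  rw [← lin_mul_G 1]; simp [lin, c, Fin.sum_univ_four]

theorem f_eq_X_two_mul : f = X 2 * G 2 := by
  rw [← lin_mul_G 2]; simp [lin, c, Fin.sum_univ_four]

theorem f_eq_X_three_mul : f = X 3 * G 3 := by
  rw [← lin_mul_G 3]; simp [lin, c, Fin.sum_univ_four]

theorem f_eq_mul_G_four : f = (X 0 + X 1) * G 4 := by
  rw [← lin_mul_G 4]; simp [lin, c, Fin.sum_univ_four]

theorem f_eq_mul_G_five : f = (X 1 + X 2) * G 5 := by
  rw [← lin_mul_G 5]; simp [lin, c, Fin.sum_univ_four]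

theorem f_eq_mul_G_six : f = (X 2 + X 3) * G 6 := by
  rw [← lin_mul_G 6]; simp [lin, c, Fin.sum_univ_four]

theorem f_eq_mul_G_seven : f = (X 0 + C 2 * X 3) * G 7 := by
  rw [← lin_mul_G 7]; simp [lin, c, Fin.sum_univ_four]

theorem pderiv_zero_f : pderiv 0 f = G 0 + G 4 + G 7 := by
  simp [pderiv_f, c, Fin.sum_univ_eight]

theorem pderiv_one_f : pderiv 1 f = G 1 + G 4 + G 5 := by
  simp [pderiv_f, c, Fin.sum_univ_eight]

theorem pderiv_two_f : pderiv 2 f = G 2 + G 5 + G 6 := by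
  simp [pderiv_f, c, Fin.sum_univ_eight]

theorem pderiv_three_f : pderiv 3 f = G 3 + G 6 + C 2 * G 7 := by
  simp [pderiv_f, c, Fin.sum_univ_eight]

theorem pderiv_mem_Jf (k : Fin 4) : pderiv k f ∈ Jf := by
  refine Ideal.subset_span ?_
  fin_cases k <;> simp

theorem lin_c_zero : lin (c 0) = X 0 := by simp [lin, c, Fin.sum_univ_four]

/-- Moving the last plane inside its pencil is an equisingular deformation: `X 0 * G 7` is up to
the Jacobian ideal a multiple of the ideal of any flat, to the power of its multiplicity. -/
theorem X_zero_mul_G_seven_mem {I : Ideal R} (W : Submodule ℚ (Fin 4 → ℚ))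
    (hI : ∀ a ∈ W, lin a ∈ I) : X 0 * G 7 ∈ I ^ {k : Fin 8 | c k ∈ W}.ncard + Jf := by
  have hS : ∀ k ∈ {k : Fin 8 | c k ∈ W}, lin (c k) ∈ I := fun k hk => hI _ hk
  have hf := f_mem_pow hS
  have hJ (k : Fin 4) (r : R) : r * pderiv k f ∈ Jf := Ideal.mul_mem_left _ _ (pderiv_mem_Jf k)
  have hG {i : Fin 8} (hi : c i ∉ W) (a : R) : a * G i ∈ I ^ {k : Fin 8 | c k ∈ W}.ncard :=
    mul_G_mem_pow hS fun h => absurd h hi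
  rw [Submodule.add_eq_sup]
  by_cases h0 : c 0 ∈ W
  · exact Submodule.mem_sup_left (mul_G_mem_pow hS fun _ => lin_c_zero ▸ hI _ h0)
  by_cases h7 : c 7 ∈ W
  swap
  · exact Submodule.mem_sup_left (hG h7 _)
  by_cases h4 : c 4 ∈ W
  swap
  · refine Submodule.mem_sup.2 ⟨-(f + X 0 * G 4), neg_mem (add_mem hf (hG h4 _)), _, hJ 0 (X 0), ?_⟩
    linear_combination X 0 * pderiv_zero_f - f_eq_X_zero_mul
  by_cases h6 : c 6 ∈ W
  swap
  · refine Submodule.mem_sup.2 ⟨f + f + X 3 * G 6, add_mem (add_mem hf hf) (hG h6 _), _,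
      hJ 3 (-X 3), ?_⟩
    linear_combination -X 3 * pderiv_three_f + f_eq_X_three_mul + f_eq_mul_G_seven
  have h1 : c 1 ∉ W := fun h1 => h0 (by
    have : c 0 = c 4 - c 1 := by ext k; fin_cases k <;> simp [c]
    exact this ▸ sub_mem h4 h1)
  have h5 : c 5 ∉ W := fun h5 => h0 (by
    have : c 0 = (2 : ℚ) • (c 4 - c 5 + c 6) - c 7 := by
      ext k
      fin_cases k <;> simp [c] <;> norm_num
    exact this ▸ sub_mem (W.smul_mem _ (add_mem (sub_mem h4 h5) h6)) h7)
  refine Submodule.mem_sup.2 ⟨X 0 * G 1 + X 0 * G 5 - f, sub_mem (add_mem (hG h1 _) (hG h5 _)) hf,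
    _, sub_mem (hJ 0 (X 0)) (hJ 1 (X 0)), ?_⟩
  linear_combination X 0 * pderiv_zero_f - X 0 * pderiv_one_f - f_eq_X_zero_mul

/-- For every plane of the arrangement a point of it on no other plane. -/
def u : Fin 8 → Fin 4 → ℚ :=
  ![![0,1,1,1], ![1,0,1,1], ![1,1,0,1], ![1,1,1,0],
    ![1,-1,2,1], ![1,1,-1,2], ![1,1,1,-1], ![2,1,2,-1]]

theorem c_dotProduct_u_self (i : Fin 8) : c i ⬝ᵥ u i = 0 := by
  fin_cases i <;> simp [c, u, dotProduct, Fin.sum_univ_four]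

theorem c_dotProduct_u {i k : Fin 8} (h : k ≠ i) : c k ⬝ᵥ u i ≠ 0 := by
  fin_cases i <;> fin_cases k <;> first | exact absurd rfl h | skip
  all_goals simp [c, u, dotProduct, Fin.sum_univ_four] <;> norm_num

theorem eval_lin (v a : Fin 4 → ℚ) : eval v (lin a) = a ⬝ᵥ v := by
  simp [lin, dotProduct]

theorem eval_eq_zero_of_sum_mul_G_mem {v : Fin 4 → ℚ} {a : Fin 8 → R} {i : Fin 8}
    (hi : c i ⬝ᵥ v = 0) (h : ∑ k, a k * G k ∈ IP v ^ m v) : eval v (a i) = 0 := by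
  classical
  let τ : R →ₐ[ℚ] Polynomial ℚ :=
    aeval fun j => Polynomial.C (v j) + Polynomial.X * Polynomial.C (u i j)
  have hτ (b : Fin 4 → ℚ) : τ (lin b) =
      Polynomial.C (b ⬝ᵥ v) + Polynomial.X * Polynomial.C (b ⬝ᵥ u i) := by
    simp only [τ, aeval_lin, dotProduct, map_sum, map_mul, mul_add, Finset.sum_add_distrib,
      Finset.mul_sum, Polynomial.algebraMap_eq]
    exact congrArg _ (Finset.sum_congr rfl fun j _ => by ring)
  have hτ0 (q : R) : (τ q).coeff 0 = eval v q := by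
    have : (Polynomial.aeval (0 : ℚ)).comp τ = aeval v := by
      ext j
      simp [τ]
    simpa [Polynomial.coeff_zero_eq_eval_zero, Polynomial.aeval_def, coe_aeval_eq_eval] using
      DFunLike.congr_fun this q
  have hmap : (IP v).map τ ≤ Ideal.span {Polynomial.X} := by
    rw [IP, Ideal.map_span, Ideal.span_le]
    rintro _ ⟨_, ⟨b, hb, rfl⟩, rfl⟩
    rw [Set.mem_ofPred_eq] at hb
    rw [SetLike.mem_coe, Ideal.mem_span_singleton, hτ, hb]
    simp
  have hdvd : Polynomial.X ^ m v ∣ τ (a i) * τ (G i) := by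
    have h1 := Ideal.mem_map_of_mem τ h
    rw [Ideal.map_pow] at h1
    have h2 := Ideal.pow_right_mono hmap _ h1
    rw [Ideal.span_singleton_pow, Ideal.mem_span_singleton, map_sum,
      Finset.sum_eq_single i _ (by simp), map_mul] at h2
    · exact h2
    · intro k _ hk
      obtain ⟨s, hs⟩ := lin_dvd_G hk.symm
      rw [hs, map_mul, map_mul, hτ, hi, c_dotProduct_u_self]
      simp
  let Q : Fin 8 → Polynomial ℚ := fun k => if c k ⬝ᵥ v = 0 then Polynomial.C (c k ⬝ᵥ u i) else
    Polynomial.C (c k ⬝ᵥ v) + Polynomial.X * Polynomial.C (c k ⬝ᵥ u i)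
  have hQ : ¬ Polynomial.X ∣ ∏ k ∈ Finset.univ.erase i, Q k := by
    rw [Polynomial.prime_X.dvd_finsetProd_iff]
    rintro ⟨k, hk, hdvd⟩
    rw [Polynomial.X_dvd_iff] at hdvd
    by_cases hk0 : c k ⬝ᵥ v = 0
    · simp [Q, hk0, c_dotProduct_u (Finset.ne_of_mem_erase hk)] at hdvd
    · simp [Q, hk0] at hdvd
  have hG : τ (G i) = Polynomial.X ^ (m v - 1) * ∏ k ∈ Finset.univ.erase i, Q k := by
    have hcard : m v - 1 = ((Finset.univ.erase i).filter fun k => c k ⬝ᵥ v = 0).card := by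
      rw [m, ← Set.ncard_sdiff_singleton_of_mem (a := i) (by simpa using hi),
        ← Set.ncard_coe_finset]
      congr 1
      ext k
      simp [and_comm]
    rw [G, map_prod, hcard, ← Finset.prod_const, Finset.prod_filter, ← Finset.prod_mul_distrib]
    refine Finset.prod_congr rfl fun k _ => ?_
    rw [hτ]
    by_cases hk0 : c k ⬝ᵥ v = 0 <;> simp [Q, hk0]
  have hm : m v - 1 + 1 = m v :=
    Nat.sub_add_cancel ((Set.ncard_pos (Set.toFinite _)).2 ⟨i, by simpa using hi⟩)
  rw [hG, mul_left_comm, ← hm, pow_succ, hm,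
    mul_dvd_mul_iff_left (pow_ne_zero _ Polynomial.X_ne_zero)] at hdvd
  have := (Polynomial.prime_X.dvd_or_dvd hdvd).resolve_right hQ
  rwa [Polynomial.X_dvd_iff, hτ0] at this

theorem mem_pow_of_mem_E {h : R} (hE : h ∈ E) {i j : Fin 8} (hij : i ≠ j) :
    h ∈ Ideal.span {lin (c i), lin (c j)} ^ (mLine i j - 1) := by
  have h1 : h ∈ Ideal.span {lin (c i), lin (c j)} ^ mLine i j + Jf := by
    have := hE.1.1
    simp only [SetLike.mem_coe, Ideal.mem_iInf] at this
    exact this i j (linearIndependent_c hij)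
  have hle : Ideal.span {lin (c i), lin (c j)} ^ mLine i j + Jf ≤
      Ideal.span {lin (c i), lin (c j)} ^ (mLine i j - 1) := by
    rw [Submodule.add_eq_sup]
    refine sup_le (Ideal.pow_le_pow_right (Nat.sub_le _ _)) ?_
    exact Jf_le_pow (S := {k | c k ∈ Submodule.span ℚ ({c i, c j} : Set (Fin 4 → ℚ))})
      fun k hk => lin_mem_of_mem_span hk
  exact hle h1

/-- Along a plane of the arrangement through a point of multiplicity at least three, an
equisingular deformation agrees at this point with an infinitesimal motion of the point. -/
theorem exists_dotProduct_eq {b : Fin 8 → Fin 4 → ℚ} (hE : ∑ i, lin (b i) * G i ∈ E)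
    {v : Fin 4 → ℚ} (hv : v ≠ 0) (hm : 3 ≤ m v) :
    ∃ w : Fin 4 → ℚ, ∀ i, c i ⬝ᵥ v = 0 → b i ⬝ᵥ v = c i ⬝ᵥ w := by
  have h1 : ∑ i, lin (b i) * G i ∈ IP v ^ m v + Jf := by
    have := hE.1.2
    simp only [SetLike.mem_coe, Ideal.mem_iInf] at this
    exact this v hv hm
  obtain ⟨p, hp, s, hs, hps⟩ := Submodule.mem_sup.1 h1
  obtain ⟨r, rfl⟩ := mem_Jf_iff.1 hs
  refine ⟨fun k => eval v (r k), fun i hi => ?_⟩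
  have hp' : ∑ i, (lin (b i) - ∑ k, C (c i k) * r k) * G i ∈ IP v ^ m v := by
    rw [sum_mul_pderiv_f, ← eq_sub_iff_add_eq] at hps
    simpa only [hps, sub_mul, Finset.sum_sub_distrib] using hp
  have := eval_eq_zero_of_sum_mul_G_mem hi hp'
  simpa [eval_lin, sub_eq_zero, dotProduct] using this

theorem dotProduct_eq_of_collinear {b : Fin 8 → Fin 4 → ℚ} (hE : ∑ i, lin (b i) * G i ∈ E)
    {i j k : Fin 8} (hij : i ≠ j) (hik : i ≠ k) (hjk : j ≠ k) {s : ℚ} (hc : c k = c i + s • c j)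
    {v : Fin 4 → ℚ} (hv : v ≠ 0) (hi : c i ⬝ᵥ v = 0) (hj : c j ⬝ᵥ v = 0) :
    b k ⬝ᵥ v = b i ⬝ᵥ v + s * b j ⬝ᵥ v := by
  have hk : c k ⬝ᵥ v = 0 := by simp [hc, hi, hj, add_dotProduct, smul_dotProduct]
  have hm : 3 ≤ m v := (Set.two_lt_ncard_iff (Set.toFinite _)).2
    ⟨i, j, k, hi, hj, hk, hij, hik, hjk⟩
  obtain ⟨w, hw⟩ := exists_dotProduct_eq hE hv hm
  rw [hw k hk, hw i hi, hw j hj, hc, add_dotProduct, smul_dotProduct, smul_eq_mul]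

theorem exists_sub_mem_Jf {b : Fin 8 → Fin 4 → ℚ}
    (h42 : b 4 2 = b 0 2 + b 1 2) (h43 : b 4 3 = b 0 3 + b 1 3)
    (h50 : b 5 0 = b 1 0 + b 2 0) (h53 : b 5 3 = b 1 3 + b 2 3)
    (h60 : b 6 0 = b 2 0 + b 3 0) (h61 : b 6 1 = b 2 1 + b 3 1)
    (h71 : b 7 1 = b 0 1 + 2 * b 3 1) (h72 : b 7 2 = b 0 2 + 2 * b 3 2) :
    ∃ γ : ℚ, ∑ i, lin (b i) * G i - C γ * (X 0 * G 7) ∈ Jf := by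
  obtain ⟨p4, hp4⟩ : ∃ p, b 4 0 = b 0 0 + b 1 0 + p := ⟨_, (add_sub_cancel _ _).symm⟩
  obtain ⟨q4, hq4⟩ : ∃ p, b 4 1 = b 0 1 + b 1 1 + p := ⟨_, (add_sub_cancel _ _).symm⟩
  obtain ⟨p5, hp5⟩ : ∃ p, b 5 1 = b 1 1 + b 2 1 + p := ⟨_, (add_sub_cancel _ _).symm⟩
  obtain ⟨q5, hq5⟩ : ∃ p, b 5 2 = b 1 2 + b 2 2 + p := ⟨_, (add_sub_cancel _ _).symm⟩
  obtain ⟨p6, hp6⟩ : ∃ p, b 6 2 = b 2 2 + b 3 2 + p := ⟨_, (add_sub_cancel _ _).symm⟩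
  obtain ⟨q6, hq6⟩ : ∃ p, b 6 3 = b 2 3 + b 3 3 + p := ⟨_, (add_sub_cancel _ _).symm⟩
  obtain ⟨p7, hp7⟩ : ∃ p, b 7 0 = b 0 0 + 2 * b 3 0 + p := ⟨_, (add_sub_cancel _ _).symm⟩
  obtain ⟨q7, hq7⟩ : ∃ p, b 7 3 = b 0 3 + 2 * b 3 3 + 2 * p :=
    ⟨(b 7 3 - (b 0 3 + 2 * b 3 3)) / 2, by ring⟩
  obtain ⟨ρ, hρ4, hρ5, hρ6, hρ⟩ : ∃ ρ : Fin 4 → ℚ, p4 = q4 + ρ 0 - ρ 1 ∧ p5 = q5 + ρ 1 - ρ 2 ∧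
      p6 = q6 + ρ 2 - ρ 3 ∧ q4 = ρ 0 + 2 * ρ 1 + 2 * ρ 2 + 3 * ρ 3 - q5 - q6 - q7 := by
    let s := (q4 + q5 + q6 + q7 - (p4 - q4) - 3 * (p5 - q5) - 5 * (p6 - q6)) / 8
    refine ⟨![s + (p4 - q4) + (p5 - q5) + (p6 - q6), s + (p5 - q5) + (p6 - q6), s + (p6 - q6), s],
      ?_, ?_, ?_, ?_⟩ <;> simp [s] <;> ring
  refine ⟨p7 - q7 - ρ 0 + ρ 3, ?_⟩
  have hJ (k : Fin 4) (i : Fin 8) : (lin (b i) + C (ρ k) * X k) * pderiv k f ∈ Jf :=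
    Ideal.mul_mem_left _ _ (pderiv_mem_Jf k)
  convert add_mem (add_mem (add_mem (hJ 0 0) (hJ 1 1)) (hJ 2 2)) (hJ 3 3) using 1
  have e4 := congrArg (C : ℚ → R) hρ4
  have e5 := congrArg (C : ℚ → R) hρ5
  have e6 := congrArg (C : ℚ → R) hρ6
  have e := congrArg (C : ℚ → R) hρ
  simp only [map_add, map_sub, map_mul, map_ofNat] at e4 e5 e6 e
  simp only [Fin.sum_univ_eight, Fin.sum_univ_four, lin, h42, h43, h50, h53, h60, h61, h71, h72,
    hp4, hq4, hp5, hq5, hp6, hq6, hp7, hq7, map_add, map_sub, map_mul, pderiv_zero_f, pderiv_one_f,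
    pderiv_two_f, pderiv_three_f, e4, e5, e6]
  linear_combination C (ρ 0) * f_eq_X_zero_mul + C (ρ 1) * f_eq_X_one_mul +
    C (ρ 2) * f_eq_X_two_mul + C (ρ 3) * f_eq_X_three_mul - (C q4 - C (ρ 1)) * f_eq_mul_G_four -
    (C q5 - C (ρ 2)) * f_eq_mul_G_five - (C q6 - C (ρ 3)) * f_eq_mul_G_six -
    (C q7 - C (ρ 3)) * f_eq_mul_G_seven + f * e

theorem lin_dvd_of_sum_mul_G_eq_zero {a : Fin 8 → R} (h : ∑ k, a k * G k = 0) (i : Fin 8) :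
    lin (c i) ∣ a i := by
  obtain ⟨p, hp⟩ := exists_c_ne_zero i
  have h0 := congrArg (restr (c i) p) h
  rw [map_sum, map_zero, Finset.sum_eq_single i _ (by simp), map_mul] at h0
  · refine lin_dvd_of_restr_eq_zero ((mul_eq_zero.1 h0).resolve_right ?_)
    rw [G, map_prod]
    refine Finset.prod_ne_zero_iff.2 fun k hk => ?_
    rw [restr_lin]
    exact lin_ne_zero (sub_smul_c_ne_zero (Finset.ne_of_mem_erase hk).symm _)
  · intro k _ hk
    obtain ⟨s, hs⟩ := lin_dvd_G hk.symm
    rw [hs, map_mul, map_mul, restr_lin_self hp, zero_mul, mul_zero]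

theorem false_of_sub_sum_mul_eq (A : Fin 4 → Fin 4 → ℚ) (s : Fin 8 → ℚ)
    (h : ∀ i k, (if i = 7 ∧ k = 0 then 1 else 0) - ∑ j, c i j * A j k = c i k * s i) : False := by
  have h03 := h 0 3
  have h30 := h 3 0
  have h01 := h 0 1
  have h10 := h 1 0
  have h12 := h 1 2
  have h21 := h 2 1
  have h23 := h 2 3
  have h32 := h 3 2
  have h40 := h 4 0
  have h41 := h 4 1
  have h51 := h 5 1
  have h52 := h 5 2
  have h62 := h 6 2
  have h63 := h 6 3
  have h70 := h 7 0
  have h73 := h 7 3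
  simp [c, Fin.sum_univ_four] at h01 h10 h12 h21 h23 h32 h40 h41 h51 h52 h62 h63 h70 h73 h03 h30
  linarith

theorem X_zero_mul_G_seven_notMem_Jf : X 0 * G 7 ∉ Jf := by
  intro h
  obtain ⟨r, hr⟩ := mem_Jf_iff.1 h
  rw [sum_mul_pderiv_f] at hr
  have hsum : ∑ i, ((Pi.single 7 (X 0) : Fin 8 → R) i - ∑ k, C (c i k) * r k) * G i = 0 := by
    simp only [sub_mul, Finset.sum_sub_distrib, ← hr]
    rw [Finset.sum_eq_single 7 (fun i _ hi => by simp [hi]) (by simp)]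
    simp
  choose s hs using lin_dvd_of_sum_mul_G_eq_zero hsum
  refine false_of_sub_sum_mul_eq (fun j k => coeff (Finsupp.single k 1) (r j))
    (fun i => coeff 0 (s i)) fun i k => ?_
  rw [← coeff_lin_mul, ← hs, coeff_sub, coeff_sum]
  simp only [coeff_C_mul]
  congr 1
  by_cases hi : i = 7
  · subst hi
    simp [coeff_X, Finsupp.single_left_inj, eq_comm]
  · simp [hi]

theorem finrank_quotient_eq_one {V : Type*} [AddCommGroup V] [Module ℚ V] {A B : Submodule ℚ V}
    {g : V}
    (hgA : g ∈ A) (hgB : g ∉ B) (hAB : ∀ h ∈ A, ∃ γ : ℚ, h - γ • g ∈ B) :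
    Module.finrank ℚ (A ⧸ Submodule.comap A.subtype B) = 1 := by
  refine finrank_eq_one (Submodule.Quotient.mk ⟨g, hgA⟩) ?_ fun w => ?_
  · rw [Ne, Submodule.Quotient.mk_eq_zero]
    exact hgB
  · obtain ⟨⟨h, hh⟩, rfl⟩ := Submodule.Quotient.mk_surjective _ w
    obtain ⟨γ, hγ⟩ := hAB h hh
    refine ⟨γ, ?_⟩
    rw [eq_comm, ← Submodule.Quotient.mk_smul, Submodule.Quotient.eq]
    exact hγ

theorem X_zero_mul_G_seven_isHomogeneous : (X 0 * G 7).IsHomogeneous 8 :=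
  (isHomogeneous_X _ _).mul (G_isHomogeneous 7)

theorem X_zero_mul_G_seven_mem_E : X 0 * G 7 ∈ E := by
  refine ⟨⟨?_, ?_⟩, X_zero_mul_G_seven_isHomogeneous⟩
  · simp only [SetLike.mem_coe, Ideal.mem_iInf]
    exact fun i j _ => X_zero_mul_G_seven_mem _ fun _ => lin_mem_of_mem_span
  · simp only [SetLike.mem_coe, Ideal.mem_iInf]
    intro v _ _
    let W : Submodule ℚ (Fin 4 → ℚ) :=
      { carrier := {a | a ⬝ᵥ v = 0}
        add_mem' := fun {a b} (ha : a ⬝ᵥ v = 0) (hb : b ⬝ᵥ v = 0) => by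
          simp [add_dotProduct, ha, hb]
        zero_mem' := zero_dotProduct v
        smul_mem' := fun s a (ha : a ⬝ᵥ v = 0) => by simp [smul_dotProduct, ha] }
    exact X_zero_mul_G_seven_mem W fun a ha => Ideal.subset_span ⟨a, ha, rfl⟩

/-- `dim_ℚ (I_eq/Jf)^(8) = 1`: the degree-8 homogeneous component of `I_eq`
contains the degree-8 homogeneous component of `Jf` as a codimension-1
subspace, so the octic has a one-dimensional space of equisingular
deformations, in accordance with `h^{1,2} = 1` for arrangement no. 1. -/
theorem family1_one_deformation :
    Module.finrank ℚ (E ⧸ Submodule.comap E.subtype F) = 1 := by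
  refine finrank_quotient_eq_one X_zero_mul_G_seven_mem_E
    (fun h => X_zero_mul_G_seven_notMem_Jf h.1) fun h hE => ?_
  obtain ⟨b, rfl⟩ := exists_lin_eq_sum_mul_G hE.2 fun i j hij => mem_pow_of_mem_E hE hij
  have key {i j k : Fin 8} (hij : i ≠ j) (hik : i ≠ k) (hjk : j ≠ k) {s : ℚ}
      (hc : c k = c i + s • c j) (l : Fin 4) (hi : c i l = 0) (hj : c j l = 0) :
      b k l = b i l + s * b j l := by
    simpa using dotProduct_eq_of_collinear hE hij hik hjk hc (v := Pi.single l 1) (by simp)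
      (by simpa using hi) (by simpa using hj)
  have c4 : c 4 = c 0 + (1 : ℚ) • c 1 := by simp [c]
  have c5 : c 5 = c 1 + (1 : ℚ) • c 2 := by simp [c]
  have c6 : c 6 = c 2 + (1 : ℚ) • c 3 := by simp [c]
  have c7 : c 7 = c 0 + (2 : ℚ) • c 3 := by simp [c]
  have k4 (l : Fin 4) (h0 : c 0 l = 0) (h1 : c 1 l = 0) : b 4 l = b 0 l + b 1 l := by
    simpa using key (by decide) (by decide) (by decide) c4 l h0 h1
  have k5 (l : Fin 4) (h1 : c 1 l = 0) (h2 : c 2 l = 0) : b 5 l = b 1 l + b 2 l := by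
    simpa using key (by decide) (by decide) (by decide) c5 l h1 h2
  have k6 (l : Fin 4) (h2 : c 2 l = 0) (h3 : c 3 l = 0) : b 6 l = b 2 l + b 3 l := by
    simpa using key (by decide) (by decide) (by decide) c6 l h2 h3
  have k7 (l : Fin 4) (h0 : c 0 l = 0) (h3 : c 3 l = 0) : b 7 l = b 0 l + 2 * b 3 l :=
    key (by decide) (by decide) (by decide) c7 l h0 h3
  obtain ⟨γ, hγ⟩ := exists_sub_mem_Jf (k4 2 (by simp [c]) (by simp [c]))
    (k4 3 (by simp [c]) (by simp [c])) (k5 0 (by simp [c]) (by simp [c]))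
    (k5 3 (by simp [c]) (by simp [c])) (k6 0 (by simp [c]) (by simp [c]))
    (k6 1 (by simp [c]) (by simp [c])) (k7 1 (by simp [c]) (by simp [c]))
    (k7 2 (by simp [c]) (by simp [c]))
  refine ⟨γ, ?_, Submodule.sub_mem _ hE.2 (Submodule.smul_mem _ _ X_zero_mul_G_seven_isHomogeneous)⟩
  rwa [smul_eq_C_mul]

end OcticFamily1
end
end

section
/- Let f = (x−t)(x+t)(y−t)(y+t)(z−t)(z+t)(x+2y+2z−t)(x+2y+2z+5t) ∈ ℚ[x,y,z,t], the member of the one-dimensional family no. 82, f = (x−t)(x+t)(y−t)(y+t)(z−t)(z+t)(Ax+By+Bz−At)(Ax+By+Bz+(A+2B)t), with (A,B) = (1,2), and let Jf and I_eq be its Jacobian ideal and equisingular ideal. Then dim_ℚ (I_eq/Jf)^(8) = 1, i.e., the degree-8 homogeneous component of I_eq contains the degree-8 homogeneous component of Jf as a codimension-1 subspace. (Hence this octic has a one-dimensional space of equisingular deformations, in accordance with h^{1,2} = 1 for arrangement no. 82.) -/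
/-!
One-dimensional equisingular deformation space of the double octic of the
one-parameter family no. 82 at `(A,B) = (1,2)`:
for `f = (x−t)(x+t)(y−t)(y+t)(z−t)(z+t)(x+2y+2z−t)(x+2y+2z+5t)` we have `dim_ℚ (I_eq/Jf)^(8) = 1`.
-/

noncomputable section

open Matrix MvPolynomial

namespace OcticFamily82

/-- `R = ℚ[x,y,z,t]` -/
abbrev R : Type := MvPolynomial (Fin 4) ℚ

/-- The linear polynomial with coefficient vector `a`. -/
def lin (a : Fin 4 → ℚ) : R := ∑ j, C (a j) * X j

/-- Coefficient vectors of the eight planes `x−t, x+t, y−t, y+t, z−t, z+t, x+2y+2z−t, x+2y+2z+5t` (family no. 82 with `(A,B) = (1,2)`). -/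
def c : Fin 8 → Fin 4 → ℚ :=
  ![![1,0,0,-1], ![1,0,0,1], ![0,1,0,-1], ![0,1,0,1],
    ![0,0,1,-1], ![0,0,1,1], ![1,2,2,-1], ![1,2,2,5]]

/-- The octic `f = (x−t)(x+t)(y−t)(y+t)(z−t)(z+t)(x+2y+2z−t)(x+2y+2z+5t)`. -/
def f : R := ∏ i, lin (c i)

/-- The Jacobian ideal of `f`. -/
def Jf : Ideal R :=
  Ideal.span {pderiv 0 f, pderiv 1 f, pderiv 2 f, pderiv 3 f}

/-- `m(P)`: the number of the eight planes through the point `v`. -/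
def m (v : Fin 4 → ℚ) : ℕ := {i : Fin 8 | c i ⬝ᵥ v = 0}.ncard

/-- `m(ℓᵢ,ℓⱼ)`: the number of the eight factors lying in the pencil spanned by
`ℓᵢ` and `ℓⱼ` (the multiplicity of `f` along the line `ℓᵢ = ℓⱼ = 0`). -/
def mLine (i j : Fin 8) : ℕ :=
  {k : Fin 8 | c k ∈ Submodule.span ℚ ({c i, c j} : Set (Fin 4 → ℚ))}.ncard

/-- `I_P`: the ideal of the point `v`, generated by all linear forms
vanishing at `v`. -/
def IP (v : Fin 4 → ℚ) : Ideal R :=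
  Ideal.span (lin '' {a : Fin 4 → ℚ | a ⬝ᵥ v = 0})

/-- The equisingular ideal
`I_eq = ⋂ ((ℓ,ℓ′)^{m(ℓ,ℓ′)} + Jf) ∩ ⋂ (I_P^{m(P)} + Jf)`, the first
intersection over all pairs of linearly independent factors, the second over
all points of `ℙ³(ℚ)` lying on at least three of the eight planes. -/
def Ieq : Ideal R :=
  (⨅ (i : Fin 8) (j : Fin 8) (_ : LinearIndependent ℚ ![c i, c j]),
      (Ideal.span {lin (c i), lin (c j)} ^ mLine i j + Jf)) ⊓
  (⨅ (v : Fin 4 → ℚ) (_ : v ≠ 0) (_ : 3 ≤ m v), (IP v ^ m v + Jf))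

/-- The degree-8 homogeneous component of `I_eq`, as a `ℚ`-subspace of
`ℚ[x,y,z,t]`. -/
def E : Submodule ℚ R :=
  Submodule.restrictScalars ℚ Ieq ⊓ homogeneousSubmodule (Fin 4) ℚ 8

/-- The degree-8 homogeneous component of `Jf`, as a `ℚ`-subspace of
`ℚ[x,y,z,t]`. -/
def F : Submodule ℚ R :=
  Submodule.restrictScalars ℚ Jf ⊓ homogeneousSubmodule (Fin 4) ℚ 8

open Finset

section CommRing

variable {S ι : Type*} [CommRing S] [DecidableEq ι]

/-- An element of the ideals `(a, l j)`, `j ∈ s`, lies in the ideal `(a, ∏ l j)`. -/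
lemma exists_eq_mul_add_mul_prod {a : S} {l : ι → S} {s : Finset ι}
    (hprime : ∀ j ∈ s, (Ideal.span {a, l j}).IsPrime)
    (hnot : ∀ i ∈ s, ∀ j ∈ s, i ≠ j → l i ∉ Ideal.span {a, l j})
    {g : S} (hg : ∀ j ∈ s, g ∈ Ideal.span {a, l j}) :
    ∃ u w, g = u * a + w * ∏ j ∈ s, l j := by
  induction s using Finset.induction_on with
  | empty => exact ⟨0, g, by simp⟩
  | insert k t hk ih =>
    obtain ⟨u, w, h⟩ := ih (fun j hj => hprime j (mem_insert_of_mem hj))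
      (fun i hi j hj => hnot i (mem_insert_of_mem hi) j (mem_insert_of_mem hj))
      (fun j hj => hg j (mem_insert_of_mem hj))
    have hP := hprime k (mem_insert_self k t)
    have hw : w * ∏ j ∈ t, l j ∈ Ideal.span {a, l k} := by
      have : w * ∏ j ∈ t, l j = g - u * a := by rw [h]; ring
      rw [this]
      exact sub_mem (hg k (mem_insert_self k t))
        (Ideal.mul_mem_left _ _ (Ideal.subset_span (by simp)))
    rcases hP.mem_or_mem hw with hw | hw
    · obtain ⟨p, q, hpq⟩ := Ideal.mem_span_pair.1 hw
      refine ⟨u + p * ∏ j ∈ t, l j, q, ?_⟩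
      rw [h, ← hpq, prod_insert hk]
      ring
    · obtain ⟨j, hj, hjk⟩ := (hP.prod_mem_iff).1 hw
      exact absurd hjk (hnot j (mem_insert_of_mem hj) k (mem_insert_self k t)
        (ne_of_mem_of_not_mem hj hk))

/-- An element of all the ideals `(l i, l j)` is a combination of the products of all but one
of the `l i`. -/
lemma exists_eq_sum_mul_prod_erase {l : ι → S}
    (hprime : ∀ i j, i ≠ j → (Ideal.span {l i, l j}).IsPrime)
    (hnot : ∀ i j k, i ≠ j → i ≠ k → j ≠ k → l k ∉ Ideal.span {l i, l j})
    {s : Finset ι} (hs : s.Nonempty) {g : S}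
    (hg : ∀ i ∈ s, ∀ j ∈ s, i ≠ j → g ∈ Ideal.span {l i, l j}) :
    ∃ a : ι → S, g = ∑ i ∈ s, a i * ∏ j ∈ s.erase i, l j := by
  induction hs using Finset.Nonempty.cons_induction generalizing g with
  | singleton k => exact ⟨fun _ => g, by simp⟩
  | cons k t hk ht ih =>
    have hne : ∀ i ∈ t, k ≠ i := fun i hi h => hk (h ▸ hi)
    obtain ⟨u, w, h⟩ := exists_eq_mul_add_mul_prod (a := l k) (l := l) (s := t) (g := g)
      (fun j hj => hprime k j (hne j hj))
      (fun i hi j hj hij => hnot k j i (hne j hj) (hne i hi) hij.symm)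
      (fun j hj => hg k (mem_cons_self k t) j (mem_cons_of_mem hj) (hne j hj))
    obtain ⟨a, ha⟩ := ih (g := u) fun i hi j hj hij => by
      have hP := hprime i j hij
      have hu : u * l k ∈ Ideal.span {l i, l j} := by
        have : u * l k = g - w * ∏ j ∈ t, l j := by rw [h]; ring
        rw [this]
        refine sub_mem (hg i (mem_cons_of_mem hi) j (mem_cons_of_mem hj) hij)
          (Ideal.mul_mem_left _ _ ((hP.prod_mem_iff).2 ⟨i, hi, Ideal.subset_span (by simp)⟩))
      exact (hP.mem_or_mem hu).resolve_right
        (hnot i j k hij (hne i hi).symm (hne j hj).symm)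
    refine ⟨Function.update a k w, ?_⟩
    rw [sum_cons, erase_cons, Function.update_self, h, ha, sum_mul, add_comm]
    congr 1
    refine sum_congr rfl fun i hi => ?_
    rw [Function.update_of_ne (hne i hi).symm, cons_eq_insert, erase_insert_of_ne (hne i hi),
      prod_insert (fun h => hk (mem_of_mem_erase h))]
    ring

/-- A product with at least `n` factors in `I` lies in `I ^ n`. -/
lemma prod_mem_pow_of_le_card {I : Ideal S} {u : ι → S} {s t : Finset ι} (hts : t ⊆ s) {n : ℕ}
    (hn : n ≤ #t) (hu : ∀ i ∈ t, u i ∈ I) : ∏ i ∈ s, u i ∈ I ^ n := by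
  rw [← prod_sdiff hts]
  refine Ideal.mul_mem_left _ _ (Ideal.pow_le_pow_right hn ?_)
  rw [← prod_const]
  exact Ideal.prod_mem_prod hu

end CommRing

section Homogeneous

variable {σ K : Type*} [CommRing K]

lemma homogeneousComponent_mul_of_isHomogeneous {d e : ℕ} (p : MvPolynomial σ K)
    {q : MvPolynomial σ K} (hq : q.IsHomogeneous e) :
    homogeneousComponent (d + e) (p * q) = homogeneousComponent d p * q := by
  have h (k : ℕ) : homogeneousComponent (d + e) (homogeneousComponent k p * q) =
      if d = k then homogeneousComponent k p * q else 0 := by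
    rw [homogeneousComponent_of_mem ((homogeneousComponent_isHomogeneous k p).mul hq)]
    simp
  conv_lhs => rw [← sum_homogeneousComponent p, sum_mul, map_sum]
  simp_rw [h]
  rw [sum_ite_eq]
  split_ifs with hd
  · rfl
  · rw [homogeneousComponent_eq_zero, zero_mul]
    simpa using hd

end Homogeneous

lemma lin_add (a b : Fin 4 → ℚ) : lin (a + b) = lin a + lin b := by
  simp [lin, add_mul, sum_add_distrib]

lemma lin_smul (r : ℚ) (a : Fin 4 → ℚ) : lin (r • a) = C r * lin a := by
  simp [lin, mul_sum, mul_assoc]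

lemma lin_sub (a b : Fin 4 → ℚ) : lin (a - b) = lin a - lin b := by
  simp [lin, sub_mul, sum_sub_distrib]

@[simp] lemma lin_zero : lin 0 = 0 := by simp [lin]

lemma eval_lin (v a : Fin 4 → ℚ) : eval v (lin a) = a ⬝ᵥ v := by
  simp [lin, dotProduct]

lemma pderiv_lin (k : Fin 4) (a : Fin 4 → ℚ) : pderiv k (lin a) = C (a k) := by
  simp [lin, pderiv_X, Pi.single_apply]

lemma lin_injective : Function.Injective lin := fun a b h => by
  ext k
  exact C_injective (Fin 4) ℚ (by rw [← pderiv_lin, ← pderiv_lin, h])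

lemma isHomogeneous_lin (a : Fin 4 → ℚ) : (lin a).IsHomogeneous 1 :=
  IsHomogeneous.sum _ _ _ fun j _ => by
    simpa using (isHomogeneous_C (Fin 4) (a j)).mul (isHomogeneous_X ℚ j)

lemma exists_eq_lin_of_isHomogeneous {p : R} (hp : p.IsHomogeneous 1) : ∃ a, p = lin a := by
  refine ⟨fun k => coeff 0 (pderiv k p), ?_⟩
  have h := hp.sum_X_mul_pderiv
  rw [one_smul] at h
  rw [lin, ← h]
  refine sum_congr rfl fun k _ => ?_
  have h0 : (pderiv k p).totalDegree = 0 := (totalDegree_zero_iff_isHomogeneous _).2 hp.pderiv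
  rw [h, ← totalDegree_eq_zero_iff_eq_C.1 h0, mul_comm]

/-- If `α, β` is dual to `a, b`, then `(lin a, lin b)` is the kernel of a substitution. -/
lemma span_pair_lin_eq_ker {a b α β : Fin 4 → ℚ} (haα : a ⬝ᵥ α = 1) (haβ : a ⬝ᵥ β = 0)
    (hbα : b ⬝ᵥ α = 0) (hbβ : b ⬝ᵥ β = 1) :
    ∃ φ : R →ₐ[ℚ] R, (∀ e, φ (lin e) = lin (e - (e ⬝ᵥ α) • a - (e ⬝ᵥ β) • b)) ∧
      Ideal.span {lin a, lin b} = RingHom.ker φ := by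
  let φ : R →ₐ[ℚ] R := aeval fun j => X j - C (α j) * lin a - C (β j) * lin b
  have hφ (e) : φ (lin e) = lin (e - (e ⬝ᵥ α) • a - (e ⬝ᵥ β) • b) := by
    rw [lin_sub, lin_sub, lin_smul, lin_smul, lin, map_sum]
    simp only [φ, map_mul, algHom_C, algebraMap_eq, aeval_X, dotProduct, map_sum, lin, mul_sub,
      sum_sub_distrib, sum_mul, mul_assoc]
  refine ⟨φ, hφ, le_antisymm ?_ fun g hg => ?_⟩
  · rw [Ideal.span_le]
    rintro _ (rfl | rfl)
    · simp [RingHom.mem_ker, hφ, haα, haβ]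
    · simp [RingHom.mem_ker, hφ, hbα, hbβ]
  · have h : (Ideal.Quotient.mkₐ ℚ (Ideal.span {lin a, lin b})).comp φ =
        Ideal.Quotient.mkₐ ℚ (Ideal.span {lin a, lin b}) := by
      refine MvPolynomial.algHom_ext fun j => ?_
      refine Ideal.Quotient.eq.2 ?_
      have : φ (X j) - X j = (- C (α j)) * lin a + (- C (β j)) * lin b := by
        simp only [φ, aeval_X]; ring
      exact Ideal.mem_span_pair.2 ⟨_, _, this.symm⟩
    have h2 := DFunLike.congr_fun h g
    rw [AlgHom.comp_apply, show φ g = 0 from hg, map_zero] at h2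
    exact Ideal.Quotient.eq_zero_iff_mem.1 h2.symm

/-- For linearly independent `a, b`, the vector of `span {a, b}` with `a ⬝ᵥ dual a b = 1` and
`b ⬝ᵥ dual a b = 0`. -/
def dual (a b : Fin 4 → ℚ) : Fin 4 → ℚ :=
  ((a ⬝ᵥ a) * (b ⬝ᵥ b) - (a ⬝ᵥ b) ^ 2)⁻¹ • ((b ⬝ᵥ b) • a - (a ⬝ᵥ b) • b)

lemma c_dotProduct_dual : ∀ i j, i ≠ j →
    c i ⬝ᵥ dual (c i) (c j) = 1 ∧ c i ⬝ᵥ dual (c j) (c i) = 0 := by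
  decide +kernel

/-- No three of the eight planes share a line. -/
lemma c_sub_ne_zero : ∀ i j k, i ≠ j → i ≠ k → j ≠ k →
    c k - (c k ⬝ᵥ dual (c i) (c j)) • c i - (c k ⬝ᵥ dual (c j) (c i)) • c j ≠ 0 := by
  decide +kernel

lemma span_pair_c_isPrime {i j : Fin 8} (hij : i ≠ j) :
    (Ideal.span {lin (c i), lin (c j)}).IsPrime := by
  obtain ⟨φ, -, h⟩ := span_pair_lin_eq_ker (c_dotProduct_dual i j hij).1
    (c_dotProduct_dual i j hij).2 (c_dotProduct_dual j i hij.symm).2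
    (c_dotProduct_dual j i hij.symm).1
  rw [h]
  exact RingHom.ker_isPrime _

lemma lin_c_notMem_span_pair {i j k : Fin 8} (hij : i ≠ j) (hik : i ≠ k) (hjk : j ≠ k) :
    lin (c k) ∉ Ideal.span {lin (c i), lin (c j)} := by
  obtain ⟨φ, hφ, h⟩ := span_pair_lin_eq_ker (c_dotProduct_dual i j hij).1
    (c_dotProduct_dual i j hij).2 (c_dotProduct_dual j i hij.symm).2
    (c_dotProduct_dual j i hij.symm).1
  intro hk
  rw [h, RingHom.mem_ker, hφ, ← lin_zero] at hk
  exact c_sub_ne_zero i j k hij hik hjk (lin_injective hk)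

lemma mLine_eq_two {i j : Fin 8} (hij : i ≠ j) : mLine i j = 2 := by
  rw [mLine, ← Set.ncard_pair hij]
  congr 1
  ext k
  refine ⟨fun hk => ?_, ?_⟩
  · by_contra h
    simp only [Set.mem_insert_iff, Set.mem_singleton_iff, not_or] at h
    obtain ⟨p, q, hpq⟩ := Submodule.mem_span_pair.1 hk
    refine c_sub_ne_zero i j k hij (Ne.symm h.1) (Ne.symm h.2) ?_
    rw [← hpq]
    simp [(c_dotProduct_dual i j hij).1, (c_dotProduct_dual i j hij).2,
      (c_dotProduct_dual j i hij.symm).1, (c_dotProduct_dual j i hij.symm).2]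
  · rintro (rfl | rfl) <;> exact Submodule.subset_span (by simp)

/-- The quotient of the octic `f` by its `i`-th factor. -/
def cofactor (i : Fin 8) : R := ∏ j ∈ univ.erase i, lin (c j)

lemma lin_mul_cofactor (i : Fin 8) : lin (c i) * cofactor i = f :=
  mul_prod_erase _ _ (mem_univ i)

lemma isHomogeneous_cofactor (i : Fin 8) : (cofactor i).IsHomogeneous 7 := by
  have h := IsHomogeneous.prod (univ.erase i) (fun j => lin (c j)) (fun _ => 1)
    fun j _ => isHomogeneous_lin (c j)
  simpa [cofactor] using h

lemma isHomogeneous_f : f.IsHomogeneous 8 := by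
  have h := IsHomogeneous.prod univ (fun j => lin (c j)) (fun _ => 1)
    fun j _ => isHomogeneous_lin (c j)
  simpa [f] using h

lemma pderiv_prod_lin (k : Fin 4) {ι : Type*} [DecidableEq ι] (a : ι → Fin 4 → ℚ)
    (s : Finset ι) : pderiv k (∏ i ∈ s, lin (a i)) =
      ∑ i ∈ s, C (a i k) * ∏ j ∈ s.erase i, lin (a j) := by
  induction s using Finset.induction_on with
  | empty => simp
  | insert i s hi ih =>
    rw [prod_insert hi, Derivation.leibniz, pderiv_lin, ih, sum_insert hi, erase_insert hi,
      smul_eq_mul, smul_eq_mul, mul_sum, add_comm, mul_comm]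
    congr 1
    refine sum_congr rfl fun j hj => ?_
    have hij : i ≠ j := fun h => hi (h ▸ hj)
    rw [erase_insert_of_ne hij, prod_insert fun h => hi (mem_of_mem_erase h)]
    ring

lemma pderiv_f (k : Fin 4) : pderiv k f = ∑ i, C (c i k) * cofactor i :=
  pderiv_prod_lin k c univ

lemma sum_mul_pderiv_f (b : Fin 4 → R) :
    ∑ k, b k * pderiv k f = ∑ i, (∑ k, C (c i k) * b k) * cofactor i := by
  simp_rw [pderiv_f, mul_sum, sum_mul]
  rw [sum_comm]
  exact sum_congr rfl fun i _ => sum_congr rfl fun k _ => by ring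

lemma mem_Jf_iff {g : R} : g ∈ Jf ↔ ∃ b : Fin 4 → R, g = ∑ k, b k * pderiv k f := by
  have h : Jf = Ideal.span (Set.range fun k => pderiv k f) := by
    rw [Jf]
    congr 1
    ext p
    simp [Fin.exists_fin_succ, eq_comm]
  rw [h, Ideal.mem_span_range_iff_exists_fun]
  simp only [eq_comm]

lemma f_mem_Jf : f ∈ Jf := by
  have h : C (8 : ℚ) * f ∈ Jf := by
    rw [mem_Jf_iff]
    refine ⟨X, ?_⟩
    rw [isHomogeneous_f.sum_X_mul_pderiv]
    simpa using Or.inl (map_ofNat C 8)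
  have h2 := Ideal.mul_mem_left _ (C (1 / 8 : ℚ)) h
  rwa [← mul_assoc, ← C_mul, show (1 / 8 * 8 : ℚ) = 1 by norm_num, C_1, one_mul] at h2

lemma Jf_le_span_pair {i j : Fin 8} (hij : i ≠ j) :
    Jf ≤ Ideal.span {lin (c i), lin (c j)} := by
  intro g hg
  obtain ⟨b, rfl⟩ := mem_Jf_iff.1 hg
  rw [sum_mul_pderiv_f]
  refine sum_mem fun k _ => Ideal.mul_mem_left _ _ ?_
  by_cases hk : k = i
  · exact Ideal.mem_of_dvd _ (dvd_prod_of_mem _ (by simp [hk, hij.symm] : j ∈ univ.erase k))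
      (Ideal.subset_span (by simp))
  · exact Ideal.mem_of_dvd _ (dvd_prod_of_mem _ (by simp [Ne.symm hk] : i ∈ univ.erase k))
      (Ideal.subset_span (by simp))

/-- Points `genericPoint i` lying on the `i`-th plane only. -/
def genericPoint : Fin 8 → Fin 4 → ℚ :=
  ![![-1, -2, 0, -1], ![-1, 0, 0, 1], ![0, -1, 0, -1], ![0, -1, 0, 1],
    ![0, 0, -1, -1], ![0, 0, -1, 1], ![0, -1, 0, -2], ![-3, 2, 2, -1]]

lemma c_dotProduct_genericPoint : ∀ i j, c i ⬝ᵥ genericPoint j = 0 ↔ i = j := by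
  decide +kernel

lemma m_eq_card (v : Fin 4 → ℚ) : m v = #{i | c i ⬝ᵥ v = 0} := by
  rw [m, ← Set.ncard_coe_finset]
  simp

/-- Restriction of polynomials to the line through `v` in the direction `e`. -/
def restrictLine (v e : Fin 4 → ℚ) : R →ₐ[ℚ] Polynomial ℚ :=
  aeval fun j => Polynomial.C (v j) + Polynomial.C (e j) * Polynomial.X

lemma restrictLine_lin (v e a : Fin 4 → ℚ) : restrictLine v e (lin a) =
    Polynomial.C (a ⬝ᵥ v) + Polynomial.C (a ⬝ᵥ e) * Polynomial.X := by
  simp only [restrictLine, lin, map_sum, map_mul, algHom_C, Polynomial.algebraMap_eq, aeval_X,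
    mul_add, sum_add_distrib, dotProduct, sum_mul, mul_assoc]

lemma eval_zero_restrictLine (v e : Fin 4 → ℚ) (g : R) :
    (restrictLine v e g).eval 0 = eval v g := by
  have h : (Polynomial.aeval (0 : ℚ)).comp (restrictLine v e) = aeval v :=
    MvPolynomial.algHom_ext fun j => by simp [restrictLine]
  simpa [aeval_eq_eval] using DFunLike.congr_fun h g

lemma X_pow_dvd_restrictLine {v : Fin 4 → ℚ} (e : Fin 4 → ℚ) {n : ℕ} {g : R}
    (hg : g ∈ IP v ^ n) : Polynomial.X ^ n ∣ restrictLine v e g := by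
  have h : (IP v).map (restrictLine v e) ≤ Ideal.span {Polynomial.X} := by
    rw [IP, Ideal.map_span, Ideal.span_le]
    rintro _ ⟨_, ⟨a, ha, rfl⟩, rfl⟩
    rw [Set.mem_ofPred_eq] at ha
    exact Ideal.mem_span_singleton.2 ⟨Polynomial.C (a ⬝ᵥ e), by
      rw [restrictLine_lin, ha, Polynomial.C_0, zero_add, mul_comm]⟩
  have h2 := Ideal.pow_right_mono h n
  rw [← Ideal.map_pow, Ideal.span_singleton_pow] at h2
  exact Ideal.mem_span_singleton.1 (h2 (Ideal.mem_map_of_mem _ hg))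

lemma not_X_pow_dvd_restrictLine_cofactor {v : Fin 4 → ℚ} {i : Fin 8} (hi : c i ⬝ᵥ v = 0) :
    ¬ Polynomial.X ^ m v ∣ restrictLine v (genericPoint i) (cofactor i) := by
  classical
  have hX := Polynomial.prime_X (R := ℚ)
  have hfac : ∀ j ∈ univ.erase i, emultiplicity Polynomial.X
      (restrictLine v (genericPoint i) (lin (c j))) = if c j ⬝ᵥ v = 0 then 1 else 0 := by
    intro j hj
    have hjg : c j ⬝ᵥ genericPoint i ≠ 0 := fun h =>
      (ne_of_mem_erase hj) ((c_dotProduct_genericPoint j i).1 h)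
    rw [restrictLine_lin]
    split_ifs with h0
    · have hC : emultiplicity Polynomial.X (Polynomial.C (c j ⬝ᵥ genericPoint i)) = 0 := by
        simpa [emultiplicity_eq_zero, Polynomial.X_dvd_iff] using hjg
      have hself := emultiplicity_pow_self_of_prime hX 1
      rw [pow_one] at hself
      rw [h0, Polynomial.C_0, zero_add, emultiplicity_mul hX, hC, hself]
      simp
    · rw [emultiplicity_eq_zero, Polynomial.X_dvd_iff]
      simpa using h0
  rw [cofactor, map_prod, pow_dvd_iff_le_emultiplicity, Finset.emultiplicity_prod hX,
    sum_congr rfl hfac, sum_boole, m_eq_card, ← card_erase_add_one (a := i) (by simpa using hi),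
    not_le, ← filter_erase]
  exact_mod_cast Nat.lt_succ_self _

/-- Modulo `I_P ^ m(P)`, the value at `P` of the `i`-th coefficient of a combination of the
cofactors is well defined for every plane through `P`. -/
lemma dotProduct_eq_of_add_eq {A : Fin 8 → Fin 4 → ℚ} {v : Fin 4 → ℚ} {p : R} {b : Fin 4 → R}
    (hp : p ∈ IP v ^ m v)
    (hpq : p + ∑ k, b k * pderiv k f = ∑ i, lin (A i) * cofactor i) {i : Fin 8}
    (hi : c i ⬝ᵥ v = 0) : A i ⬝ᵥ v = c i ⬝ᵥ fun k => eval v (b k) := by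
  set ψ := restrictLine v (genericPoint i)
  have hψ (a : Fin 8 → R) : ψ (∑ j, a j * cofactor j) = ψ (a i) * ψ (cofactor i) := by
    rw [map_sum, sum_eq_single i _ (by simp), map_mul]
    intro j _ hj
    have h0 : ψ (cofactor j) = 0 := by
      rw [cofactor, map_prod]
      refine prod_eq_zero (i := i) (by simp [hj.symm]) ?_
      rw [restrictLine_lin, hi, (c_dotProduct_genericPoint i i).2 rfl]
      simp
    rw [map_mul, h0, mul_zero]
  have hdvd : Polynomial.X ^ m v ∣
      ψ (lin (A i) - ∑ k, C (c i k) * b k) * ψ (cofactor i) := by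
    rw [map_sub, sub_mul, ← hψ fun i => lin (A i), ← hψ fun i => ∑ k, C (c i k) * b k,
      ← sum_mul_pderiv_f, ← map_sub, ← hpq, add_sub_cancel_right]
    exact X_pow_dvd_restrictLine _ hp
  have hroot : Polynomial.X ∣ ψ (lin (A i) - ∑ k, C (c i k) * b k) := by
    by_contra hn
    exact not_X_pow_dvd_restrictLine_cofactor hi
      (Polynomial.prime_X.pow_dvd_of_dvd_mul_left _ hn hdvd)
  rw [Polynomial.X_dvd_iff, Polynomial.coeff_zero_eq_eval_zero, eval_zero_restrictLine] at hroot
  simpa [eval_lin, sub_eq_zero, dotProduct] using hroot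

lemma exists_dotProduct_eq_of_mem {A : Fin 8 → Fin 4 → ℚ} {v : Fin 4 → ℚ}
    (h : ∑ i, lin (A i) * cofactor i ∈ IP v ^ m v + Jf) :
    ∃ w, ∀ i, c i ⬝ᵥ v = 0 → A i ⬝ᵥ v = c i ⬝ᵥ w := by
  obtain ⟨p, hp, q, hq, hpq⟩ := Submodule.mem_sup.1 h
  obtain ⟨b, rfl⟩ := mem_Jf_iff.1 hq
  exact ⟨fun k => eval v (b k), fun i hi => dotProduct_eq_of_add_eq hp hpq hi⟩

lemma exists_eq_sum_lin_mul_cofactor {g : R} (hg : g ∈ E) :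
    ∃ A : Fin 8 → Fin 4 → ℚ, g = ∑ i, lin (A i) * cofactor i := by
  obtain ⟨⟨hlines, -⟩, hdeg⟩ := hg
  have hmem (i j : Fin 8) (hij : i ≠ j) : g ∈ Ideal.span {lin (c i), lin (c j)} := by
    have hli : LinearIndependent ℚ ![c i, c j] := by
      rw [LinearIndependent.pair_iff]
      intro p q hpq
      have h1 := congrArg (· ⬝ᵥ dual (c i) (c j)) hpq
      have h2 := congrArg (· ⬝ᵥ dual (c j) (c i)) hpq
      simpa [(c_dotProduct_dual i j hij).1, (c_dotProduct_dual i j hij).2,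
        (c_dotProduct_dual j i hij.symm).1, (c_dotProduct_dual j i hij.symm).2,
        add_dotProduct] using And.intro h1 h2
    have h := hlines
    simp only [SetLike.mem_coe, Ideal.mem_iInf] at h
    have h := h i j hli
    rw [mLine_eq_two hij] at h
    exact sup_le (Ideal.pow_le_self two_ne_zero) (Jf_le_span_pair hij) h
  obtain ⟨a, ha⟩ := exists_eq_sum_mul_prod_erase (l := fun i => lin (c i))
    (fun i j hij => span_pair_c_isPrime hij)
    (fun i j k hij hik hjk => lin_c_notMem_span_pair hij hik hjk)
    univ_nonempty (fun i _ j _ hij => hmem i j hij)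
  choose A hA using fun i =>
    exists_eq_lin_of_isHomogeneous (homogeneousComponent_isHomogeneous 1 (a i))
  refine ⟨A, ?_⟩
  have h8 : homogeneousComponent (1 + 7) g = g := homogeneousComponent_eq_self hdeg
  rw [← h8, ha, map_sum]
  refine sum_congr rfl fun i _ => ?_
  rw [← hA]
  exact homogeneousComponent_mul_of_isHomogeneous _ (isHomogeneous_cofactor i)

/-- The derivatives of the eight linear forms `x−t, …, Ax+By+Bz−At, Ax+By+Bz+(A+2B)t` with respect
to the parameter `B`. -/
def cDeriv : Fin 8 → Fin 4 → ℚ :=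
  ![0, 0, 0, 0, 0, 0, ![0, 1, 1, 0], ![0, 1, 1, 2]]

/-- The derivative of the family of octics with respect to the parameter `B`. -/
def fDeriv : R := ∑ i, lin (cDeriv i) * cofactor i

lemma sum_mul_dotProduct_eq_zero {A : Fin 8 → Fin 4 → ℚ}
    (hA : ∀ v, v ≠ 0 → 3 ≤ m v → ∃ w, ∀ i, c i ⬝ᵥ v = 0 → A i ⬝ᵥ v = c i ⬝ᵥ w)
    {v : Fin 4 → ℚ} {ρ : Fin 8 → ℚ} (hv : v ≠ 0) (hm : 3 ≤ m v)
    (hρ : ∀ i, ρ i = 0 ∨ c i ⬝ᵥ v = 0) (hrel : ∑ i, ρ i • c i = 0) :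
    ∑ i, ρ i * (A i ⬝ᵥ v) = 0 := by
  obtain ⟨w, hw⟩ := hA v hv hm
  calc ∑ i, ρ i * (A i ⬝ᵥ v) = ∑ i, ρ i * (c i ⬝ᵥ w) := by
        refine sum_congr rfl fun i _ => ?_
        rcases hρ i with h | h
        · simp [h]
        · rw [hw i h]
    _ = (∑ i, ρ i • c i) ⬝ᵥ w := by simp [sum_dotProduct]
    _ = 0 := by rw [hrel, zero_dotProduct]

set_option maxHeartbeats 1000000 in
/-- A first-order deformation of the eight planes which preserves the incidences at the points of
multiplicity four is a combination of the given family, a linear coordinate change and a rescaling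
of the equations. -/
lemma exists_eq_smul_add_sum_add {A : Fin 8 → Fin 4 → ℚ}
    (hA : ∀ v, v ≠ 0 → 3 ≤ m v → ∃ w, ∀ i, c i ⬝ᵥ v = 0 → A i ⬝ᵥ v = c i ⬝ᵥ w) :
    ∃ (r : ℚ) (θ : Fin 4 → Fin 4 → ℚ) (μ : Fin 8 → ℚ),
      ∀ i, A i = r • cDeriv i + ∑ k, c i k • θ k + μ i • c i := by
  have h1 := sum_mul_dotProduct_eq_zero hA (v := ![0, 0, 1, 0])
    (ρ := ![1, -1, -1, 1, 0, 0, 0, 0])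
    (by decide +kernel) (by rw [m_eq_card]; decide +kernel) (by decide +kernel) (by decide +kernel)
  have h2 := sum_mul_dotProduct_eq_zero hA (v := ![0, 1, 0, 0])
    (ρ := ![1, -1, 0, 0, -1, 1, 0, 0])
    (by decide +kernel) (by rw [m_eq_card]; decide +kernel) (by decide +kernel) (by decide +kernel)
  have h3 := sum_mul_dotProduct_eq_zero hA (v := ![0, -1, 1, 0])
    (ρ := ![3, -3, 0, 0, 0, 0, -1, 1])
    (by decide +kernel) (by rw [m_eq_card]; decide +kernel) (by decide +kernel) (by decide +kernel)
  have h4 := sum_mul_dotProduct_eq_zero hA (v := ![1, 1, -1, 1])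
    (ρ := ![-1, 0, -2, 0, 0, -2, 1, 0])
    (by decide +kernel) (by rw [m_eq_card]; decide +kernel) (by decide +kernel) (by decide +kernel)
  have h5 := sum_mul_dotProduct_eq_zero hA (v := ![1, -1, 1, 1])
    (ρ := ![-1, 0, 0, -2, -2, 0, 1, 0])
    (by decide +kernel) (by rw [m_eq_card]; decide +kernel) (by decide +kernel) (by decide +kernel)
  have h6 := sum_mul_dotProduct_eq_zero hA (v := ![-1, -1, -1, 1])
    (ρ := ![0, -1, 0, -2, 0, -2, 0, 1])
    (by decide +kernel) (by rw [m_eq_card]; decide +kernel) (by decide +kernel) (by decide +kernel)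
  have h7 := sum_mul_dotProduct_eq_zero hA (v := ![1, 0, 0, 0])
    (ρ := ![0, 0, 1, -1, -1, 1, 0, 0])
    (by decide +kernel) (by rw [m_eq_card]; decide +kernel) (by decide +kernel) (by decide +kernel)
  have h8 := sum_mul_dotProduct_eq_zero hA (v := ![-2, 0, 1, 0])
    (ρ := ![0, 0, 3, -3, 0, 0, -1, 1])
    (by decide +kernel) (by rw [m_eq_card]; decide +kernel) (by decide +kernel) (by decide +kernel)
  simp [Fin.sum_univ_succ, dotProduct, Fin.succ_one_eq_two] at h1 h2 h3 h4 h5 h6 h7 h8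
  refine ⟨A 0 0 + A 0 3 + A 1 0 - A 1 1 - A 1 3 + A 2 0
      - A 2 1 - A 2 3 + 3 * A 3 0 - A 3 1 + A 3 3 + 4 * A 4 0 - 2 * A 4 1 - 2 * A 6 0 + A 6 1,
    ![![(A 0 0 + A 0 3 + A 1 0 - A 1 3) / 2,
        (A 0 1 + A 1 1) / 2,
        (A 0 2 + A 1 2) / 2,
        (A 0 0 + A 0 3 - A 1 0 + A 1 3 - A 2 0 + A 3 0) / 2],
      ![(A 2 0 + A 3 0) / 2,
        (A 2 1 + A 2 3 + A 3 1 - A 3 3) / 2,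
        (A 2 2 + A 3 2) / 2,
        (-A 0 1 + A 1 1 + A 2 1 + A 2 3 - A 3 1 + A 3 3) / 2],
      ![(A 4 0 + A 5 0) / 2,
        (A 4 1 + A 5 1) / 2,
        (A 4 2 + A 4 3 + A 5 2 - A 5 3) / 2,
        (-A 0 2 + A 1 2 + A 4 2 + A 4 3 - A 5 2 + A 5 3) / 2],
      ![(-A 2 0 + A 3 0) / 2,
        (-A 0 1 + A 1 1) / 2,
        (-A 0 2 + A 1 2) / 2,
        0]],
    ![(A 0 0 - A 0 3 - A 1 0 + A 1 3 - A 2 0 + A 3 0) / 2,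
      (-A 0 0 - A 0 3 + A 1 0 + A 1 3 + A 2 0 - A 3 0) / 2,
      (-A 0 1 + A 1 1 + A 2 1 - A 2 3 - A 3 1 + A 3 3) / 2,
      (A 0 1 - A 1 1 - A 2 1 - A 2 3 + A 3 1 + A 3 3) / 2,
      (-A 0 2 + A 1 2 + A 4 2 - A 4 3 - A 5 2 + A 5 3) / 2,
      (A 0 2 - A 1 2 - A 4 2 - A 4 3 + A 5 2 + A 5 3) / 2,
      (-A 0 0 - A 0 3 - A 1 0 + A 1 3 - A 2 0 - 3 * A 3 0 - 4 * A 4 0 + 2 * A 6 0) / 2,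
      (-A 0 0 - A 0 3 - A 1 0 + A 1 3 + A 2 0 - 5 * A 3 0 - 4 * A 5 0 + 2 * A 7 0) / 2], ?_⟩
  intro i
  ext l
  fin_cases i <;> fin_cases l <;> simp [Fin.sum_univ_succ, c, cDeriv] <;> linarith

lemma fDeriv_isHomogeneous : fDeriv.IsHomogeneous 8 :=
  IsHomogeneous.sum _ _ _ fun i _ => (isHomogeneous_lin (cDeriv i)).mul (isHomogeneous_cofactor i)

/-- If the planes in `t` contain the centre of `I` and the deformation `fDeriv` is, along them,
induced by the vector field `θ` modulo `I`, then `fDeriv` is equisingular along the centre of `I`. -/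
lemma fDeriv_mem_pow_add_Jf {I : Ideal R} {t : Finset (Fin 8)} {n : ℕ} (hn : n ≤ #t)
    (hI : ∀ i ∈ t, lin (c i) ∈ I) (θ : Fin 4 → R)
    (hθ : ∀ i ∈ t, lin (cDeriv i) - ∑ k, C (c i k) * θ k ∈ I) : fDeriv ∈ I ^ n + Jf := by
  refine Submodule.mem_sup.2 ⟨∑ i, (lin (cDeriv i) - ∑ k, C (c i k) * θ k) * cofactor i,
    sum_mem fun i _ => ?_, ∑ k, θ k * pderiv k f, mem_Jf_iff.2 ⟨θ, rfl⟩, ?_⟩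
  · have h := prod_update_of_mem (mem_univ i) (fun j => lin (c j))
      (lin (cDeriv i) - ∑ k, C (c i k) * θ k)
    rw [sdiff_singleton_eq_erase] at h
    rw [cofactor, ← h]
    refine prod_mem_pow_of_le_card (subset_univ t) hn fun j hj => ?_
    by_cases hji : j = i
    · subst hji
      rw [Function.update_self]
      exact hθ j hj
    · rw [Function.update_of_ne hji]
      exact hI j hj
  · rw [sum_mul_pderiv_f, ← sum_add_distrib, fDeriv]
    exact sum_congr rfl fun i _ => by ring

/-- To first order, the planes through a point still have a common point after deformation. -/
lemma exists_cDeriv_dotProduct_eq (v : Fin 4 → ℚ) :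
    ∃ w, ∀ i, c i ⬝ᵥ v = 0 → cDeriv i ⬝ᵥ v = c i ⬝ᵥ w := by
  obtain ⟨τ, h1, h2⟩ : ∃ τ : ℚ, (v 0 + 2 * v 1 + 2 * v 2 - v 3 = 0 → v 1 + v 2 = τ) ∧
      (v 0 + 2 * v 1 + 2 * v 2 + 5 * v 3 = 0 → v 1 + v 2 + 2 * v 3 = τ) := by
    by_cases h : v 0 + 2 * v 1 + 2 * v 2 - v 3 = 0
    · exact ⟨v 1 + v 2, fun _ => rfl, fun _ => by linarith⟩
    · exact ⟨v 1 + v 2 + 2 * v 3, fun hz => absurd hz h, fun _ => rfl⟩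
  by_cases hv0 : v 0 - v 3 ≠ 0 ∧ v 0 + v 3 ≠ 0
  · refine ⟨![τ, 0, 0, 0], fun i hi => ?_⟩
    fin_cases i <;> simp [Fin.sum_univ_succ, dotProduct, c, cDeriv] at hi ⊢ <;> grind
  by_cases hv1 : v 1 - v 3 ≠ 0 ∧ v 1 + v 3 ≠ 0
  · refine ⟨![0, τ / 2, 0, 0], fun i hi => ?_⟩
    fin_cases i <;> simp [Fin.sum_univ_succ, dotProduct, c, cDeriv] at hi ⊢ <;> grind
  by_cases hv2 : v 2 - v 3 ≠ 0 ∧ v 2 + v 3 ≠ 0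
  · refine ⟨![0, 0, τ / 2, 0], fun i hi => ?_⟩
    fin_cases i <;> simp [Fin.sum_univ_succ, dotProduct, c, cDeriv] at hi ⊢ <;> grind
  refine ⟨0, fun i hi => ?_⟩
  fin_cases i <;> simp [Fin.sum_univ_succ, dotProduct, c, cDeriv] at hi ⊢ <;> grind

lemma fDeriv_mem_Ieq : fDeriv ∈ Ieq := by
  rw [Ieq]
  refine ⟨?_, ?_⟩
  · simp only [SetLike.mem_coe, Ideal.mem_iInf]
    intro i j hli
    have hij : i ≠ j := by
      rintro rfl
      simpa using hli.injective.ne (show (0 : Fin 2) ≠ 1 by decide)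
    rw [mLine_eq_two hij]
    refine fDeriv_mem_pow_add_Jf (t := {i, j}) (card_pair hij).ge ?_ (fun k =>
      C (dual (c i) (c j) k) * lin (cDeriv i) + C (dual (c j) (c i) k) * lin (cDeriv j))
      fun k hk => ?_
    · simp only [mem_insert, mem_singleton]
      rintro k (rfl | rfl) <;> exact Ideal.subset_span (by simp)
    · have h : ∑ l, C (c k l) * (C (dual (c i) (c j) l) * lin (cDeriv i) +
          C (dual (c j) (c i) l) * lin (cDeriv j)) =
          C (c k ⬝ᵥ dual (c i) (c j)) * lin (cDeriv i) +
            C (c k ⬝ᵥ dual (c j) (c i)) * lin (cDeriv j) := by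
        simp only [dotProduct, map_sum, sum_mul, map_mul, mul_add, sum_add_distrib, mul_assoc]
      rw [h]
      simp only [mem_insert, mem_singleton] at hk
      rcases hk with rfl | rfl
      · simp [(c_dotProduct_dual k j hij).1, (c_dotProduct_dual k j hij).2]
      · simp [(c_dotProduct_dual k i hij.symm).1, (c_dotProduct_dual k i hij.symm).2]
  · simp only [SetLike.mem_coe, Ideal.mem_iInf]
    intro v hv _
    obtain ⟨w, hw⟩ := exists_cDeriv_dotProduct_eq v
    refine fDeriv_mem_pow_add_Jf (t := {i | c i ⬝ᵥ v = 0}) (m_eq_card v).le (fun i hi => ?_)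
      (fun k => lin (w k • (v ⬝ᵥ v)⁻¹ • v)) fun i hi => ?_
    · exact Ideal.subset_span ⟨c i, by simpa using hi, rfl⟩
    · have h : ∑ k, C (c i k) * lin (w k • (v ⬝ᵥ v)⁻¹ • v) =
          lin ((c i ⬝ᵥ w) • (v ⬝ᵥ v)⁻¹ • v) := by
        simp only [lin_smul, dotProduct, map_sum, sum_mul, map_mul, mul_assoc]
      rw [h, ← lin_sub]
      have hvv : v ⬝ᵥ v ≠ 0 := by simpa using hv
      refine Ideal.subset_span ⟨_, ?_, rfl⟩
      rw [Set.mem_ofPred_eq, sub_dotProduct, smul_dotProduct, smul_dotProduct, smul_eq_mul,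
        smul_eq_mul, inv_mul_cancel₀ hvv, mul_one, hw i (by simpa using hi), sub_self]

lemma fDeriv_notMem_Jf : fDeriv ∉ Jf := by
  intro h
  obtain ⟨b, hb⟩ := mem_Jf_iff.1 h
  choose B hB using fun k =>
    exists_eq_lin_of_isHomogeneous (homogeneousComponent_isHomogeneous 1 (b k))
  have hfB : fDeriv = ∑ k, lin (B k) * pderiv k f := by
    have h8 : homogeneousComponent (1 + 7) fDeriv = fDeriv :=
      homogeneousComponent_eq_self fDeriv_isHomogeneous
    rw [← h8, hb, map_sum]
    refine sum_congr rfl fun k _ => ?_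
    rw [← hB]
    exact homogeneousComponent_mul_of_isHomogeneous _ isHomogeneous_f.pderiv
  have key (v : Fin 4 → ℚ) (i : Fin 8) (hi : c i ⬝ᵥ v = 0) :
      cDeriv i ⬝ᵥ v = c i ⬝ᵥ fun k => B k ⬝ᵥ v := by
    have := dotProduct_eq_of_add_eq (A := cDeriv) (v := v) (p := 0) (b := fun k => lin (B k))
      (zero_mem _) (by rw [zero_add, ← hfB, fDeriv]) hi
    simpa only [eval_lin] using this
  have h1 := key ![0, 0, 1, 0] 0 (by decide +kernel)
  have h2 := key ![1, -1, -1, -1] 1 (by decide +kernel)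
  have h3 := key ![0, 0, 1, 0] 2 (by decide +kernel)
  have h4 := key ![1, -1, 1, -1] 2 (by decide +kernel)
  have h5 := key ![1, -1, -1, -1] 4 (by decide +kernel)
  have h6 := key ![1, -1, 1, -1] 5 (by decide +kernel)
  have h7 := key ![1, -1, 0, -1] 6 (by decide +kernel)
  simp [Fin.sum_univ_succ, dotProduct, c, cDeriv] at h1 h2 h3 h4 h5 h6 h7
  linarith

/-- `dim_ℚ (I_eq/Jf)^(8) = 1`: the degree-8 homogeneous component of `I_eq`
contains the degree-8 homogeneous component of `Jf` as a codimension-1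
subspace, so the octic has a one-dimensional space of equisingular
deformations, in accordance with `h^{1,2} = 1` for arrangement no. 82. -/
theorem family82_one_deformation :
    Module.finrank ℚ (E ⧸ Submodule.comap E.subtype F) = 1 := by
  have hE : fDeriv ∈ E := ⟨fDeriv_mem_Ieq, fDeriv_isHomogeneous⟩
  refine finrank_eq_one (Submodule.Quotient.mk ⟨fDeriv, hE⟩) (fun h => ?_) fun q => ?_
  · rw [Submodule.Quotient.mk_eq_zero] at h
    exact fDeriv_notMem_Jf h.1
  · obtain ⟨⟨g, hg⟩, rfl⟩ := Submodule.Quotient.mk_surjective _ q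
    obtain ⟨A, rfl⟩ := exists_eq_sum_lin_mul_cofactor hg
    obtain ⟨r, θ, μ, hA⟩ := exists_eq_smul_add_sum_add (A := A) fun v hv hm =>
      exists_dotProduct_eq_of_mem (by
        have h := hg.1.2
        simp only [SetLike.mem_coe, Ideal.mem_iInf] at h
        exact h v hv hm)
    refine ⟨r, ?_⟩
    rw [← Submodule.Quotient.mk_smul, eq_comm, Submodule.Quotient.eq]
    refine ⟨?_, (E.sub_mem hg (E.smul_mem r hE)).2⟩
    have h : ∑ i, lin (A i) * cofactor i - r • fDeriv =
        ∑ k, lin (θ k) * pderiv k f + C (∑ i, μ i) * f := by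
      rw [sum_mul_pderiv_f, fDeriv, smul_sum, ← sum_sub_distrib, map_sum, sum_mul,
        ← sum_add_distrib]
      refine sum_congr rfl fun i _ => ?_
      have hs : lin (∑ k, c i k • θ k) = ∑ k, C (c i k) * lin (θ k) := by
        simp only [Fin.sum_univ_four, lin_add, lin_smul]
      rw [hA i, lin_add, lin_add, lin_smul, lin_smul, hs, smul_eq_C_mul, ← lin_mul_cofactor i]
      ring
    change ∑ i, lin (A i) * cofactor i - r • fDeriv ∈ Jf
    rw [h]
    exact add_mem (mem_Jf_iff.2 ⟨_, rfl⟩) (Ideal.mul_mem_left _ _ f_mem_Jf)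

end OcticFamily82
end
end
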